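/- Let 1 ≤ p < ∞. A proper closed subspace M of H^p is invariant under the backward shift operator f ↦ (f−f(0))/z if and only if there exists an inner function ϑ such that M = K^p_ϑ = H^p ∩ ϑ·conj(H^p_0). -/

import Mathlib

open MeasureTheory Complex Filter Set Metric Polynomial

noncomputable section

/-- Normalized arc-length measure on the unit circle 𝕋, realized on the
parameter interval `(0, 2π]` via `θ ↦ e^{iθ}`. -/
def arcM : Measure ℝ :=
  (ENNReal.ofReal (2 * Real.pi))⁻¹ • (volume.restrict (Set.Ioc 0 (2 * Real.pi)))

/-- The open unit disc 𝔻 ⊆ ℂ. -/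
def uDisc : Set ℂ := Metric.ball 0 1

/-- The unit circle 𝕋 ⊆ ℂ. -/
def uCircle : Set ℂ := Metric.sphere 0 1

/-- The boundary point `e^{iθ}`. -/
def bpt (θ : ℝ) : ℂ := Complex.exp (θ * Complex.I)

/-- `f` is analytic on the open unit disc. -/
def AnalyticOnDisc (f : ℂ → ℂ) : Prop := DifferentiableOn ℂ f uDisc

/-- The integral mean `∫_𝕋 |f(rζ)|^p dm(ζ)`. -/
def hMean (p : ℝ) (f : ℂ → ℂ) (r : ℝ) : ℝ := ∫ θ, ‖f ((r : ℂ) * bpt θ)‖ ^ p ∂arcM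

/-- Membership in the Hardy space `H^p`, `0 < p < ∞`. -/
def MemHp (p : ℝ) (f : ℂ → ℂ) : Prop :=
  AnalyticOnDisc f ∧ BddAbove (hMean p f '' Set.Ioo 0 1)

/-- The Hardy space (quasi-)norm `‖f‖_{H^p} = (sup_{0<r<1} ∫_𝕋 |f(rζ)|^p dm)^{min(1,1/p)}`. -/
def hardyNorm (p : ℝ) (f : ℂ → ℂ) : ℝ :=
  sSup (hMean p f '' Set.Ioo 0 1) ^ min 1 (1 / p)

/-- Membership in `H^∞`: bounded analytic functions on 𝔻. -/
def MemHinf (f : ℂ → ℂ) : Prop :=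
  AnalyticOnDisc f ∧ ∃ C : ℝ, ∀ z ∈ uDisc, ‖f z‖ ≤ C

/-- `F` is (a representative of) the boundary function of `f` : radial limits a.e. on 𝕋. -/
def BoundaryFn (f : ℂ → ℂ) (F : ℝ → ℂ) : Prop :=
  ∀ᵐ θ ∂arcM, Filter.Tendsto (fun r : ℝ => f ((r : ℂ) * bpt θ))
    (nhdsWithin 1 (Set.Iio 1)) (nhds (F θ))

/-- `ϑ` is an inner function: bounded analytic with unimodular boundary values a.e. -/
def IsInner (ϑ : ℂ → ℂ) : Prop :=
  MemHinf ϑ ∧ ∃ Θ : ℝ → ℂ, BoundaryFn ϑ Θ ∧ ∀ᵐ θ ∂arcM, ‖Θ θ‖ = 1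

/-- The boundary function of `f` lies in `ϑ ⋅ conj(H^p_0)`. -/
def PseudoCont (p : ℝ) (ϑ f : ℂ → ℂ) : Prop :=
  ∃ F Θ G : ℝ → ℂ, ∃ g : ℂ → ℂ,
    BoundaryFn f F ∧ BoundaryFn ϑ Θ ∧ MemHp p g ∧ g 0 = 0 ∧ BoundaryFn g G ∧
    ∀ᵐ θ ∂arcM, F θ = Θ θ * (starRingEnd ℂ) (G θ)

/-- The boundary function of `f` lies in `ϑ ⋅ conj(H^∞_0)`. -/
def PseudoContInf (ϑ f : ℂ → ℂ) : Prop :=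
  ∃ F Θ G : ℝ → ℂ, ∃ g : ℂ → ℂ,
    BoundaryFn f F ∧ BoundaryFn ϑ Θ ∧ MemHinf g ∧ g 0 = 0 ∧ BoundaryFn g G ∧
    ∀ᵐ θ ∂arcM, F θ = Θ θ * (starRingEnd ℂ) (G θ)

/-- `f` extends analytically across the boundary set `S ⊆ 𝕋`. -/
def ExtendsAcross (f : ℂ → ℂ) (S : Set ℂ) : Prop :=
  ∃ U : Set ℂ, ∃ g : ℂ → ℂ, IsOpen U ∧ S ⊆ U ∧
    DifferentiableOn ℂ g (uDisc ∪ U) ∧ Set.EqOn g f uDisc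

/-- The boundary spectrum `σ(ϑ)`: the points of 𝕋 across which `ϑ` admits no
analytic continuation. -/
def bSpectrum (ϑ : ℂ → ℂ) : Set ℂ := {ζ | ζ ∈ uCircle ∧ ¬ ExtendsAcross ϑ {ζ}}

/-- Membership in the space `K^p_ϑ` of pseudocontinuable functions, `0 < p < ∞`:
`f ∈ H^p`, the boundary function of `f` lies in `ϑ ⋅ conj(H^p_0)`, and `f`
continues analytically across `𝕋 ∖ σ(ϑ)`. -/
def MemKp (p : ℝ) (ϑ f : ℂ → ℂ) : Prop :=
  MemHp p f ∧ PseudoCont p ϑ f ∧ ExtendsAcross f (uCircle \ bSpectrum ϑ)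

/-- Membership in `K^∞_ϑ = H^∞ ∩ ϑ ⋅ conj(H^∞_0)`. -/
def MemKinf (ϑ f : ℂ → ℂ) : Prop := MemHinf f ∧ PseudoContInf ϑ f

/-- The backward shift `f ↦ (f - f(0))/z`. -/
def bShift (f : ℂ → ℂ) : ℂ → ℂ :=
  fun z => if z = 0 then deriv f 0 else (f z - f 0) / z

/-- `X ∩ K^p_ϑ` is dense in `K^p_ϑ` in the `H^p` metric. -/
def DenseInKp (p : ℝ) (ϑ : ℂ → ℂ) (X : Set (ℂ → ℂ)) : Prop :=
  ∀ f : ℂ → ℂ, MemKp p ϑ f → ∀ ε > (0 : ℝ), ∃ g ∈ X, MemKp p ϑ g ∧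
    hardyNorm p (fun z => f z - g z) < ε

/-- `X ∩ K^∞_ϑ` is dense in `K^∞_ϑ` in the weak-star topology inherited from
`L^∞(𝕋, m) = (L¹(𝕋, m))^*`. -/
def WStarDenseKinf (ϑ : ℂ → ℂ) (X : Set (ℂ → ℂ)) : Prop :=
  ∀ f : ℂ → ℂ, MemKinf ϑ f → ∀ F : ℝ → ℂ, BoundaryFn f F →
    ∀ (n : ℕ) (h : Fin n → ℝ → ℂ), (∀ i, Integrable (h i) arcM) → ∀ ε > (0 : ℝ),
      ∃ g ∈ X, MemKinf ϑ g ∧ ∃ G : ℝ → ℂ, BoundaryFn g G ∧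
        ∀ i, ‖∫ θ, (F θ - G θ) * h i θ ∂arcM‖ < ε

open scoped ComplexConjugate Topology ENNReal

instance arcM_prob : IsProbabilityMeasure arcM := by
  constructor
  have h : (0:ℝ) < 2 * Real.pi := by positivity
  simp only [arcM, Measure.smul_apply, Measure.restrict_apply MeasurableSet.univ, univ_inter,
    Real.volume_Ioc, sub_zero, smul_eq_mul]
  exact ENNReal.inv_mul_cancel (by simpa using h) ENNReal.ofReal_ne_top

lemma integral_arcM {E : Type*} [NormedAddCommGroup E] [NormedSpace ℝ E] (f : ℝ → E) :
    ∫ θ, f θ ∂arcM = (2 * Real.pi)⁻¹ • ∫ θ in (0:ℝ)..(2 * Real.pi), f θ := by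
  have h : (0:ℝ) ≤ 2 * Real.pi := by positivity
  rw [arcM, integral_smul_measure, intervalIntegral.integral_of_le h, ENNReal.toReal_inv,
    ENNReal.toReal_ofReal h]

lemma integrable_arcM_iff {E : Type*} [NormedAddCommGroup E] (f : ℝ → E) :
    Integrable f arcM ↔ IntervalIntegrable f volume 0 (2 * Real.pi) := by
  have h : (0:ℝ) ≤ 2 * Real.pi := by positivity
  have h' : (0:ℝ) < 2 * Real.pi := by positivity
  rw [arcM, integrable_smul_measure, intervalIntegrable_iff_integrableOn_Ioc_of_le h]
  · rfl
  · exact ENNReal.inv_ne_zero.mpr ENNReal.ofReal_ne_top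
  · simpa using h'

lemma ae_arcM_of_ae {P : ℝ → Prop} (h : ∀ᵐ θ, θ ∈ Ioo 0 (2 * Real.pi) → P θ) :
    ∀ᵐ θ ∂arcM, P θ := by
  rw [arcM]
  refine Measure.ae_smul_measure ?_ _
  rw [ae_restrict_iff' measurableSet_Ioc]
  have h2 : ∀ᵐ θ : ℝ, θ ≠ 2 * Real.pi := by
    simp [ae_iff]
  filter_upwards [h, h2] with θ h1 h2 h3
  exact h1 ⟨h3.1, lt_of_le_of_ne h3.2 h2⟩

@[simp] lemma norm_bpt (θ : ℝ) : ‖bpt θ‖ = 1 := by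
  simp [bpt, Complex.norm_exp]

@[simp] lemma bpt_ne_zero (θ : ℝ) : bpt θ ≠ 0 := Complex.exp_ne_zero _

@[fun_prop] lemma continuous_bpt : Continuous bpt := by
  unfold bpt; fun_prop

@[simp] lemma conj_bpt (θ : ℝ) : conj (bpt θ) = (bpt θ)⁻¹ := by
  rw [Complex.inv_def]; simp [Complex.normSq_eq_norm_sq]

lemma bpt_sub (a b : ℝ) : bpt (a - b) = bpt a * (bpt b)⁻¹ := by
  simp only [bpt, ← Complex.exp_neg, ← Complex.exp_add]; congr 1; push_cast; ring

/-- integral of characters -/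
lemma integral_bpt_zpow (n : ℤ) : ∫ θ, bpt θ ^ n ∂arcM = if n = 0 then 1 else 0 := by
  split_ifs with h
  · simp [h]
  · rw [integral_arcM]
    have : ∀ θ : ℝ, bpt θ ^ n = Complex.exp ((n * I) * θ) := by
      intro θ; rw [bpt, ← Complex.exp_int_mul]; congr 1; ring
    simp_rw [this]
    rw [integral_exp_mul_complex (by simp [h])]
    have : Complex.exp (n * I * ((2 * Real.pi : ℝ) : ℂ)) = 1 := by
      rw [Complex.exp_eq_one_iff]; exact ⟨n, by push_cast; ring⟩
    rw [this]; simp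

/-- Fourier coefficients -/
def cf (F : ℝ → ℂ) (n : ℤ) : ℂ := ∫ θ, F θ * bpt θ ^ (-n) ∂arcM

/-- analytic type -/
def Anl (F : ℝ → ℂ) : Prop := ∀ n : ℤ, n < 0 → cf F n = 0

lemma continuous_bpt_zpow (n : ℤ) : Continuous (fun θ => bpt θ ^ n) :=
  continuous_bpt.zpow₀ n (fun θ => Or.inl (bpt_ne_zero θ))

lemma norm_bpt_zpow (θ : ℝ) (n : ℤ) : ‖bpt θ ^ n‖ = 1 := by simp

lemma MeasureTheory.Integrable.mul_bpt {F : ℝ → ℂ} (hF : Integrable F arcM) (n : ℤ) :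
    Integrable (fun θ => F θ * bpt θ ^ n) arcM := by
  refine hF.mul_bdd (c := 1) (continuous_bpt_zpow n).aestronglyMeasurable ?_
  exact Eventually.of_forall fun θ => by simp

lemma cf_add {F G : ℝ → ℂ} (hF : Integrable F arcM) (hG : Integrable G arcM) (n : ℤ) :
    cf (fun θ => F θ + G θ) n = cf F n + cf G n := by
  simp only [cf, add_mul]
  exact integral_add (hF.mul_bpt _) (hG.mul_bpt _)

lemma cf_sub {F G : ℝ → ℂ} (hF : Integrable F arcM) (hG : Integrable G arcM) (n : ℤ) :
    cf (fun θ => F θ - G θ) n = cf F n - cf G n := by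
  simp only [cf, sub_mul]
  exact integral_sub (hF.mul_bpt _) (hG.mul_bpt _)

lemma cf_smul (c : ℂ) (F : ℝ → ℂ) (n : ℤ) : cf (fun θ => c * F θ) n = c * cf F n := by
  simp only [cf, mul_assoc]
  exact integral_const_mul _ _

lemma cf_congr {F G : ℝ → ℂ} (h : F =ᵐ[arcM] G) (n : ℤ) : cf F n = cf G n := by
  refine integral_congr_ae ?_
  filter_upwards [h] with θ h; rw [h]

lemma cf_shift (F : ℝ → ℂ) (m n : ℤ) : cf (fun θ => bpt θ ^ m * F θ) n = cf F (n - m) := by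
  refine integral_congr_ae (Eventually.of_forall fun θ => ?_)
  simp only
  rw [mul_comm (bpt θ ^ m), mul_assoc, ← zpow_add₀ (bpt_ne_zero θ)]; congr 2; ring

lemma cf_conj (F : ℝ → ℂ) (n : ℤ) : cf (fun θ => conj (F θ)) n = conj (cf F (-n)) := by
  rw [cf, cf, ← integral_conj]
  refine integral_congr_ae (Eventually.of_forall fun θ => ?_)
  simp

lemma cf_bpt (m n : ℤ) : cf (fun θ => bpt θ ^ m) n = if n = m then 1 else 0 := by
  simp only [cf, ← zpow_add₀ (bpt_ne_zero _), integral_bpt_zpow]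
  congr 1; simp only [eq_iff_iff]; omega

lemma cf_const (c : ℂ) (n : ℤ) : cf (fun _ => c) n = if n = 0 then c else 0 := by
  have := cf_bpt 0 n
  have h2 := cf_smul c (fun θ => bpt θ ^ (0:ℤ)) n
  rw [this] at h2
  simpa using h2

lemma norm_cf_le (F : ℝ → ℂ) (n : ℤ) : ‖cf F n‖ ≤ ∫ θ, ‖F θ‖ ∂arcM := by
  refine (norm_integral_le_integral_norm _).trans (le_of_eq ?_)
  simp

lemma cf_zero_eq (F : ℝ → ℂ) : cf F 0 = ∫ θ, F θ ∂arcM := by simp [cf]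

/-- Cauchy kernel -/
def ck (z : ℂ) (t : ℝ) : ℂ := (1 - z * (bpt t)⁻¹)⁻¹

/-- Cauchy transform -/
def cau (F : ℝ → ℂ) (z : ℂ) : ℂ := ∫ t, F t * ck z t ∂arcM

/-- Poisson kernel -/
def pk (z : ℂ) (t : ℝ) : ℝ := (1 - ‖z‖ ^ 2) / ‖1 - z * (bpt t)⁻¹‖ ^ 2

def pois (F : ℝ → ℂ) (z : ℂ) : ℂ := ∫ t, F t * (pk z t : ℂ) ∂arcM

lemma one_sub_ne {z : ℂ} (hz : ‖z‖ < 1) (t : ℝ) : 1 - z * (bpt t)⁻¹ ≠ 0 := by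
  intro h
  have : z * (bpt t)⁻¹ = 1 := (sub_eq_zero.mp h).symm
  have h2 : ‖z * (bpt t)⁻¹‖ = 1 := by rw [this]; simp
  simp at h2; linarith

lemma continuous_ck {z : ℂ} (hz : ‖z‖ < 1) : Continuous (ck z) := by
  unfold ck
  refine Continuous.inv₀ ?_ (one_sub_ne hz)
  exact continuous_const.sub (continuous_const.mul (continuous_bpt.inv₀ bpt_ne_zero))

lemma continuous_pk {z : ℂ} (hz : ‖z‖ < 1) : Continuous (pk z) := by
  unfold pk
  refine Continuous.div continuous_const ?_ ?_
  · exact ((continuous_const.sub (continuous_const.mul (continuous_bpt.inv₀ bpt_ne_zero))).norm).pow 2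
  · intro t; have := one_sub_ne hz t; positivity

lemma one_sub_norm_le {z : ℂ} (t : ℝ) : 1 - ‖z‖ ≤ ‖1 - z * (bpt t)⁻¹‖ := by
  have := norm_sub_norm_le (1:ℂ) (z * (bpt t)⁻¹)
  simpa using this

lemma norm_ck_le {z : ℂ} (hz : ‖z‖ < 1) (t : ℝ) : ‖ck z t‖ ≤ (1 - ‖z‖)⁻¹ := by
  rw [ck, norm_inv]
  exact inv_anti₀ (by linarith) (one_sub_norm_le t)

lemma pk_nonneg {z : ℂ} (hz : ‖z‖ < 1) (t : ℝ) : 0 ≤ pk z t := by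
  unfold pk
  have : ‖z‖ ^ 2 ≤ 1 := by nlinarith [norm_nonneg z]
  apply div_nonneg <;> [linarith; positivity]

lemma pk_pos {z : ℂ} (hz : ‖z‖ < 1) (t : ℝ) : 0 < pk z t := by
  unfold pk
  have h1 : 0 < 1 - ‖z‖ ^ 2 := by nlinarith [norm_nonneg z]
  have := one_sub_ne hz t
  positivity

lemma pk_le {z : ℂ} (hz : ‖z‖ < 1) (t : ℝ) : pk z t ≤ (1 - ‖z‖ ^ 2) / (1 - ‖z‖) ^ 2 := by
  unfold pk
  have h1 : 0 < 1 - ‖z‖ ^ 2 := by nlinarith [norm_nonneg z]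
  have h2 : 0 < 1 - ‖z‖ := by linarith
  have := one_sub_norm_le (z := z) t
  gcongr

lemma pk_eq {z : ℂ} (hz : ‖z‖ < 1) (t : ℝ) : (pk z t : ℂ) = ck z t + conj (ck z t) - 1 := by
  have h := one_sub_ne hz t
  have hn : ‖z * (bpt t)⁻¹‖ = ‖z‖ := by simp
  set w := z * (bpt t)⁻¹ with hw
  have h' : 1 - conj w ≠ 0 := by
    have : conj (1 - w) ≠ 0 := (_root_.map_ne_zero _).mpr h
    rwa [map_sub, map_one] at this
  rw [pk, ck, ← hw]
  push_cast
  rw [← hn, ← Complex.mul_conj', ← Complex.mul_conj']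
  simp only [map_sub, map_one, map_inv₀]
  field_simp
  ring

lemma integrable_mul_ck {F : ℝ → ℂ} (hF : Integrable F arcM) {z : ℂ} (hz : ‖z‖ < 1) :
    Integrable (fun t => F t * ck z t) arcM :=
  hF.mul_bdd (c := (1 - ‖z‖)⁻¹) (continuous_ck hz).aestronglyMeasurable
    (Eventually.of_forall fun t => norm_ck_le hz t)

lemma integrable_mul_pk {F : ℝ → ℂ} (hF : Integrable F arcM) {z : ℂ} (hz : ‖z‖ < 1) :
    Integrable (fun t => F t * (pk z t : ℂ)) arcM :=
  hF.mul_bdd (c := (1 - ‖z‖ ^ 2) / (1 - ‖z‖) ^ 2)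
    (Complex.continuous_ofReal.comp (continuous_pk hz)).aestronglyMeasurable
    (Eventually.of_forall fun t => by
      rw [Complex.norm_of_nonneg (pk_nonneg hz t)]; exact pk_le hz t)

lemma integrable_pk {z : ℂ} (hz : ‖z‖ < 1) : Integrable (pk z) arcM := by
  have := integrable_mul_pk (F := fun _ => 1) (integrable_const _) hz
  simp only [one_mul] at this
  exact this.re.congr (Eventually.of_forall fun t => by simp)

lemma cau_hasSum {F : ℝ → ℂ} (hF : Integrable F arcM) {z : ℂ} (hz : ‖z‖ < 1) :
    HasSum (fun n : ℕ => cf F n * z ^ n) (cau F z) := by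
  have key : ∀ t, HasSum (fun n : ℕ => F t * bpt t ^ (-(n:ℤ)) * z ^ n) (F t * ck z t) := by
    intro t
    have hw : ‖z * (bpt t)⁻¹‖ < 1 := by simpa using hz
    have := (hasSum_geometric_of_norm_lt_one hw).mul_left (F t)
    refine this.congr_fun ?_ |> fun h => h
    intro n
    simp [mul_pow]; ring
  have h1 : ∀ n : ℕ, Integrable (fun t => F t * bpt t ^ (-(n:ℤ)) * z ^ n) arcM := fun n =>
    (hF.mul_bpt _).mul_const _
  have h2 : Summable fun n : ℕ => ∫ t, ‖F t * bpt t ^ (-(n:ℤ)) * z ^ n‖ ∂arcM := by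
    have : ∀ n : ℕ, ∫ t, ‖F t * bpt t ^ (-(n:ℤ)) * z ^ n‖ ∂arcM = (∫ t, ‖F t‖ ∂arcM) * ‖z‖ ^ n := by
      intro n; simp [integral_mul_const]
    simp_rw [this]
    exact (summable_geometric_of_lt_one (norm_nonneg _) hz).mul_left _
  have h3 := hasSum_integral_of_summable_integral_norm h1 h2
  have h4 : ∀ t, ∑' n : ℕ, F t * bpt t ^ (-(n:ℤ)) * z ^ n = F t * ck z t := fun t => (key t).tsum_eq
  simp_rw [h4] at h3
  refine h3.congr_fun ?_ |> fun h => h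
  intro n
  rw [integral_mul_const]; rfl

lemma pois_eq {F : ℝ → ℂ} (hF : Integrable F arcM) {z : ℂ} (hz : ‖z‖ < 1) :
    pois F z = cau F z + conj (cau (fun t => conj (F t)) z) - cf F 0 := by
  have hF' : Integrable (fun t => conj (F t)) arcM := by
    have := hF.norm
    refine ⟨Complex.continuous_conj.comp_aestronglyMeasurable hF.1, ?_⟩
    exact hF.2.mono (Eventually.of_forall fun t => by simp)
  have h2 : Integrable (fun t => F t * conj (ck z t)) arcM := by
    refine hF.mul_bdd (c := (1 - ‖z‖)⁻¹) 
      (Complex.continuous_conj.comp (continuous_ck hz)).aestronglyMeasurable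
      (Eventually.of_forall fun t => by simpa using norm_ck_le hz t)
  have : conj (cau (fun t => conj (F t)) z) = ∫ t, F t * conj (ck z t) ∂arcM := by
    rw [cau, ← integral_conj]; simp
  rw [this, pois, cau, cf_zero_eq, ← integral_add (integrable_mul_ck hF hz) h2,
    ← integral_sub _ hF]
  · congr 1; ext t; rw [pk_eq hz]; ring
  · exact (integrable_mul_ck hF hz).add h2

lemma MeasureTheory.Integrable.conj' {F : ℝ → ℂ} (hF : Integrable F arcM) : Integrable (fun t => conj (F t)) arcM := by
  refine ⟨Complex.continuous_conj.comp_aestronglyMeasurable hF.1, ?_⟩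
  exact hF.2.mono (Eventually.of_forall fun t => by simp)

lemma cau_conj_of_anl {F : ℝ → ℂ} (hF : Integrable F arcM) (hA : Anl F) {z : ℂ} (hz : ‖z‖ < 1) :
    cau (fun t => conj (F t)) z = conj (cf F 0) := by
  have h := cau_hasSum (hF.conj') hz
  have h2 : HasSum (fun n : ℕ => cf (fun t => conj (F t)) n * z ^ n) (cf (fun t => conj (F t)) (0:ℕ) * z ^ 0) := by
    refine hasSum_single 0 ?_
    intro n hn
    rw [cf_conj, hA (-n) (by omega)]; simp
  rw [h.unique h2, cf_conj]; simp

lemma pois_anl {F : ℝ → ℂ} (hF : Integrable F arcM) (hA : Anl F) {z : ℂ} (hz : ‖z‖ < 1) :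
    pois F z = cau F z := by
  rw [pois_eq hF hz, cau_conj_of_anl hF hA hz]; simp

lemma integral_pk {z : ℂ} (hz : ‖z‖ < 1) : ∫ t, pk z t ∂arcM = 1 := by
  have hA : Anl (fun _ => (1:ℂ)) := by intro n hn; rw [cf_const]; simp [hn.ne]
  have h1 := pois_anl (integrable_const (1:ℂ)) hA hz
  have h2 := cau_conj_of_anl (integrable_const (1:ℂ)) hA hz
  simp only [map_one] at h2
  rw [h2, cf_const] at h1
  simp only [pois, one_mul, integral_complex_ofReal] at h1
  simp at h1
  exact_mod_cast h1

lemma one_sub_cos_lower {θ : ℝ} (hθ : θ ∈ Ioo 0 (2 * Real.pi)) :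
    ∃ c > 0, ∀ t ∈ Icc 0 (2 * Real.pi), c * (θ - t) ^ 2 ≤ 1 - Real.cos (θ - t) := by
  have hcont : ContinuousOn (fun t : ℝ => Real.sinc ((θ - t) / 2) ^ 2) (Icc 0 (2 * Real.pi)) := by
    have : Continuous Real.sinc := Real.continuous_sinc
    fun_prop
  obtain ⟨t0, ht0, hmin⟩ := isCompact_Icc.exists_isMinOn
    (nonempty_Icc.mpr (by positivity)) hcont
  have hpos : 0 < Real.sinc ((θ - t0) / 2) ^ 2 := by
    have : Real.sinc ((θ - t0) / 2) ≠ 0 := by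
      by_cases h : (θ - t0) / 2 = 0
      · rw [h]; simp
      · rw [Real.sinc_of_ne_zero h]
        refine div_ne_zero ?_ h
        rcases lt_or_gt_of_ne h with h1 | h1
        · exact (Real.sin_neg_of_neg_of_neg_pi_lt h1 (by have := ht0.2; have := hθ.1; linarith)).ne
        · exact (Real.sin_pos_of_pos_of_lt_pi h1 (by have := ht0.1; have := hθ.2; linarith)).ne'
    positivity
  refine ⟨Real.sinc ((θ - t0) / 2) ^ 2 / 2, by positivity, fun t ht => ?_⟩
  have h1 : Real.sinc ((θ - t0) / 2) ^ 2 ≤ Real.sinc ((θ - t) / 2) ^ 2 := hmin ht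
  have h2 : 1 - Real.cos (θ - t) = 2 * Real.sin ((θ - t) / 2) ^ 2 := by
    have := Real.cos_sq_add_sin_sq ((θ - t) / 2)
    have h3 := Real.cos_two_mul ((θ - t) / 2)
    rw [show 2 * ((θ - t) / 2) = θ - t by ring] at h3
    nlinarith
  have h3 : Real.sin ((θ - t) / 2) = Real.sinc ((θ - t) / 2) * ((θ - t) / 2) := by
    by_cases h : (θ - t) / 2 = 0
    · simp [h]
    · rw [Real.sinc_of_ne_zero h, div_mul_cancel₀ _ h]
  rw [h2, h3]
  nlinarith [sq_nonneg (θ - t)]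

lemma pk_real (r θ t : ℝ) : pk ((r:ℂ) * bpt θ) t = (1 - r ^ 2) / ((1 - r) ^ 2 + 2 * r * (1 - Real.cos (θ - t))) := by
  have h1 : ‖(r:ℂ) * bpt θ‖ ^ 2 = r ^ 2 := by simp
  have h2 : (r:ℂ) * bpt θ * (bpt t)⁻¹ = r * bpt (θ - t) := by rw [bpt_sub]; ring
  rw [pk, h1, h2]
  congr 1
  rw [← Complex.normSq_eq_norm_sq, Complex.normSq_apply]
  have h3 : bpt (θ - t) = Real.cos (θ - t) + Real.sin (θ - t) * I := by
    rw [bpt, Complex.exp_mul_I]; push_cast; rfl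
  rw [h3]
  have := Real.cos_sq_add_sin_sq (θ - t)
  generalize Real.cos (θ - t) = x at *
  generalize Real.sin (θ - t) = y at *
  simp
  linear_combination r ^ 2 * this

lemma fatou_point {φ : ℝ → ℝ} (hφ : IntervalIntegrable φ volume 0 (2 * Real.pi)) {θ : ℝ}
    (hθ : θ ∈ Ioo 0 (2 * Real.pi))
    (hd : HasDerivAt (fun x => ∫ t in θ..x, φ t) (φ θ) θ) :
    Tendsto (fun r : ℝ => ∫ t, φ t * pk ((r:ℂ) * bpt θ) t ∂arcM) (𝓝[<] 1) (𝓝 (φ θ)) := by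
  obtain ⟨c, hc, hcos⟩ := one_sub_cos_lower hθ
  have h2pi : (0:ℝ) ≤ 2 * Real.pi := by positivity
  have hθ' : θ ∈ uIcc 0 (2 * Real.pi) := by rw [uIcc_of_le h2pi]; exact ⟨hθ.1.le, hθ.2.le⟩
  set ψ : ℝ → ℝ := fun t => φ t - φ θ with hψ
  have hψi : IntervalIntegrable ψ volume 0 (2 * Real.pi) := hφ.sub intervalIntegrable_const
  set D : ℝ → ℝ := fun x => ∫ t in θ..x, ψ t with hD
  have hDac : AbsolutelyContinuousOnInterval D 0 (2 * Real.pi) :=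
    hψi.absolutelyContinuousOnInterval_intervalIntegral hθ'
  have hDder : ∀ᵐ x, x ∈ uIcc 0 (2 * Real.pi) → deriv D x = ψ x := by
    filter_upwards [hψi.ae_hasDerivAt_integral] with x hx hx'
    exact (hx hx' θ hθ').deriv
  have hDcont : ContinuousOn D (Icc 0 (2 * Real.pi)) := by
    have := hDac.continuousOn
    rwa [uIcc_of_le h2pi] at this
  have hD0 : HasDerivAt D 0 θ := by
    have h1 : HasDerivAt (fun x => (∫ t in θ..x, φ t) - (x - θ) * φ θ) (φ θ - 1 * φ θ) θ :=
      hd.sub (((hasDerivAt_id θ).sub_const θ).mul_const _)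
    rw [one_mul, sub_self] at h1
    refine h1.congr_of_eventuallyEq ?_
    filter_upwards [Ioo_mem_nhds hθ.1 hθ.2] with x hx
    have hx' : uIcc θ x ⊆ uIcc 0 (2 * Real.pi) := by
      refine uIcc_subset_uIcc hθ' ?_
      rw [uIcc_of_le h2pi]; exact ⟨hx.1.le, hx.2.le⟩
    simp only [hD, hψ]
    rw [intervalIntegral.integral_sub (hφ.mono_set hx') intervalIntegrable_const]
    simp
  obtain ⟨K0, hK0⟩ := isCompact_Icc.exists_bound_of_continuousOn hDcont
  have hK0n : 0 ≤ K0 := (norm_nonneg _).trans (hK0 0 ⟨le_rfl, h2pi⟩)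
  -- bound on D
  have hDb : ∀ ε > 0, ∃ K ≥ 0, ∀ t ∈ Icc 0 (2 * Real.pi), |D t| ≤ (ε + K * (θ - t) ^ 2) * |θ - t| := by
    intro ε hε
    have h1 := (hasDerivAt_iff_isLittleO.mp hD0).def hε
    have hDθ : D θ = 0 := by simp [hD]
    simp only [hDθ, smul_zero, sub_zero] at h1
    obtain ⟨η, hη, hη'⟩ := Metric.eventually_nhds_iff.mp h1
    refine ⟨K0 / η ^ 3, by positivity, fun t ht => ?_⟩
    by_cases h : |θ - t| < η
    · have h2 := hη' (y := t) (by rwa [dist_comm, Real.dist_eq])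
      simp only [Real.norm_eq_abs] at h2
      rw [abs_sub_comm t θ] at h2
      refine h2.trans ?_
      gcongr
      have : 0 ≤ K0 / η ^ 3 * (θ - t) ^ 2 := by positivity
      linarith
    · push Not at h
      have h2 := hK0 t ht
      rw [Real.norm_eq_abs] at h2
      refine h2.trans ?_
      have h3 : η ^ 3 ≤ |θ - t| ^ 3 := by gcongr
      have h4 : K0 = K0 / η ^ 3 * η ^ 3 := by field_simp
      have h5 : K0 ≤ K0 / η ^ 3 * |θ - t| ^ 3 := by
        conv_lhs => rw [h4]
        gcongr
      have h6 : 0 ≤ ε * |θ - t| := by positivity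
      have h7 : |θ - t| ^ 3 = (θ - t) ^ 2 * |θ - t| := by rw [← sq_abs]; ring
      rw [h7] at h5
      linarith
  -- main estimate
  have main : ∀ ε > 0, ∃ K ≥ 0, ∀ r ∈ Ioo (1/2:ℝ) 1,
      |∫ t in (0:ℝ)..(2 * Real.pi), ψ t * pk ((r:ℂ) * bpt θ) t| ≤ 4 * Real.pi / c * ε + K * (1 - r ^ 2) := by
    intro ε hε
    obtain ⟨K, hK, hDK⟩ := hDb ε hε
    refine ⟨K0 / (c * (θ - 2 * Real.pi) ^ 2) + K0 / (c * θ ^ 2) + 4 * Real.pi * K / c ^ 2 , by positivity, ?_⟩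
    rintro r ⟨hr1, hr2⟩
    set d : ℝ → ℝ := fun t => (1 - r) ^ 2 + 2 * r * (1 - Real.cos (θ - t)) with hdd
    have hdpos : ∀ t, 0 < d t := by
      intro t
      have h1 := Real.cos_le_one (θ - t)
      have : 0 < (1 - r) ^ 2 := by have : 0 < 1 - r := by linarith
                                   positivity
      have : 0 ≤ 2 * r * (1 - Real.cos (θ - t)) := by
        apply mul_nonneg <;> linarith
      simp only [hdd]; linarith
    have hdlow : ∀ t ∈ Icc 0 (2 * Real.pi), c * (θ - t) ^ 2 ≤ d t := by
      intro t ht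
      have h1 := hcos t ht
      have h0 : 0 ≤ 1 - Real.cos (θ - t) := by linarith [Real.cos_le_one (θ - t)]
      simp only [hdd]
      nlinarith [sq_nonneg (1 - r)]
    set q : ℝ → ℝ := fun t => (1 - r ^ 2) / d t with hq
    have hr3 : 0 < 1 - r ^ 2 := by nlinarith
    have hqpos : ∀ t, 0 < q t := fun t => div_pos hr3 (hdpos t)
    have hqk : ∀ t, pk ((r:ℂ) * bpt θ) t = q t := fun t => pk_real r θ t
    have hz : ‖(r:ℂ) * bpt θ‖ < 1 := by
      simp only [norm_mul, norm_bpt, mul_one, Complex.norm_real, Real.norm_eq_abs]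
      rw [abs_lt]; constructor <;> linarith
    have hqd : ∀ t, HasDerivAt q ((1 - r ^ 2) * (2 * r * Real.sin (θ - t)) / d t ^ 2) t := by
      intro t
      have h1 : HasDerivAt d (2 * r * (-(Real.sin (θ - t)))) t := by
        have h := (((hasDerivAt_id t).const_sub θ).cos.const_sub 1).const_mul (2 * r)
        have h' := h.const_add ((1 - r) ^ 2)
        refine h'.congr_deriv ?_
        simp
      have h2 := (hasDerivAt_const t (1 - r ^ 2)).div h1 (hdpos t).ne'
      refine h2.congr_deriv ?_
      ring
    have hqc : ContDiff ℝ 1 q := by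
      refine ContDiff.div contDiff_const ?_ (fun t => (hdpos t).ne')
      exact contDiff_const.add (contDiff_const.mul (contDiff_const.sub (Real.contDiff_cos.comp (contDiff_const.sub contDiff_id))))
    have hqac : AbsolutelyContinuousOnInterval q 0 (2 * Real.pi) :=
      hqc.contDiffOn.absolutelyContinuousOnInterval
    have ibp := hqac.integral_mul_deriv_eq_deriv_mul hDac
    have e1 : ∫ t in (0:ℝ)..(2 * Real.pi), ψ t * pk ((r:ℂ) * bpt θ) t = ∫ t in (0:ℝ)..(2 * Real.pi), q t * deriv D t := by
      refine intervalIntegral.integral_congr_ae ?_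
      filter_upwards [hDder] with t ht ht'
      rw [ht (uIoc_subset_uIcc ht'), hqk]; ring
    have hqint : ∫ t in (0:ℝ)..(2 * Real.pi), q t = 2 * Real.pi := by
      have := integral_pk hz
      rw [integral_arcM] at this
      simp_rw [hqk] at this
      rw [smul_eq_mul, inv_mul_eq_one₀ (by positivity)] at this
      exact this.symm
    have hqcont : Continuous q := hqc.continuous
    have hb1 : ∀ t ∈ Icc 0 (2 * Real.pi), (θ - t) ^ 2 * q t ≤ (1 - r ^ 2) / c := by
      intro t ht
      simp only [hq]
      rw [mul_div_assoc', div_le_div_iff₀ (hdpos t) hc]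
      nlinarith [hdlow t ht]
    have hb2 : ∀ t ∈ Icc 0 (2 * Real.pi), |deriv q t * D t| ≤ 2 / c * (ε * q t + K * ((1 - r ^ 2) / c)) := by
      intro t ht
      rw [(hqd t).deriv, abs_mul]
      have h1 : |(1 - r ^ 2) * (2 * r * Real.sin (θ - t)) / d t ^ 2| = q t * (2 * r * |Real.sin (θ - t)| / d t) := by
        rw [abs_div, abs_mul, abs_mul, abs_mul, abs_of_pos hr3, abs_of_pos (show (0:ℝ) < 2 by norm_num), abs_of_pos (show 0 < r by linarith), abs_of_pos (show 0 < d t ^ 2 by have := hdpos t; positivity)]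
        simp only [hq]; field_simp
      rw [h1]
      have h2 : 2 * r * |Real.sin (θ - t)| / d t * |θ - t| ≤ 2 / c := by
        rw [div_mul_eq_mul_div, div_le_div_iff₀ (hdpos t) hc]
        have h3 : |Real.sin (θ - t)| ≤ |θ - t| := Real.abs_sin_le_abs
        have h4 := hdlow t ht
        have h5 : |θ - t| * |θ - t| = (θ - t) ^ 2 := by rw [← sq, sq_abs]
        have h6 : 2 * r * |Real.sin (θ - t)| * |θ - t| ≤ 2 * (|θ - t| * |θ - t|) := by
          have : r * |Real.sin (θ - t)| ≤ 1 * |θ - t| := by gcongr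
          nlinarith [abs_nonneg (θ - t)]
        nlinarith
      have h7 := hqpos t
      have h9 : 0 ≤ ε + K * (θ - t) ^ 2 := by positivity
      have h10 : 0 ≤ 2 * r * |Real.sin (θ - t)| / d t := by
        have := hdpos t
        have : 0 < r := by linarith
        positivity
      calc q t * (2 * r * |Real.sin (θ - t)| / d t) * |D t|
          ≤ q t * (2 * r * |Real.sin (θ - t)| / d t) * ((ε + K * (θ - t) ^ 2) * |θ - t|) := by
            gcongr; exact hDK t ht
        _ = (q t * (ε + K * (θ - t) ^ 2)) * (2 * r * |Real.sin (θ - t)| / d t * |θ - t|) := by ring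
        _ ≤ (q t * (ε + K * (θ - t) ^ 2)) * (2 / c) := by gcongr
        _ = 2 / c * (ε * q t + K * ((θ - t) ^ 2 * q t)) := by ring
        _ ≤ _ := by
          have := hb1 t ht
          gcongr
    have hintg : |∫ t in (0:ℝ)..(2 * Real.pi), deriv q t * D t| ≤ 2 / c * (ε * (2 * Real.pi) + 2 * Real.pi * (K * ((1 - r ^ 2) / c))) := by
      have h1 : ∫ t in (0:ℝ)..(2 * Real.pi), 2 / c * (ε * q t + K * ((1 - r ^ 2) / c)) = 2 / c * (ε * (2 * Real.pi) + 2 * Real.pi * (K * ((1 - r ^ 2) / c))) := by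
        rw [intervalIntegral.integral_const_mul, intervalIntegral.integral_add, intervalIntegral.integral_const_mul, hqint, intervalIntegral.integral_const, smul_eq_mul, sub_zero]
        · exact (hqcont.const_mul ε |>.intervalIntegrable _ _)
        · exact intervalIntegrable_const
      rw [← h1]
      have := intervalIntegral.norm_integral_le_of_norm_le (f := fun t => deriv q t * D t) (μ := volume) h2pi (Eventually.of_forall fun t ht => hb2 t ⟨ht.1.le, ht.2⟩) ?_
      · exact this
      · apply Continuous.intervalIntegrable; fun_prop
    have hend : ∀ t ∈ Icc 0 (2 * Real.pi), θ - t ≠ 0 → |q t * D t| ≤ K0 / (c * (θ - t) ^ 2) * (1 - r ^ 2) := by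
      intro t ht hne
      rw [abs_mul, abs_of_pos (hqpos t)]
      have h1 := hK0 t ht
      rw [Real.norm_eq_abs] at h1
      have h2 : q t ≤ (1 - r ^ 2) / (c * (θ - t) ^ 2) := by
        simp only [hq]
        have := hdlow t ht
        gcongr
      have h3 := hqpos t
      calc q t * |D t| ≤ (1 - r ^ 2) / (c * (θ - t) ^ 2) * K0 := by gcongr
        _ = _ := by ring
    have he1 := hend (2 * Real.pi) ⟨h2pi, le_rfl⟩ (by linarith [hθ.2])
    have he2 := hend 0 ⟨le_rfl, h2pi⟩ (by linarith [hθ.1])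
    rw [sub_zero] at he2
    rw [e1, ibp]
    calc _ ≤ |q (2 * Real.pi) * D (2 * Real.pi)| + |q 0 * D 0| + |∫ t in (0:ℝ)..(2 * Real.pi), deriv q t * D t| := by
            refine (abs_sub _ _).trans ?_
            gcongr
            exact abs_sub _ _
      _ ≤ K0 / (c * (θ - 2 * Real.pi) ^ 2) * (1 - r ^ 2) + K0 / (c * θ ^ 2) * (1 - r ^ 2) + 2 / c * (ε * (2 * Real.pi) + 2 * Real.pi * (K * ((1 - r ^ 2) / c))) := by gcongr
      _ = _ := by field_simp; ring
  -- conclude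
  have hpi : 0 < Real.pi := Real.pi_pos
  have key : Tendsto (fun r : ℝ => ∫ t in (0:ℝ)..(2 * Real.pi), ψ t * pk ((r:ℂ) * bpt θ) t) (𝓝[<] 1) (𝓝 0) := by
    rw [Metric.tendsto_nhds]
    intro δ hδ
    obtain ⟨K, hK, hmain⟩ := main (c / (4 * Real.pi) * (δ / 2)) (by positivity)
    have h1 : Tendsto (fun r : ℝ => K * (1 - r ^ 2)) (𝓝[<] 1) (𝓝 0) := by
      have : Continuous (fun r : ℝ => K * (1 - r ^ 2)) := by fun_prop
      have := (this.tendsto 1).mono_left (nhdsWithin_le_nhds (s := Iio 1))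
      simpa using this
    have h2 : ∀ᶠ r : ℝ in 𝓝[<] 1, r ∈ Ioo (1/2:ℝ) 1 := Ioo_mem_nhdsLT (by norm_num)
    filter_upwards [h2, h1.eventually (gt_mem_nhds (show (0:ℝ) < δ / 2 by positivity))] with r hr hr'
    have := hmain r hr
    rw [dist_zero_right, Real.norm_eq_abs]
    refine this.trans_lt ?_
    have : 4 * Real.pi / c * (c / (4 * Real.pi) * (δ / 2)) = δ / 2 := by field_simp
    linarith
  have h3 : Tendsto (fun r : ℝ => φ θ + (2 * Real.pi)⁻¹ * ∫ t in (0:ℝ)..(2 * Real.pi), ψ t * pk ((r:ℂ) * bpt θ) t) (𝓝[<] 1) (𝓝 (φ θ)) := by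
    simpa using (key.const_mul (2 * Real.pi)⁻¹).const_add (φ θ)
  refine h3.congr' ?_
  have h2 : ∀ᶠ r : ℝ in 𝓝[<] 1, r ∈ Ioo (1/2:ℝ) 1 := Ioo_mem_nhdsLT (by norm_num)
  filter_upwards [h2] with r hr
  have hz : ‖(r:ℂ) * bpt θ‖ < 1 := by
    simp only [norm_mul, norm_bpt, mul_one, Complex.norm_real, Real.norm_eq_abs]
    rw [abs_lt]; constructor <;> linarith [hr.1, hr.2]
  have h4 := integral_pk hz
  rw [integral_arcM, smul_eq_mul] at h4
  have hpkc := continuous_pk hz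
  have h5 : ∫ t in (0:ℝ)..(2 * Real.pi), ψ t * pk ((r:ℂ) * bpt θ) t = (∫ t in (0:ℝ)..(2 * Real.pi), φ t * pk ((r:ℂ) * bpt θ) t) - φ θ * ∫ t in (0:ℝ)..(2 * Real.pi), pk ((r:ℂ) * bpt θ) t := by
    rw [← intervalIntegral.integral_const_mul, ← intervalIntegral.integral_sub]
    · simp only [hψ, sub_mul]
    · exact hφ.mul_continuousOn hpkc.continuousOn
    · exact (hpkc.const_mul _).intervalIntegrable _ _
  rw [integral_arcM, smul_eq_mul, h5, mul_sub]
  linear_combination -φ θ * h4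

lemma pois_re {F : ℝ → ℂ} (hF : Integrable F arcM) {z : ℂ} (hz : ‖z‖ < 1) :
    pois F z = ((∫ t, (F t).re * pk z t ∂arcM : ℝ) : ℂ) + ((∫ t, (F t).im * pk z t ∂arcM : ℝ) : ℂ) * I := by
  have h := integrable_mul_pk hF hz
  have := integral_re_add_im h
  rw [pois, ← this]
  simp

/-- Fatou's radial limit theorem for Poisson integrals of `L¹` functions. -/
lemma fatou {F : ℝ → ℂ} (hF : Integrable F arcM) :
    ∀ᵐ θ ∂arcM, Tendsto (fun r : ℝ => pois F ((r:ℂ) * bpt θ)) (𝓝[<] 1) (𝓝 (F θ)) := by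
  have h1 : IntervalIntegrable (fun t => (F t).re) volume 0 (2 * Real.pi) :=
    (integrable_arcM_iff _).mp hF.re
  have h2 : IntervalIntegrable (fun t => (F t).im) volume 0 (2 * Real.pi) :=
    (integrable_arcM_iff _).mp hF.im
  have h2pi : (0:ℝ) ≤ 2 * Real.pi := by positivity
  refine ae_arcM_of_ae ?_
  filter_upwards [h1.ae_hasDerivAt_integral, h2.ae_hasDerivAt_integral] with θ hr hi hθ
  have hθ' : θ ∈ uIcc 0 (2 * Real.pi) := by rw [uIcc_of_le h2pi]; exact ⟨hθ.1.le, hθ.2.le⟩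
  have l1 := fatou_point h1 hθ (hr hθ' θ hθ')
  have l2 := fatou_point h2 hθ (hi hθ' θ hθ')
  have l3 := (Complex.continuous_ofReal.tendsto _).comp l1
  have l4 := ((Complex.continuous_ofReal.tendsto _).comp l2).mul_const I
  have l5 := l3.add l4
  rw [Complex.re_add_im] at l5
  refine l5.congr' ?_
  have h2 : ∀ᶠ r : ℝ in 𝓝[<] 1, r ∈ Ioo (1/2:ℝ) 1 := Ioo_mem_nhdsLT (by norm_num)
  filter_upwards [h2] with r hr
  have hz : ‖(r:ℂ) * bpt θ‖ < 1 := by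
    simp only [norm_mul, norm_bpt, mul_one, Complex.norm_real, Real.norm_eq_abs]
    rw [abs_lt]; constructor <;> linarith [hr.1, hr.2]
  rw [pois_re hF hz]; rfl

/-- Uniqueness of Fourier coefficients in `L¹`. -/
lemma ae_zero_of_cf {F : ℝ → ℂ} (hF : Integrable F arcM) (h : ∀ n, cf F n = 0) : F =ᵐ[arcM] 0 := by
  have hp : ∀ z : ℂ, ‖z‖ < 1 → pois F z = 0 := by
    intro z hz
    rw [pois_anl hF (fun n _ => h n) hz]
    have := cau_hasSum hF hz
    simp only [h, zero_mul] at this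
    exact this.unique hasSum_zero
  filter_upwards [fatou hF] with θ hθ
  refine tendsto_nhds_unique hθ ?_
  refine tendsto_const_nhds.congr' ?_
  have h2 : ∀ᶠ r : ℝ in 𝓝[<] 1, r ∈ Ioo (1/2:ℝ) 1 := Ioo_mem_nhdsLT (by norm_num)
  filter_upwards [h2] with r hr
  have hz : ‖(r:ℂ) * bpt θ‖ < 1 := by
    simp only [norm_mul, norm_bpt, mul_one, Complex.norm_real, Real.norm_eq_abs]
    rw [abs_lt]; constructor <;> linarith [hr.1, hr.2]
  exact (hp _ hz).symm

lemma ae_eq_of_cf {F G : ℝ → ℂ} (hF : Integrable F arcM) (hG : Integrable G arcM)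
    (h : ∀ n, cf F n = cf G n) : F =ᵐ[arcM] G := by
  have := ae_zero_of_cf (hF.sub hG) (fun n => by
    have := cf_sub hF hG n
    rw [h n, sub_self] at this; exact this)
  filter_upwards [this] with θ h
  simpa [sub_eq_zero] using h

lemma memLp_bpt (n : ℤ) : MemLp (fun θ => bpt θ ^ n) 2 arcM :=
  MemLp.of_bound (continuous_bpt_zpow n).aestronglyMeasurable 1
    (Eventually.of_forall fun θ => by simp)

lemma MeasureTheory.MemLp.int2 {F : ℝ → ℂ} (hF : MemLp F 2 arcM) : Integrable F arcM :=
  hF.integrable (by norm_num)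

lemma l2_inner_e (n : ℤ) (F : Lp ℂ 2 arcM) :
    inner ℂ ((memLp_bpt n).toLp (fun θ => bpt θ ^ n)) F = cf F n := by
  rw [L2.inner_def, cf]
  refine integral_congr_ae ?_
  filter_upwards [(memLp_bpt n).coeFn_toLp] with θ h
  simp only [RCLike.inner_apply]
  rw [h]; simp

lemma l2_orthonormal : Orthonormal ℂ (fun n : ℤ => (memLp_bpt n).toLp (fun θ => bpt θ ^ n)) := by
  rw [orthonormal_iff_ite]
  intro m n
  rw [l2_inner_e, cf_congr (memLp_bpt n).coeFn_toLp, cf_bpt]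

lemma l2_complete : (Submodule.span ℂ (Set.range (fun n : ℤ => (memLp_bpt n).toLp (fun θ => bpt θ ^ n))))ᗮ = ⊥ := by
  rw [Submodule.eq_bot_iff]
  intro F hF
  have h1 : ∀ n, cf F n = 0 := by
    intro n
    rw [← l2_inner_e]
    exact (Submodule.mem_orthogonal _ _).mp hF _ (Submodule.subset_span ⟨n, rfl⟩)
  have h2 := ae_zero_of_cf (Lp.memLp F).int2 h1
  exact (Lp.eq_zero_iff_ae_eq_zero).mpr h2

def l2basis : HilbertBasis ℤ ℂ (Lp ℂ 2 arcM) :=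
  HilbertBasis.mkOfOrthogonalEqBot l2_orthonormal l2_complete

lemma l2basis_apply (n : ℤ) : l2basis n = (memLp_bpt n).toLp (fun θ => bpt θ ^ n) := by
  simp [l2basis]

/-- Riesz–Fischer -/
lemma l2_rf (a : ℤ → ℂ) (ha : Memℓp a 2) : ∃ F, MemLp F 2 arcM ∧ ∀ n, cf F n = a n := by
  refine ⟨l2basis.repr.symm ⟨a, ha⟩, Lp.memLp _, fun n => ?_⟩
  rw [← l2_inner_e, ← l2basis_apply, ← HilbertBasis.repr_apply_apply]
  simp

lemma l2_inner {F G : ℝ → ℂ} (hF : MemLp F 2 arcM) (hG : MemLp G 2 arcM) :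
    HasSum (fun n => cf F n * conj (cf G n)) (∫ θ, F θ * conj (G θ) ∂arcM) := by
  have h := l2basis.hasSum_inner_mul_inner (hG.toLp G) (hF.toLp F)
  have e : inner ℂ (hG.toLp G) (hF.toLp F) = ∫ θ, F θ * conj (G θ) ∂arcM := by
    rw [L2.inner_def]
    refine integral_congr_ae ?_
    filter_upwards [hF.coeFn_toLp, hG.coeFn_toLp] with θ h1 h2
    simp only [RCLike.inner_apply, h1, h2]
  rw [e] at h
  refine h.congr_fun ?_ |> fun h => h
  intro n
  rw [← inner_conj_symm, l2basis_apply, l2_inner_e, l2_inner_e, cf_congr hF.coeFn_toLp,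
    cf_congr hG.coeFn_toLp, mul_comm]

lemma l2_parseval {F : ℝ → ℂ} (hF : MemLp F 2 arcM) :
    HasSum (fun n => ‖cf F n‖ ^ 2) (∫ θ, ‖F θ‖ ^ 2 ∂arcM) := by
  have h := l2_inner hF hF
  simp only [Complex.mul_conj'] at h
  have h2 := Complex.hasSum_re h
  have e : ∫ θ, ((‖F θ‖:ℂ) ^ 2) ∂arcM = ((∫ θ, ‖F θ‖ ^ 2 ∂arcM : ℝ) : ℂ) := by
    rw [← integral_complex_ofReal]; push_cast; rfl
  rw [e] at h2
  simp only [Complex.ofReal_re] at h2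
  refine h2.congr_fun ?_ |> fun h => h
  intro n; norm_cast

lemma MeasureTheory.MemLp.conj' {F : ℝ → ℂ} {q : ℝ≥0∞} (hF : MemLp F q arcM) :
    MemLp (fun t => conj (F t)) q arcM :=
  hF.of_le (Complex.continuous_conj.comp_aestronglyMeasurable hF.1)
    (Eventually.of_forall fun t => by simp)

lemma MeasureTheory.MemLp.bpt_mul {F : ℝ → ℂ} {q : ℝ≥0∞} (hF : MemLp F q arcM) (n : ℤ) :
    MemLp (fun t => bpt t ^ n * F t) q arcM :=
  hF.of_le ((continuous_bpt_zpow n).aestronglyMeasurable.mul hF.1)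
    (Eventually.of_forall fun t => by simp)

lemma l2_mul_int {F G : ℝ → ℂ} (hF : MemLp F 2 arcM) (hG : MemLp G 2 arcM) :
    Integrable (fun θ => F θ * G θ) arcM := hF.integrable_mul hG

lemma cf_mul {F G : ℝ → ℂ} (hF : MemLp F 2 arcM) (hG : MemLp G 2 arcM) (n : ℤ) :
    HasSum (fun k => cf F k * cf G (n - k)) (cf (fun θ => F θ * G θ) n) := by
  have h := l2_inner hF (hG.conj'.bpt_mul n)
  have e1 : ∀ k, conj (cf (fun t => bpt t ^ n * conj (G t)) k) = cf G (n - k) := by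
    intro k
    rw [cf_shift, cf_conj]; simp
  simp only [e1] at h
  convert h using 1
  rw [cf]
  congr 1; ext θ; simp [mul_assoc, mul_comm]

lemma anl_mul {F G : ℝ → ℂ} (hF : MemLp F 2 arcM) (hG : MemLp G 2 arcM) (hFA : Anl F) (hGA : Anl G) :
    Anl (fun θ => F θ * G θ) := by
  intro n hn
  refine (cf_mul hF hG n).unique ?_
  convert hasSum_zero with k
  by_cases h : k < 0
  · simp [hFA k h]
  · rw [hGA (n - k) (by omega)]; simp

lemma cf_mul_nat {F G : ℝ → ℂ} (hF : MemLp F 2 arcM) (hG : MemLp G 2 arcM) (hFA : Anl F) (hGA : Anl G) (n : ℕ) :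
    cf (fun θ => F θ * G θ) n = ∑ k ∈ Finset.range (n + 1), cf F k * cf G ((n:ℤ) - k) := by
  refine (cf_mul hF hG n).unique ?_
  have : ∑ k ∈ Finset.range (n + 1), cf F k * cf G ((n:ℤ) - k) = ∑ k ∈ (Finset.range (n + 1)).map Nat.castEmbedding, cf F k * cf G ((n:ℤ) - k) := by
    rw [Finset.sum_map]; rfl
  rw [this]
  refine hasSum_sum_of_ne_finset_zero ?_
  intro k hk
  by_cases h : k < 0
  · simp [hFA k h]
  · by_cases h2 : (n:ℤ) < k
    · rw [hGA (n - k) (by omega)]; simp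
    · exfalso; apply hk
      simp only [Finset.mem_map, Finset.mem_range]
      exact ⟨k.toNat, by omega, by simp; omega⟩

/-- the L² projection on the analytic part -/
lemma l2_proj {F : ℝ → ℂ} (hF : MemLp F 2 arcM) : ∃ G, MemLp G 2 arcM ∧ Anl G ∧
    ∀ n : ℤ, 0 ≤ n → cf G n = cf F n := by
  obtain ⟨G, hG, hG'⟩ := l2_rf (fun n => if 0 ≤ n then cf F n else 0) (by
    refine memℓp_gen ?_
    have := (l2_parseval hF).summable
    refine Summable.of_nonneg_of_le (fun n => by positivity) (fun n => ?_) this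
    split_ifs <;> simp)
  refine ⟨G, hG, fun n hn => ?_, fun n hn => ?_⟩
  · rw [hG', if_neg (by omega)]
  · rw [hG', if_pos hn]

/-- Pairing of an analytic L² function with L² only sees nonnegative coefficients. -/
lemma l2_inner_anl {F G H : ℝ → ℂ} (hF : MemLp F 2 arcM) (hG : MemLp G 2 arcM) (hH : MemLp H 2 arcM)
    (hA : Anl H) (h : ∀ n : ℤ, 0 ≤ n → cf F n = cf G n) :
    ∫ θ, F θ * conj (H θ) ∂arcM = ∫ θ, G θ * conj (H θ) ∂arcM := by
  refine (l2_inner hF hH).unique ?_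
  convert l2_inner hG hH using 2 with n
  by_cases hn : 0 ≤ n
  · rw [h n hn]
  · rw [hA n (by omega)]; simp

lemma pk_symm (r θ t : ℝ) : pk ((r:ℂ) * bpt θ) t = pk ((r:ℂ) * bpt t) θ := by
  rw [pk_real, pk_real, ← Real.cos_neg (θ - t), neg_sub]

lemma norm_r_bpt {r : ℝ} (h0 : 0 ≤ r) (θ : ℝ) : ‖(r:ℂ) * bpt θ‖ = r := by
  simp [abs_of_nonneg h0]

lemma norm_pois_le {F : ℝ → ℂ} {z : ℂ} (hz : ‖z‖ < 1) :
    ‖pois F z‖ ≤ ∫ t, ‖F t‖ * pk z t ∂arcM := by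
  refine (norm_integral_le_integral_norm _).trans (le_of_eq ?_)
  congr 1; ext t
  rw [norm_mul, Complex.norm_of_nonneg (pk_nonneg hz t)]

lemma rint_mul_pk {u : ℝ → ℝ} (hu : Integrable u arcM) {z : ℂ} (hz : ‖z‖ < 1) :
    Integrable (fun t => u t * pk z t) arcM :=
  hu.mul_bdd (c := (1 - ‖z‖ ^ 2) / (1 - ‖z‖) ^ 2) (continuous_pk hz).aestronglyMeasurable
    (Eventually.of_forall fun t => by
      rw [Real.norm_of_nonneg (pk_nonneg hz t)]; exact pk_le hz t)

/-- Jensen for the Poisson kernel. -/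
lemma rpow_pois_le {u : ℝ → ℝ} (hu : Integrable u arcM) (hu0 : ∀ t, 0 ≤ u t) {p : ℝ} (hp : 1 ≤ p)
    (hup : Integrable (fun t => u t ^ p) arcM) {z : ℂ} (hz : ‖z‖ < 1) :
    (∫ t, u t * pk z t ∂arcM) ^ p ≤ ∫ t, u t ^ p * pk z t ∂arcM := by
  have hm : Measurable (fun t => ENNReal.ofReal (pk z t)) := (continuous_pk hz).measurable.ennreal_ofReal
  set ν := arcM.withDensity (fun t => ENNReal.ofReal (pk z t)) with hν
  have conv : ∀ v : ℝ → ℝ, ∫ t, v t ∂ν = ∫ t, v t * pk z t ∂arcM := by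
    intro v
    rw [hν, integral_withDensity_eq_integral_toReal_smul hm (Eventually.of_forall fun t => ENNReal.ofReal_lt_top)]
    congr 1; ext t
    rw [ENNReal.toReal_ofReal (pk_nonneg hz t), smul_eq_mul, mul_comm]
  have convi : ∀ v : ℝ → ℝ, Integrable v arcM → Integrable v ν := by
    intro v hv
    rw [hν, integrable_withDensity_iff_integrable_smul' hm (Eventually.of_forall fun t => ENNReal.ofReal_lt_top)]
    refine (rint_mul_pk hv hz).congr (Eventually.of_forall fun t => ?_)
    simp only
    rw [ENNReal.toReal_ofReal (pk_nonneg hz t), smul_eq_mul, mul_comm]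
  have hprob : IsProbabilityMeasure ν := by
    constructor
    rw [hν, withDensity_apply _ MeasurableSet.univ, Measure.restrict_univ,
      ← ofReal_integral_eq_lintegral_ofReal (integrable_pk hz) (Eventually.of_forall fun t => pk_nonneg hz t), integral_pk hz]
    simp
  rw [← conv, ← conv]
  exact (convexOn_rpow hp).map_integral_le (f := u) (g := fun x : ℝ => x ^ p)
    (Real.continuous_rpow_const (by linarith)).continuousOn isClosed_Ici
    (Eventually.of_forall fun t => hu0 t) (convi _ hu) (convi _ hup)

lemma continuous_pk2 {r : ℝ} (h0 : 0 ≤ r) (h1 : r < 1) : Continuous (fun x : ℝ × ℝ => pk ((r:ℂ) * bpt x.1) x.2) := by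
  simp only [pk_real]
  refine Continuous.div continuous_const (by fun_prop) ?_
  intro x
  have h3 : 0 < (1 - r) ^ 2 := by have : 0 < 1 - r := by linarith
                                  positivity
  have : 0 ≤ 2 * r * (1 - Real.cos (x.1 - x.2)) :=
    mul_nonneg (by linarith) (by linarith [Real.cos_le_one (x.1 - x.2)])
  linarith

lemma pk2_bdd {r : ℝ} (h0 : 0 ≤ r) (h1 : r < 1) (θ t : ℝ) :
    ‖pk ((r:ℂ) * bpt θ) t‖ ≤ (1 - r ^ 2) / (1 - r) ^ 2 := by
  have hz : ‖(r:ℂ) * bpt θ‖ < 1 := by rw [norm_r_bpt h0]; exact h1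
  rw [Real.norm_of_nonneg (pk_nonneg hz t)]
  have := pk_le hz t
  rwa [norm_r_bpt h0] at this

lemma int2_pk {u : ℝ → ℝ} (hu : Integrable u arcM) {r : ℝ} (h0 : 0 ≤ r) (h1 : r < 1) :
    Integrable (fun x : ℝ × ℝ => u x.2 * pk ((r:ℂ) * bpt x.1) x.2) (arcM.prod arcM) :=
  (hu.comp_snd arcM).mul_bdd (c := (1 - r ^ 2) / (1 - r) ^ 2)
    (continuous_pk2 h0 h1).aestronglyMeasurable (Eventually.of_forall fun x => pk2_bdd h0 h1 _ _)

lemma integral_pois_swap {u : ℝ → ℝ} (hu : Integrable u arcM) {r : ℝ} (h0 : 0 ≤ r) (h1 : r < 1) :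
    ∫ θ, (∫ t, u t * pk ((r:ℂ) * bpt θ) t ∂arcM) ∂arcM = ∫ t, u t ∂arcM := by
  rw [integral_integral_swap (int2_pk hu h0 h1)]
  congr 1; ext t
  rw [integral_const_mul]
  have hz : ‖(r:ℂ) * bpt t‖ < 1 := by rw [norm_r_bpt h0]; exact h1
  have := integral_pk hz
  simp_rw [pk_symm r _ t]
  rw [this, mul_one]

lemma continuous_cau_r {F : ℝ → ℂ} {r : ℝ} (hF : Integrable F arcM) (h0 : 0 ≤ r) (h1 : r < 1) :
    Continuous (fun θ => pois F ((r:ℂ) * bpt θ)) := by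
  unfold pois
  refine continuous_of_dominated (bound := fun t => ‖F t‖ * ((1 - r ^ 2) / (1 - r) ^ 2)) ?_ ?_ ?_ ?_
  · intro θ
    have hz : ‖(r:ℂ) * bpt θ‖ < 1 := by rw [norm_r_bpt h0]; exact h1
    exact (integrable_mul_pk hF hz).1
  · intro θ
    refine Eventually.of_forall fun t => ?_
    rw [norm_mul, Complex.norm_real]
    gcongr
    exact pk2_bdd h0 h1 θ t
  · exact hF.norm.mul_const _
  · refine Eventually.of_forall fun t => ?_
    have hc : Continuous (fun θ : ℝ => (θ, t)) := by fun_prop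
    have : Continuous (fun θ => pk ((r:ℂ) * bpt θ) t) := by
      have := (continuous_pk2 h0 h1).comp hc
      simpa only [Function.comp_def] using this
    exact continuous_const.mul (Complex.continuous_ofReal.comp this)

lemma jensen {F : ℝ → ℂ} {p : ℝ} (hp : 1 ≤ p) (hF : Integrable F arcM)
    (hFp : Integrable (fun t => ‖F t‖ ^ p) arcM) {r : ℝ} (h0 : 0 ≤ r) (h1 : r < 1) :
    ∫ θ, ‖pois F ((r:ℂ) * bpt θ)‖ ^ p ∂arcM ≤ ∫ t, ‖F t‖ ^ p ∂arcM := by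
  rw [← integral_pois_swap hFp h0 h1]
  have hi := (int2_pk hFp h0 h1).integral_prod_left
  refine integral_mono_of_nonneg (Eventually.of_forall fun θ => by positivity) hi ?_
  · refine Eventually.of_forall fun θ => ?_
    have hz : ‖(r:ℂ) * bpt θ‖ < 1 := by rw [norm_r_bpt h0]; exact h1
    refine le_trans ?_ (rpow_pois_le hF.norm (fun t => norm_nonneg _) hp hFp hz)
    exact Real.rpow_le_rpow (norm_nonneg _) (norm_pois_le hz) (by linarith)

lemma norm_pois_le_bdd {F : ℝ → ℂ} {C : ℝ} (hF : Integrable F arcM) (hb : ∀ᵐ t ∂arcM, ‖F t‖ ≤ C) {z : ℂ} (hz : ‖z‖ < 1) :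
    ‖pois F z‖ ≤ C := by
  refine (norm_pois_le hz).trans ?_
  calc ∫ t, ‖F t‖ * pk z t ∂arcM ≤ ∫ t, C * pk z t ∂arcM := by
        refine integral_mono_ae (rint_mul_pk hF.norm hz) ((integrable_pk hz).const_mul C) ?_
        filter_upwards [hb] with t ht
        exact mul_le_mul_of_nonneg_right ht (pk_nonneg hz t)
    _ = C := by rw [integral_const_mul, integral_pk hz, mul_one]

/-! analyticity of the Cauchy transform -/
lemma cau_analytic {F : ℝ → ℂ} (hF : Integrable F arcM) : AnalyticOnDisc (cau F) := by
  have hb : ∀ z ∈ uDisc, ‖z‖ < 1 := fun z hz => by simpa [uDisc] using hz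
  intro z hz
  have hz' := hb z hz
  obtain ⟨ρ, h1, h2⟩ := exists_between hz'
  have hs : Summable (fun n : ℕ => (∫ t, ‖F t‖ ∂arcM) * ρ ^ n) :=
    (summable_geometric_of_lt_one ((norm_nonneg _).trans h1.le) h2).mul_left _
  have hd := differentiableOn_tsum_of_summable_norm (U := ball (0:ℂ) ρ) (F := fun (n : ℕ) (w : ℂ) => cf F n * w ^ n) hs
    (fun n => by fun_prop) isOpen_ball (fun n w hw => by
      rw [norm_mul, norm_pow]
      have : ‖w‖ ≤ ρ := by simpa using (mem_ball_zero_iff.mp hw).le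
      gcongr
      exact norm_cf_le F n)
  have hmem : ball (0:ℂ) ρ ∈ 𝓝 z := isOpen_ball.mem_nhds (by simpa using h1)
  have := (hd.differentiableAt hmem)
  refine (this.congr_of_eventuallyEq ?_).differentiableWithinAt
  filter_upwards [hmem] with w hw
  have : ‖w‖ < 1 := (mem_ball_zero_iff.mp hw).trans h2
  exact (cau_hasSum hF this).tsum_eq.symm

lemma cau_zero {F : ℝ → ℂ} : cau F 0 = cf F 0 := by
  simp [cau, cf, ck]

lemma fatou_cau {F : ℝ → ℂ} (hF : Integrable F arcM) (hA : Anl F) : BoundaryFn (cau F) F := by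
  filter_upwards [fatou hF] with θ hθ
  refine hθ.congr' ?_
  have h2 : ∀ᶠ r : ℝ in 𝓝[<] 1, r ∈ Ioo (0:ℝ) 1 := Ioo_mem_nhdsLT (by norm_num)
  filter_upwards [h2] with r hr
  have hz : ‖(r:ℂ) * bpt θ‖ < 1 := by rw [norm_r_bpt hr.1.le]; exact hr.2
  exact pois_anl hF hA hz

lemma bdry_unique {f : ℂ → ℂ} {F G : ℝ → ℂ} (hF : BoundaryFn f F) (hG : BoundaryFn f G) : F =ᵐ[arcM] G := by
  filter_upwards [hF, hG] with θ h1 h2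
  exact tendsto_nhds_unique h1 h2

lemma T2 {F : ℝ → ℂ} {p : ℝ} (hp : 1 ≤ p) (hF : Integrable F arcM)
    (hFp : Integrable (fun t => ‖F t‖ ^ p) arcM) (hA : Anl F) {r : ℝ} (h0 : 0 ≤ r) (h1 : r < 1) :
    hMean p (cau F) r ≤ ∫ t, ‖F t‖ ^ p ∂arcM := by
  refine le_trans (le_of_eq ?_) (jensen hp hF hFp h0 h1)
  unfold hMean
  congr 1; ext θ
  have hz : ‖(r:ℂ) * bpt θ‖ < 1 := by rw [norm_r_bpt h0]; exact h1
  rw [pois_anl hF hA hz]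

lemma T2' {F : ℝ → ℂ} {p : ℝ} (hp : 1 ≤ p) (hF : Integrable F arcM)
    (hFp : Integrable (fun t => ‖F t‖ ^ p) arcM) (hA : Anl F) : MemHp p (cau F) := by
  refine ⟨cau_analytic hF, ∫ t, ‖F t‖ ^ p ∂arcM, ?_⟩
  rintro _ ⟨r, hr, rfl⟩
  exact T2 hp hF hFp hA hr.1.le hr.2

lemma mem_uDisc {z : ℂ} : z ∈ uDisc ↔ ‖z‖ < 1 := by simp [uDisc]

lemma taylor_disc {g : ℂ → ℂ} (hg : AnalyticOnDisc g) :
    ∃ a : ℕ → ℂ, ∀ z : ℂ, ‖z‖ < 1 → HasSum (fun n => a n * z ^ n) (g z) := by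
  refine ⟨fun n => (n.factorial : ℂ)⁻¹ * iteratedDeriv n g 0, fun z hz => ?_⟩
  have := Complex.hasSum_taylorSeries_on_ball (r := 1) (f := g) (c := 0) (by simpa [AnalyticOnDisc, uDisc] using hg)
    (z := z) (by simpa using hz)
  refine this.congr_fun ?_ |> fun h => h
  intro n
  simp only [sub_zero, smul_eq_mul]; ring

lemma series_pair {b : ℕ → ℂ} (hb : Summable fun n => ‖b n‖) {F : ℝ → ℂ} (hF : Integrable F arcM) :
    HasSum (fun n : ℕ => b n * cf F (-(n:ℤ))) (∫ θ, (∑' n : ℕ, b n * bpt θ ^ n) * F θ ∂arcM) := by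
  have h1 : ∀ n : ℕ, Integrable (fun t => b n * bpt t ^ n * F t) arcM := fun n => by
    have := (hF.mul_bpt n).const_mul (b n)
    refine this.congr (Eventually.of_forall fun t => ?_)
    simp; ring
  have h2 : Summable fun n : ℕ => ∫ t, ‖b n * bpt t ^ n * F t‖ ∂arcM := by
    have : ∀ n : ℕ, ∫ t, ‖b n * bpt t ^ n * F t‖ ∂arcM = ‖b n‖ * (∫ t, ‖F t‖ ∂arcM) := by
      intro n; simp [integral_const_mul]
    simp_rw [this]
    exact hb.mul_right _
  have h3 := hasSum_integral_of_summable_integral_norm h1 h2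
  have hs : ∀ t, Summable (fun n => b n * bpt t ^ n) := fun t =>
    Summable.of_norm (by simpa using hb)
  have h4 : ∀ t, ∑' n : ℕ, b n * bpt t ^ n * F t = (∑' n : ℕ, b n * bpt t ^ n) * F t := fun t =>
    (hs t).tsum_mul_right _
  simp_rw [h4] at h3
  refine h3.congr_fun ?_ |> fun h => h
  intro n
  simp only [mul_assoc]
  rw [integral_const_mul, cf]
  congr 2; ext t; simp [mul_comm]

lemma cf_series {b : ℕ → ℂ} (hb : Summable fun n => ‖b n‖) (m : ℤ) :
    cf (fun θ => ∑' n : ℕ, b n * bpt θ ^ n) m = if 0 ≤ m then b m.toNat else 0 := by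
  have hF : Integrable (fun θ => bpt θ ^ (-m)) arcM := (memLp_bpt (-m)).int2
  have h := series_pair hb hF
  refine h.unique ?_
  simp only [cf_bpt]
  split_ifs with hm
  · convert hasSum_single m.toNat ?_ using 1
    · rw [if_pos (by omega), mul_one]
    · intro n hn
      rw [if_neg (by omega), mul_zero]
  · convert hasSum_zero with n
    rw [if_neg (by omega), mul_zero]

lemma summable_dil {a : ℕ → ℂ} {g : ℂ → ℂ} (ha : ∀ z : ℂ, ‖z‖ < 1 → HasSum (fun n => a n * z ^ n) (g z))
    {r : ℝ} (h0 : 0 ≤ r) (h1 : r < 1) : Summable fun n => ‖a n * (r:ℂ) ^ n‖ :=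
  (ha r (by simpa [abs_of_nonneg h0] using h1)).summable.norm

lemma dil_eq {a : ℕ → ℂ} {g : ℂ → ℂ} (ha : ∀ z : ℂ, ‖z‖ < 1 → HasSum (fun n => a n * z ^ n) (g z))
    {r : ℝ} (h0 : 0 ≤ r) (h1 : r < 1) (θ : ℝ) :
    g ((r:ℂ) * bpt θ) = ∑' n : ℕ, (a n * (r:ℂ) ^ n) * bpt θ ^ n := by
  rw [← (ha _ (by rw [norm_r_bpt h0]; exact h1)).tsum_eq]
  congr 1; ext n; rw [mul_pow]; ring

lemma cf_dil {a : ℕ → ℂ} {g : ℂ → ℂ} (ha : ∀ z : ℂ, ‖z‖ < 1 → HasSum (fun n => a n * z ^ n) (g z))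
    {r : ℝ} (h0 : 0 ≤ r) (h1 : r < 1) (m : ℤ) :
    cf (fun θ => g ((r:ℂ) * bpt θ)) m = if 0 ≤ m then a m.toNat * (r:ℂ) ^ m.toNat else 0 := by
  simp_rw [dil_eq ha h0 h1]
  exact cf_series (summable_dil ha h0 h1) m

lemma continuous_dil {g : ℂ → ℂ} (hg : AnalyticOnDisc g) {r : ℝ} (h0 : 0 ≤ r) (h1 : r < 1) :
    Continuous (fun θ => g ((r:ℂ) * bpt θ)) := by
  have : ContinuousOn g uDisc := hg.continuousOn
  refine this.comp_continuous (by fun_prop) ?_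
  intro θ; rw [mem_uDisc, norm_r_bpt h0]; exact h1

lemma bdd_dil {g : ℂ → ℂ} (hg : AnalyticOnDisc g) {r : ℝ} (h0 : 0 ≤ r) (h1 : r < 1) :
    ∃ C, ∀ θ, ‖g ((r:ℂ) * bpt θ)‖ ≤ C := by
  have h2 : closedBall (0:ℂ) r ⊆ uDisc := fun z hz => by
    rw [mem_uDisc]; have := mem_closedBall_zero_iff.mp hz; linarith
  obtain ⟨C, hC⟩ := (isCompact_closedBall (0:ℂ) r).exists_bound_of_continuousOn (hg.continuousOn.mono h2)
  refine ⟨C, fun θ => hC _ ?_⟩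
  rw [mem_closedBall_zero_iff, norm_r_bpt h0]

lemma memLp_dil {g : ℂ → ℂ} (hg : AnalyticOnDisc g) {r : ℝ} (h0 : 0 ≤ r) (h1 : r < 1) (q : ℝ≥0∞) :
    MemLp (fun θ => g ((r:ℂ) * bpt θ)) q arcM := by
  obtain ⟨C, hC⟩ := bdd_dil hg h0 h1
  exact MemLp.of_bound (continuous_dil hg h0 h1).aestronglyMeasurable C (Eventually.of_forall hC)

/-- a sequence of radii -/
def rad (n : ℕ) : ℝ := 1 - 1 / ((n:ℝ) + 2)

lemma rad_mem (n : ℕ) : rad n ∈ Ioo (0:ℝ) 1 := by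
  have : (0:ℝ) < (n:ℝ) + 2 := by positivity
  have h2 : 1 / ((n:ℝ) + 2) < 1 := by rw [div_lt_one this]; linarith [(Nat.cast_nonneg n : (0:ℝ) ≤ n)]
  have h3 : 0 < 1 / ((n:ℝ) + 2) := by positivity
  constructor <;> simp only [rad] <;> linarith

lemma rad_tendsto' : Tendsto rad atTop (𝓝 1) := by
  have h : Tendsto (fun n : ℕ => 1 / ((n:ℝ) + 2)) atTop (𝓝 0) := by
    have := tendsto_one_div_add_atTop_nhds_zero_nat (𝕜 := ℝ)
    have := (tendsto_add_atTop_iff_nat 1).mpr this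
    refine this.congr fun n => ?_
    push_cast; ring
  have h2 := h.const_sub 1
  rw [sub_zero] at h2
  exact h2

lemma rad_tendsto : Tendsto rad atTop (𝓝[<] 1) :=
  tendsto_nhdsWithin_iff.mpr ⟨rad_tendsto', Eventually.of_forall fun n => (rad_mem n).2⟩

lemma bdry_aesm {g : ℂ → ℂ} (hg : AnalyticOnDisc g) {G : ℝ → ℂ} (hG : BoundaryFn g G) :
    AEStronglyMeasurable G arcM := by
  refine aestronglyMeasurable_of_tendsto_ae atTop (f := fun (n : ℕ) θ => g ((rad n : ℂ) * bpt θ)) ?_ ?_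
  · intro n; exact (continuous_dil hg (rad_mem n).1.le (rad_mem n).2).aestronglyMeasurable
  · filter_upwards [hG] with θ h
    exact h.comp rad_tendsto

/-- bounded analytic functions with given boundary function -/
lemma bddAnalytic {g : ℂ → ℂ} (hg : AnalyticOnDisc g) {C : ℝ} (hC : ∀ z, ‖z‖ < 1 → ‖g z‖ ≤ C)
    {G : ℝ → ℂ} (hG : BoundaryFn g G) :
    AEStronglyMeasurable G arcM ∧ (∀ᵐ θ ∂arcM, ‖G θ‖ ≤ C) ∧ Anl G ∧ ∀ z, ‖z‖ < 1 → cau G z = g z := by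
  have hm := bdry_aesm hg hG
  have hz : ∀ n θ, ‖(rad n : ℂ) * bpt θ‖ < 1 := fun n θ => by
    rw [norm_r_bpt (rad_mem n).1.le]; exact (rad_mem n).2
  have hb : ∀ᵐ θ ∂arcM, ‖G θ‖ ≤ C := by
    filter_upwards [hG] with θ h
    exact le_of_tendsto (h.comp rad_tendsto).norm (Eventually.of_forall fun n => hC _ (hz n θ))
  obtain ⟨a, ha⟩ := taylor_disc hg
  have hlim : ∀ m : ℤ, Tendsto (fun n => cf (fun θ => g ((rad n : ℂ) * bpt θ)) m) atTop (𝓝 (cf G m)) := by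
    intro m
    refine tendsto_integral_of_dominated_convergence (fun _ => C) ?_ (integrable_const C) ?_ ?_
    · intro n
      exact ((continuous_dil hg (rad_mem n).1.le (rad_mem n).2).mul (continuous_bpt_zpow _)).aestronglyMeasurable
    · intro n; refine Eventually.of_forall fun θ => ?_
      rw [norm_mul, norm_bpt_zpow, mul_one]; exact hC _ (hz n θ)
    · filter_upwards [hG] with θ h
      exact (h.comp rad_tendsto).mul_const _
  have hcf : ∀ m : ℤ, cf G m = if 0 ≤ m then a m.toNat else 0 := by
    intro m
    refine tendsto_nhds_unique (hlim m) ?_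
    simp_rw [cf_dil ha (rad_mem _).1.le (rad_mem _).2]
    split_ifs
    · have h1 : Tendsto (fun n => ((rad n : ℝ) : ℂ)) atTop (𝓝 1) := by
        have := (Complex.continuous_ofReal.tendsto 1).comp rad_tendsto'
        simpa [Function.comp_def] using this
      simpa using (h1.pow m.toNat).const_mul (a m.toNat)
    · exact tendsto_const_nhds
  have hi : Integrable G arcM := Integrable.of_bound hm C hb
  refine ⟨hm, hb, fun n hn => by rw [hcf, if_neg (by omega)], fun z hz => ?_⟩
  refine (cau_hasSum hi hz).unique ?_
  refine (ha z hz).congr_fun ?_ |> fun h => h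
  intro n; rw [hcf]; simp

lemma anl_comp {V : ℝ → ℂ} (hV : Integrable V arcM) (hA : Anl V) {Φ : ℂ → ℂ} {U : Set ℂ}
    (hU : IsOpen U) (hΦ : DifferentiableOn ℂ Φ U) {C : ℝ} (hC : ∀ w ∈ U, ‖Φ w‖ ≤ C)
    (hVU : ∀ z, ‖z‖ < 1 → cau V z ∈ U) (hVc : ∀ᵐ θ ∂arcM, V θ ∈ U) :
    AEStronglyMeasurable (fun θ => Φ (V θ)) arcM ∧ (∀ᵐ θ ∂arcM, ‖Φ (V θ)‖ ≤ C) ∧ Anl (fun θ => Φ (V θ)) ∧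
      ∀ z, ‖z‖ < 1 → cau (fun θ => Φ (V θ)) z = Φ (cau V z) := by
  refine bddAnalytic (g := fun z => Φ (cau V z)) ?_ (fun z hz => hC _ (hVU z hz)) ?_
  · exact hΦ.comp (cau_analytic hV) (fun z hz => hVU z (mem_uDisc.mp hz))
  · filter_upwards [fatou_cau hV hA, hVc] with θ h1 h2
    have : ContinuousAt Φ (V θ) := (hΦ.differentiableAt (hU.mem_nhds h2)).continuousAt
    exact this.tendsto.comp h1

/-- Schwarz completion of a real L² function -/
lemma schwarz {u : ℝ → ℝ} (hu : MemLp u 2 arcM) : ∃ V : ℝ → ℂ, MemLp V 2 arcM ∧ Anl V ∧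
    (∀ᵐ θ ∂arcM, (V θ).re = u θ) ∧ (∀ z, ‖z‖ < 1 → (cau V z).re = ∫ t, u t * pk z t ∂arcM) ∧
    ∫ θ, ‖V θ‖ ^ 2 ∂arcM ≤ 4 * ∫ θ, u θ ^ 2 ∂arcM ∧ cf V 0 = (∫ θ, u θ ∂arcM : ℝ) ∧
    ∀ n : ℤ, 0 < n → cf V n = 2 * cf (fun θ => (u θ : ℂ)) n := by
  have huc : MemLp (fun θ => (u θ : ℂ)) 2 arcM := hu.ofReal
  set U : ℝ → ℂ := fun θ => (u θ : ℂ) with hU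
  obtain ⟨G, hG, hGA, hGc⟩ := l2_proj huc
  set V : ℝ → ℂ := fun θ => 2 * G θ - cf U 0 with hVdef
  have hV : MemLp V 2 arcM := (hG.const_mul 2).sub (memLp_const _)
  have hVc : ∀ n, cf V n = 2 * cf G n - if n = 0 then cf U 0 else 0 := by
    intro n
    rw [hVdef, cf_sub (hG.const_mul 2).int2 (integrable_const _), cf_smul, cf_const]
  have hVA : Anl V := fun n hn => by rw [hVc, hGA n hn, if_neg hn.ne]; simp
  have hV0 : cf V 0 = cf U 0 := by rw [hVc, hGc 0 le_rfl]; simp; ring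
  have hVn : ∀ n : ℤ, 0 < n → cf V n = 2 * cf U n := fun n hn => by
    rw [hVc, hGc n hn.le, if_neg hn.ne']; simp
  have hcau : ∀ z, ‖z‖ < 1 → cau V z = 2 * cau U z - cf U 0 := by
    intro z hz
    have h1 := cau_hasSum hV.int2 hz
    have h2 := ((cau_hasSum huc.int2 hz).mul_left 2).sub (hasSum_ite_eq 0 (cf U 0))
    refine h1.unique (h2.congr_fun ?_ |> fun h => h)
    intro n
    rw [hVc, hGc _ (by omega)]
    by_cases hn : n = 0
    · subst hn; simp
    · simp [hn]; ring
  have hre : ∀ z, ‖z‖ < 1 → (cau V z).re = ∫ t, u t * pk z t ∂arcM := by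
    intro z hz
    have h1 := pois_eq huc.int2 hz
    have h2 : (fun t => conj (U t)) = U := by ext t; simp [hU]
    rw [h2] at h1
    have h3 : pois U z = ((∫ t, u t * pk z t ∂arcM : ℝ) : ℂ) := by
      rw [pois, ← integral_complex_ofReal]; simp [hU]
    have h4 := congrArg Complex.re (h3.symm.trans h1)
    rw [hcau z hz]
    simp only [Complex.ofReal_re, Complex.sub_re, Complex.add_re, Complex.conj_re] at h4
    rw [h4]; simp; ring
  refine ⟨V, hV, hVA, ?_, hre, ?_, ?_, hVn⟩
  · filter_upwards [fatou_cau hV.int2 hVA, fatou huc.int2] with θ h1 h2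
    have h3 := (Complex.continuous_re.tendsto _).comp h1
    have h4 := (Complex.continuous_re.tendsto _).comp h2
    have h5 : (U θ).re = u θ := by simp [hU]
    rw [← h5]
    refine tendsto_nhds_unique h3 (h4.congr' ?_)
    have h2 : ∀ᶠ r : ℝ in 𝓝[<] 1, r ∈ Ioo (0:ℝ) 1 := Ioo_mem_nhdsLT (by norm_num)
    filter_upwards [h2] with r hr
    have hz : ‖(r:ℂ) * bpt θ‖ < 1 := by rw [norm_r_bpt hr.1.le]; exact hr.2
    simp only [Function.comp]
    rw [hre _ hz, pois_re huc.int2 hz]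
    simp [hU]
  · have h1 := l2_parseval hV
    have h2 := (l2_parseval huc).mul_left 4
    have h3 : ∫ θ, ‖U θ‖ ^ 2 ∂arcM = ∫ θ, u θ ^ 2 ∂arcM := by simp [hU]
    rw [h3] at h2
    refine hasSum_le (fun n => ?_) h1 h2
    rcases lt_trichotomy n 0 with h | h | h
    · rw [hVA n h]; simp
    · subst h; rw [hV0]; nlinarith [sq_nonneg ‖cf U 0‖]
    · rw [hVn n h, norm_mul, mul_pow]; norm_num
  · rw [hV0, cf_zero_eq, ← integral_complex_ofReal]

lemma re_cau_ge {u : ℝ → ℝ} {c : ℝ} (hu : Integrable u arcM) (h : ∀ᵐ t ∂arcM, c ≤ u t) {z : ℂ} (hz : ‖z‖ < 1) :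
    c ≤ ∫ t, u t * pk z t ∂arcM := by
  calc c = ∫ t, c * pk z t ∂arcM := by rw [integral_const_mul, integral_pk hz, mul_one]
    _ ≤ _ := by
      refine integral_mono_ae ((integrable_pk hz).const_mul c) (rint_mul_pk hu hz) ?_
      filter_upwards [h] with t ht
      exact mul_le_mul_of_nonneg_right ht (pk_nonneg hz t)

/-- square-root factorization -/
lemma factor_dil {g : ℂ → ℂ} (hg : AnalyticOnDisc g) {r : ℝ} (h0 : 0 ≤ r) (h1 : r < 1) :
    ∃ A B : ℝ → ℂ, MemLp A 2 arcM ∧ MemLp B 2 arcM ∧ Anl A ∧ Anl B ∧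
      (∀ᵐ θ ∂arcM, g ((r:ℂ) * bpt θ) = A θ * B θ) ∧
      ∫ θ, ‖A θ‖ ^ 2 ∂arcM ≤ 4 * (1 + hMean 1 g r) ∧ ∫ θ, ‖B θ‖ ^ 2 ∂arcM ≤ 4 * (1 + hMean 1 g r) := by
  obtain ⟨C, hC⟩ := bdd_dil hg h0 h1
  have hcont := continuous_dil hg h0 h1
  set f : ℝ → ℂ := fun θ => g ((r:ℂ) * bpt θ) with hf
  have hfm : MemLp f 2 arcM := memLp_dil hg h0 h1 2
  have hfA : Anl f := by
    obtain ⟨a, ha⟩ := taylor_disc hg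
    intro n hn
    rw [hf, cf_dil ha h0 h1, if_neg (by omega)]
  set u : ℝ → ℝ := fun θ => Real.sqrt (1 + ‖f θ‖) with hu
  have huc : Continuous u := by fun_prop
  have hu1 : ∀ θ, 1 ≤ u θ := fun θ => by
    rw [hu]; simp only; rw [Real.one_le_sqrt]; linarith [norm_nonneg (f θ)]
  have hum : MemLp u 2 arcM := by
    refine MemLp.of_bound huc.aestronglyMeasurable (Real.sqrt (1 + C)) (Eventually.of_forall fun θ => ?_)
    rw [Real.norm_of_nonneg (Real.sqrt_nonneg _)]
    exact Real.sqrt_le_sqrt (by linarith [hC θ])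
  have husq : ∫ θ, u θ ^ 2 ∂arcM = 1 + hMean 1 g r := by
    have : ∀ θ, u θ ^ 2 = 1 + ‖f θ‖ := fun θ => Real.sq_sqrt (by positivity)
    simp_rw [this]
    rw [integral_add (integrable_const _) hfm.int2.norm]
    simp [hMean, hf]
  obtain ⟨V, hV, hVA, hVre, hVc, hVn, -, -⟩ := schwarz hum
  have hVge : ∀ᵐ θ ∂arcM, u θ ≤ ‖V θ‖ := by
    filter_upwards [hVre] with θ h
    rw [← h]; exact Complex.re_le_norm _
  obtain ⟨hm, hb, hA, -⟩ := anl_comp hV.int2 hVA (Φ := fun w => w⁻¹) (U := {w | 1/2 < w.re})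
    (isOpen_lt continuous_const Complex.continuous_re)
    (by
      intro w hw
      have : w ≠ 0 := by rintro rfl; simp at hw; linarith
      exact (differentiableAt_inv this).differentiableWithinAt) (C := 2)
    (by
      intro w hw
      have h2 : 1/2 < ‖w‖ := lt_of_lt_of_le hw (Complex.re_le_norm w)
      rw [norm_inv, inv_le_comm₀ (by linarith) (by norm_num)]; linarith)
    (by
      intro z hz
      have := re_cau_ge (hum.integrable (by norm_num)) (Eventually.of_forall hu1) hz
      rw [← hVc z hz] at this
      show 1/2 < (cau V z).re
      linarith)
    (by
      filter_upwards [hVre] with θ h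
      show 1/2 < (V θ).re
      rw [h]; linarith [hu1 θ])
  have hI : MemLp (fun θ => (V θ)⁻¹) 2 arcM := MemLp.of_bound hm 2 hb
  have hBn : ∀ᵐ θ ∂arcM, ‖f θ * (V θ)⁻¹‖ ≤ ‖u θ‖ := by
    filter_upwards [hVge] with θ h
    have h2 := hu1 θ
    have h3 : u θ ^ 2 = 1 + ‖f θ‖ := Real.sq_sqrt (by positivity)
    rw [norm_mul, norm_inv, ← div_eq_mul_inv, div_le_iff₀ (by linarith), Real.norm_of_nonneg (by linarith)]
    nlinarith
  have hBm : MemLp (fun θ => f θ * (V θ)⁻¹) 2 arcM := hum.of_le (hfm.1.mul hm) hBn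
  refine ⟨V, fun θ => f θ * (V θ)⁻¹, hV, hBm, hVA, anl_mul hfm hI hfA hA, ?_, ?_, ?_⟩
  · filter_upwards [hVge] with θ h
    have : V θ ≠ 0 := by
      intro h0; rw [h0] at h; simp at h; linarith [hu1 θ]
    field_simp; rfl
  · rw [← husq]; exact hVn
  · have : ∫ θ, ‖f θ * (V θ)⁻¹‖ ^ 2 ∂arcM ≤ ∫ θ, u θ ^ 2 ∂arcM := by
      refine integral_mono_ae (hBm.integrable_norm_pow (by norm_num)) hum.integrable_sq ?_
      filter_upwards [hBn] with θ h
      have : ‖f θ * (V θ)⁻¹‖ ^ 2 ≤ ‖u θ‖ ^ 2 := by gcongr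
      simpa using this
    have h2 : 0 ≤ ∫ θ, u θ ^ 2 ∂arcM := integral_nonneg fun θ => by positivity
    rw [← husq]; linarith

lemma ultra_lim (u : Ultrafilter ℕ) {x : ℕ → ℂ} {C : ℝ} (h : ∀ n, ‖x n‖ ≤ C) : ∃ y, Tendsto x u (𝓝 y) := by
  obtain ⟨y, -, hy⟩ := (isCompact_closedBall (0:ℂ) C).ultrafilter_le_nhds (u.map x) (by
    rw [le_principal_iff]
    exact Filter.Eventually.of_forall (f := (u:Filter ℕ)) fun n => by simpa using h n)
  exact ⟨y, hy⟩

lemma ultra_l2 (u : Ultrafilter ℕ) {A : ℕ → ℝ → ℂ} {C : ℝ} (hA : ∀ n, MemLp (A n) 2 arcM)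
    (hAA : ∀ n, Anl (A n)) (hC : ∀ n, ∫ θ, ‖A n θ‖ ^ 2 ∂arcM ≤ C) :
    ∃ F, MemLp F 2 arcM ∧ Anl F ∧ ∀ k, Tendsto (fun n => cf (A n) k) u (𝓝 (cf F k)) := by
  have hb : ∀ k n, ‖cf (A n) k‖ ≤ Real.sqrt C := by
    intro k n
    have h1 := l2_parseval (hA n)
    have h2 : ‖cf (A n) k‖ ^ 2 ≤ C := (le_hasSum h1 k (fun j _ => by positivity)).trans (hC n)
    exact Real.le_sqrt_of_sq_le h2
  choose a ha using fun k => ultra_lim u (hb k)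
  have hmem : Memℓp a 2 := by
    refine memℓp_gen ?_
    refine summable_of_sum_le (c := C) (fun k => by positivity) (fun s => ?_)
    have h1 : Tendsto (fun n => ∑ k ∈ s, ‖cf (A n) k‖ ^ 2) u (𝓝 (∑ k ∈ s, ‖a k‖ ^ 2)) :=
      tendsto_finsetSum _ fun k _ => ((ha k).norm.pow 2)
    have h2 := le_of_tendsto h1 (Eventually.of_forall fun n =>
      (sum_le_hasSum s (fun j _ => by positivity) (l2_parseval (hA n))).trans (hC n))
    simpa using h2
  obtain ⟨F, hF, hFc⟩ := l2_rf a hmem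
  refine ⟨F, hF, fun k hk => ?_, fun k => by rw [hFc]; exact ha k⟩
  rw [hFc]
  refine tendsto_nhds_unique (ha k) ?_
  simp_rw [fun n => hAA n k hk]
  exact tendsto_const_nhds

lemma le_one_add_rpow {x p : ℝ} (hx : 0 ≤ x) (hp : 1 ≤ p) : x ≤ 1 + x ^ p := by
  rcases le_total x 1 with h | h
  · have := Real.rpow_nonneg hx p; linarith
  · have := Real.rpow_le_rpow_of_exponent_le h hp
    rw [Real.rpow_one] at this; linarith

lemma integrable_dil_rpow {f : ℂ → ℂ} (hf : AnalyticOnDisc f) {p : ℝ} (hp : 0 ≤ p) {r : ℝ} (h0 : 0 ≤ r) (h1 : r < 1) :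
    Integrable (fun θ => ‖f ((r:ℂ) * bpt θ)‖ ^ p) arcM := by
  obtain ⟨C, hC⟩ := bdd_dil hf h0 h1
  refine Integrable.of_bound (C := C ^ p) ?_ (Eventually.of_forall fun θ => ?_)
  · exact ((continuous_dil hf h0 h1).norm.rpow_const (fun _ => Or.inr hp)).aestronglyMeasurable
  · rw [Real.norm_of_nonneg (by positivity)]
    exact Real.rpow_le_rpow (norm_nonneg _) (hC θ) hp

lemma hMean_one_le {f : ℂ → ℂ} (hf : AnalyticOnDisc f) {p : ℝ} (hp : 1 ≤ p) {r : ℝ} (h0 : 0 ≤ r) (h1 : r < 1) :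
    hMean 1 f r ≤ 1 + hMean p f r := by
  have h2 : ∫ θ, (1 + ‖f ((r:ℂ) * bpt θ)‖ ^ p) ∂arcM = 1 + hMean p f r := by
    rw [integral_add (integrable_const _) (integrable_dil_rpow hf (by linarith) h0 h1)]
    simp [hMean]
  rw [← h2]
  refine integral_mono (integrable_dil_rpow hf (by norm_num) h0 h1)
    ((integrable_const _).add (integrable_dil_rpow hf (by linarith) h0 h1)) (fun θ => ?_)
  simp only [Real.rpow_one]
  exact le_one_add_rpow (norm_nonneg _) hp

lemma fatou_lemma_int {p C : ℝ} (hp : 0 ≤ p) {f : ℕ → ℝ → ℂ} {F : ℝ → ℂ} 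
    (hfm : ∀ n, AEStronglyMeasurable (f n) arcM)
    (hfi : ∀ n, Integrable (fun θ => ‖f n θ‖ ^ p) arcM)
    (hC : ∀ n, ∫ θ, ‖f n θ‖ ^ p ∂arcM ≤ C) (hlim : ∀ᵐ θ ∂arcM, Tendsto (fun n => f n θ) atTop (𝓝 (F θ))) :
    Integrable (fun θ => ‖F θ‖ ^ p) arcM ∧ ∫ θ, ‖F θ‖ ^ p ∂arcM ≤ C := by
  have hFm : AEStronglyMeasurable F arcM := aestronglyMeasurable_of_tendsto_ae atTop hfm hlim
  have hcp : Continuous (fun x : ℂ => ‖x‖ ^ p) := continuous_norm.rpow_const (fun _ => Or.inr hp)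
  have hFpm : AEStronglyMeasurable (fun θ => ‖F θ‖ ^ p) arcM := hcp.comp_aestronglyMeasurable hFm
  have hC0 : 0 ≤ C := (integral_nonneg fun θ => by positivity).trans (hC 0)
  have h1 : ∫⁻ θ, ENNReal.ofReal (‖F θ‖ ^ p) ∂arcM ≤ ENNReal.ofReal C := by
    calc ∫⁻ θ, ENNReal.ofReal (‖F θ‖ ^ p) ∂arcM 
        ≤ ∫⁻ θ, liminf (fun n => ENNReal.ofReal (‖f n θ‖ ^ p)) atTop ∂arcM := by
          refine lintegral_mono_ae ?_
          filter_upwards [hlim] with θ h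
          have h2 : Tendsto (fun n => ENNReal.ofReal (‖f n θ‖ ^ p)) atTop (𝓝 (ENNReal.ofReal (‖F θ‖ ^ p))) :=
            (ENNReal.continuous_ofReal.tendsto _).comp ((hcp.tendsto _).comp h)
          rw [h2.liminf_eq]
      _ ≤ liminf (fun n => ∫⁻ θ, ENNReal.ofReal (‖f n θ‖ ^ p) ∂arcM) atTop :=
          lintegral_liminf_le' fun n => (hfi n).1.aemeasurable.ennreal_ofReal
      _ ≤ liminf (fun _ : ℕ => ENNReal.ofReal C) atTop := by
          refine liminf_le_liminf (Eventually.of_forall fun n => ?_)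
          rw [← ofReal_integral_eq_lintegral_ofReal (hfi n) (Eventually.of_forall fun θ => by positivity)]
          exact ENNReal.ofReal_le_ofReal (hC n)
      _ = _ := by simp
  have hi : Integrable (fun θ => ‖F θ‖ ^ p) arcM := by
    refine ⟨hFpm, ?_⟩
    rw [hasFiniteIntegral_iff_ofReal (Eventually.of_forall fun θ => by positivity)]
    exact h1.trans_lt ENNReal.ofReal_lt_top
  refine ⟨hi, ?_⟩
  rw [← ofReal_integral_eq_lintegral_ofReal hi (Eventually.of_forall fun θ => by positivity)] at h1
  exact (ENNReal.ofReal_le_ofReal_iff hC0).mp h1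

/-- Boundary values for Hardy functions. -/
lemma T1 {f : ℂ → ℂ} {p : ℝ} (hp : 1 ≤ p) (hf : MemHp p f) :
    ∃ F : ℝ → ℂ, Integrable F arcM ∧ Integrable (fun θ => ‖F θ‖ ^ p) arcM ∧ Anl F ∧ BoundaryFn f F ∧
      (∀ z, ‖z‖ < 1 → cau F z = f z) ∧ ∫ θ, ‖F θ‖ ^ p ∂arcM ≤ sSup (hMean p f '' Set.Ioo 0 1) := by
  obtain ⟨hfa, hfb⟩ := hf
  have hle : ∀ n, hMean p f (rad n) ≤ sSup (hMean p f '' Set.Ioo 0 1) := fun n =>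
    le_csSup hfb ⟨rad n, rad_mem n, rfl⟩
  set S := sSup (hMean p f '' Set.Ioo 0 1) with hS
  choose A B hA hB hAA hBA hAB hAn hBn using fun n => factor_dil hfa (rad_mem n).1.le (rad_mem n).2
  have hb : ∀ n, 4 * (1 + hMean 1 f (rad n)) ≤ 4 * (1 + (1 + S)) := by
    intro n
    have := hMean_one_le hfa hp (rad_mem n).1.le (rad_mem n).2
    linarith [hle n]
  let u : Ultrafilter ℕ := Filter.hyperfilter ℕ
  have hu : (u : Filter ℕ) ≤ atTop := by
    rw [← Nat.cofinite_eq_atTop]; exact Filter.hyperfilter_le_cofinite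
  obtain ⟨A', hA', hAA', hAl⟩ := ultra_l2 u hA hAA (fun n => (hAn n).trans (hb n))
  obtain ⟨B', hB', hBA', hBl⟩ := ultra_l2 u hB hBA (fun n => (hBn n).trans (hb n))
  obtain ⟨a, ha⟩ := taylor_disc hfa
  set F : ℝ → ℂ := fun θ => A' θ * B' θ with hF
  have hFi : Integrable F arcM := l2_mul_int hA' hB'
  have hFA : Anl F := anl_mul hA' hB' hAA' hBA'
  have hFc : ∀ j : ℕ, cf F j = a j := by
    intro j
    have h1 : Tendsto (fun n => cf (fun θ => A n θ * B n θ) j) u (𝓝 (cf F j)) := by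
      simp_rw [hF, fun n => cf_mul_nat (hA n) (hB n) (hAA n) (hBA n) j, cf_mul_nat hA' hB' hAA' hBA' j]
      exact tendsto_finsetSum _ fun k _ => (hAl k).mul (hBl _)
    refine tendsto_nhds_unique h1 ?_
    have h2 : ∀ n, cf (fun θ => A n θ * B n θ) j = a j * (rad n : ℂ) ^ j := by
      intro n
      rw [← cf_congr (hAB n), cf_dil ha (rad_mem n).1.le (rad_mem n).2]; simp
    simp_rw [h2]
    have h1 : Tendsto (fun n => ((rad n : ℝ) : ℂ)) atTop (𝓝 1) := by
      have := (Complex.continuous_ofReal.tendsto 1).comp rad_tendsto'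
      simpa [Function.comp_def] using this
    have h3 := (h1.pow j).const_mul (a j)
    rw [one_pow, mul_one] at h3
    exact h3.mono_left hu
  have hcau : ∀ z, ‖z‖ < 1 → cau F z = f z := by
    intro z hz
    have := cau_hasSum hFi hz
    simp_rw [hFc] at this
    exact this.unique (ha z hz)
  have hbd : BoundaryFn f F := by
    filter_upwards [fatou_cau hFi hFA] with θ h
    refine h.congr' ?_
    have h2 : ∀ᶠ r : ℝ in 𝓝[<] 1, r ∈ Ioo (0:ℝ) 1 := Ioo_mem_nhdsLT (by norm_num)
    filter_upwards [h2] with r hr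
    exact hcau _ (by rw [norm_r_bpt hr.1.le]; exact hr.2)
  obtain ⟨h1, h2⟩ := fatou_lemma_int (p := p) (C := S) (by linarith) (f := fun n θ => f ((rad n : ℂ) * bpt θ)) (F := F)
    (fun n => (continuous_dil hfa (rad_mem n).1.le (rad_mem n).2).aestronglyMeasurable)
    (fun n => integrable_dil_rpow hfa (by linarith) (rad_mem n).1.le (rad_mem n).2)
    hle (by filter_upwards [hbd] with θ h; exact h.comp rad_tendsto)
  exact ⟨F, hFi, h1, hFA, hbd, hcau, h2⟩

/-- membership in L^p -/
def LP (p : ℝ) (F : ℝ → ℂ) : Prop :=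
  AEStronglyMeasurable F arcM ∧ Integrable (fun θ => ‖F θ‖ ^ p) arcM

lemma LP.int {p : ℝ} (hp : 1 ≤ p) {F : ℝ → ℂ} (h : LP p F) : Integrable F arcM := by
  refine Integrable.mono' (g := fun θ => 1 + ‖F θ‖ ^ p) ((integrable_const _).add h.2) h.1 ?_
  exact Eventually.of_forall fun θ => le_one_add_rpow (norm_nonneg _) hp

lemma LP.mono_ae {p : ℝ} (hp : 0 ≤ p) {F : ℝ → ℂ} {g : ℝ → ℝ} (hF : AEStronglyMeasurable F arcM)
    (hg : Integrable g arcM) (h : ∀ᵐ θ ∂arcM, ‖F θ‖ ^ p ≤ g θ) : LP p F := by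
  refine ⟨hF, Integrable.mono' hg ?_ ?_⟩
  · exact (Real.continuous_rpow_const hp).comp_aestronglyMeasurable hF.norm
  · filter_upwards [h] with θ h
    rwa [Real.norm_of_nonneg (by positivity)]

lemma LP.of_le {p : ℝ} (hp : 0 ≤ p) {F G : ℝ → ℂ} (hF : AEStronglyMeasurable F arcM) (hG : LP p G)
    {C : ℝ} (h : ∀ᵐ θ ∂arcM, ‖F θ‖ ≤ C * ‖G θ‖) : LP p F := by
  refine LP.mono_ae hp hF (g := fun θ => |C| ^ p * ‖G θ‖ ^ p) (hG.2.const_mul _) ?_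
  filter_upwards [h] with θ h
  rw [← Real.mul_rpow (abs_nonneg _) (norm_nonneg _)]
  refine Real.rpow_le_rpow (norm_nonneg _) (h.trans ?_) hp
  gcongr; exact le_abs_self C

lemma LP.bdd {p : ℝ} (hp : 0 ≤ p) {F : ℝ → ℂ} (hF : AEStronglyMeasurable F arcM) 
    {C : ℝ} (h : ∀ᵐ θ ∂arcM, ‖F θ‖ ≤ C) : LP p F := by
  refine LP.mono_ae hp hF (g := fun θ => C ^ p) (integrable_const _) ?_
  filter_upwards [h] with θ h
  exact Real.rpow_le_rpow (norm_nonneg _) h hp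

lemma LP.congr {p : ℝ} {F G : ℝ → ℂ} (hF : LP p F) (h : F =ᵐ[arcM] G) : LP p G := by
  refine ⟨hF.1.congr h, hF.2.congr ?_⟩
  filter_upwards [h] with θ h; rw [h]

lemma rpow_add_le {p : ℝ} (hp : 0 ≤ p) {a b c : ℝ} (ha : 0 ≤ a) (hb : 0 ≤ b) (hc : 0 ≤ c) (h : c ≤ a + b) :
    c ^ p ≤ 2 ^ p * (a ^ p + b ^ p) := by
  have h1 : c ≤ 2 * max a b := by
    have := le_max_left a b; have := le_max_right a b; linarith
  have hm : 0 ≤ max a b := le_max_of_le_left ha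
  calc c ^ p ≤ (2 * max a b) ^ p := Real.rpow_le_rpow hc h1 hp
    _ = 2 ^ p * (max a b) ^ p := Real.mul_rpow (by norm_num) hm
    _ ≤ 2 ^ p * (a ^ p + b ^ p) := by
      gcongr
      rcases max_cases a b with ⟨h, _⟩ | ⟨h, _⟩ <;> rw [h]
      · have := Real.rpow_nonneg hb p; linarith
      · have := Real.rpow_nonneg ha p; linarith

lemma LP.add {p : ℝ} (hp : 0 ≤ p) {F G : ℝ → ℂ} (hF : LP p F) (hG : LP p G) :
    LP p (fun θ => F θ + G θ) :=
  LP.mono_ae hp (hF.1.add hG.1) ((hF.2.add hG.2).const_mul (2 ^ p)) (Eventually.of_forall fun θ =>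
    rpow_add_le hp (norm_nonneg _) (norm_nonneg _) (norm_nonneg _) (norm_add_le _ _))

lemma LP.sub {p : ℝ} (hp : 0 ≤ p) {F G : ℝ → ℂ} (hF : LP p F) (hG : LP p G) :
    LP p (fun θ => F θ - G θ) :=
  LP.mono_ae hp (hF.1.sub hG.1) ((hF.2.add hG.2).const_mul (2 ^ p)) (Eventually.of_forall fun θ =>
    rpow_add_le hp (norm_nonneg _) (norm_nonneg _) (norm_nonneg _) (norm_sub_le _ _))

lemma lp_add_le {p : ℝ} (hp : 0 ≤ p) {F G H : ℝ → ℂ} (hF : LP p F) (hG : LP p G)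
    (h : ∀ᵐ θ ∂arcM, ‖H θ‖ ≤ ‖F θ‖ + ‖G θ‖) :
    ∫ θ, ‖H θ‖ ^ p ∂arcM ≤ 2 ^ p * (∫ θ, ‖F θ‖ ^ p ∂arcM + ∫ θ, ‖G θ‖ ^ p ∂arcM) := by
  rw [← integral_add hF.2 hG.2, ← integral_const_mul]
  refine integral_mono_of_nonneg (Eventually.of_forall fun θ => by positivity) ((hF.2.add hG.2).const_mul (2 ^ p)) ?_
  filter_upwards [h] with θ h
  exact rpow_add_le hp (norm_nonneg _) (norm_nonneg _) (norm_nonneg _) h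

lemma LP.smul {p : ℝ} (hp : 0 ≤ p) {F : ℝ → ℂ} (hF : LP p F) (c : ℂ) : LP p (fun θ => c * F θ) :=
  LP.of_le hp (hF.1.const_mul c) hF (C := ‖c‖) (Eventually.of_forall fun θ => (norm_mul_le _ _))

lemma LP.bdd_mul {p : ℝ} (hp : 0 ≤ p) {F h : ℝ → ℂ} (hF : LP p F) (hh : AEStronglyMeasurable h arcM)
    {C : ℝ} (hC : ∀ᵐ θ ∂arcM, ‖h θ‖ ≤ C) : LP p (fun θ => h θ * F θ) := by
  refine LP.of_le hp (hh.mul hF.1) hF (C := C) ?_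
  filter_upwards [hC] with θ hC
  rw [norm_mul]; gcongr

lemma LP.conj {p : ℝ} {F : ℝ → ℂ} (hF : LP p F) : LP p (fun θ => conj (F θ)) :=
  ⟨Complex.continuous_conj.comp_aestronglyMeasurable hF.1, by simpa using hF.2⟩

lemma LP.bpt_mul {p : ℝ} {F : ℝ → ℂ} (hF : LP p F) (n : ℤ) : LP p (fun θ => bpt θ ^ n * F θ) :=
  ⟨(continuous_bpt_zpow n).aestronglyMeasurable.mul hF.1, by simpa using hF.2⟩

lemma memLp2_iff {F : ℝ → ℂ} : MemLp F 2 arcM ↔ LP 2 F := by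
  constructor
  · intro h
    refine ⟨h.1, ?_⟩
    have := h.integrable_norm_rpow (by norm_num) (by norm_num)
    simpa using this
  · intro h
    rw [← integrable_norm_rpow_iff h.1 (by norm_num) (by norm_num)]
    simpa using h.2

lemma LP.mono_exp {p q : ℝ} (hp : 0 ≤ p) (hq : p ≤ q) {F : ℝ → ℂ} (hF : LP q F) : LP p F := by
  refine LP.mono_ae hp hF.1 (g := fun θ => 1 + ‖F θ‖ ^ q) ((integrable_const _).add hF.2) ?_
  refine Eventually.of_forall fun θ => ?_
  rcases le_total ‖F θ‖ 1 with h | h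
  · have := Real.rpow_le_one (norm_nonneg _) h hp
    have := Real.rpow_nonneg (norm_nonneg (F θ)) q
    linarith
  · have := Real.rpow_le_rpow_of_exponent_le h hq
    linarith

lemma LP.mem2 {p : ℝ} (hp : 2 ≤ p) {F : ℝ → ℂ} (hF : LP p F) : MemLp F 2 arcM :=
  memLp2_iff.2 (hF.mono_exp (by norm_num) hp)

lemma lp_dom {p : ℝ} (hp : 0 < p) {A : ℕ → ℝ → ℂ} {g : ℝ → ℝ} (hA : ∀ n, AEStronglyMeasurable (A n) arcM)
    (hg : Integrable (fun θ => g θ ^ p) arcM) (h : ∀ n, ∀ᵐ θ ∂arcM, ‖A n θ‖ ≤ g θ)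
    (h0 : ∀ᵐ θ ∂arcM, Tendsto (fun n => A n θ) atTop (𝓝 0)) :
    Tendsto (fun n => ∫ θ, ‖A n θ‖ ^ p ∂arcM) atTop (𝓝 0) := by
  have : (0:ℝ) = ∫ θ : ℝ, (0:ℝ) ∂arcM := by simp
  rw [this]
  refine tendsto_integral_of_dominated_convergence (fun θ => g θ ^ p) ?_ hg ?_ ?_
  · intro n
    exact (Real.continuous_rpow_const hp.le).comp_aestronglyMeasurable (hA n).norm
  · intro n
    filter_upwards [h n] with θ h
    rw [Real.norm_of_nonneg (by positivity)]
    exact Real.rpow_le_rpow (norm_nonneg _) h hp.le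
  · filter_upwards [h0] with θ h0
    have h1 := (Real.continuous_rpow_const hp.le).continuousAt.tendsto.comp (h0.norm)
    simpa [Function.comp_def, Real.zero_rpow hp.ne'] using h1

lemma ae_subseq {g : ℕ → ℝ → ℝ} (hg : ∀ n, Integrable (g n) arcM) (h0 : ∀ n θ, 0 ≤ g n θ)
    (h : Tendsto (fun n => ∫ θ, g n θ ∂arcM) atTop (𝓝 0)) :
    ∃ φ : ℕ → ℕ, StrictMono φ ∧ ∀ᵐ θ ∂arcM, Tendsto (fun n => g (φ n) θ) atTop (𝓝 0) := by
  have h1 : Tendsto (fun n => eLpNorm (g n - fun _ => 0) 1 arcM) atTop (𝓝 0) := by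
    have : ∀ n, eLpNorm (g n - fun _ => 0) 1 arcM = ENNReal.ofReal (∫ θ, g n θ ∂arcM) := by
      intro n
      have : (g n - fun _ => 0) = g n := by ext; simp
      rw [this, eLpNorm_one_eq_lintegral_enorm, ofReal_integral_eq_lintegral_ofReal (hg n) (Eventually.of_forall (h0 n))]
      refine lintegral_congr fun θ => ?_
      rw [← ofReal_norm, Real.norm_of_nonneg (h0 n θ)]
    simp_rw [this]
    simpa using ENNReal.tendsto_ofReal h
  have h2 := tendstoInMeasure_of_tendsto_eLpNorm (p := 1) (by norm_num) (fun n => (hg n).1) aestronglyMeasurable_const h1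
  exact h2.exists_seq_tendsto_ae

lemma anl_congr {F G : ℝ → ℂ} (hF : Anl F) (h : F =ᵐ[arcM] G) : Anl G := fun n hn => by
  rw [← cf_congr h]; exact hF n hn

lemma anl_add {F G : ℝ → ℂ} (hF : Integrable F arcM) (hG : Integrable G arcM) (hA : Anl F) (hB : Anl G) :
    Anl (fun θ => F θ + G θ) := fun n hn => by
  rw [cf_add hF hG, hA n hn, hB n hn, add_zero]

lemma anl_sub {F G : ℝ → ℂ} (hF : Integrable F arcM) (hG : Integrable G arcM) (hA : Anl F) (hB : Anl G) :
    Anl (fun θ => F θ - G θ) := fun n hn => by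
  rw [cf_sub hF hG, hA n hn, hB n hn, sub_zero]

lemma anl_smul {F : ℝ → ℂ} (hA : Anl F) (c : ℂ) : Anl (fun θ => c * F θ) := fun n hn => by
  rw [cf_smul, hA n hn, mul_zero]

lemma anl_const (c : ℂ) : Anl (fun _ => c) := fun n hn => by
  rw [cf_const, if_neg hn.ne]

/-- bounded analytic function approximated by dilates -/
lemma dil_bdd {h : ℝ → ℂ} (hh : Integrable h arcM) (hA : Anl h) {C : ℝ} (hC : ∀ᵐ θ ∂arcM, ‖h θ‖ ≤ C)
    {r : ℝ} (h0 : 0 ≤ r) (h1 : r < 1) (θ : ℝ) : ‖cau h ((r:ℂ) * bpt θ)‖ ≤ C := by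
  have hz : ‖(r:ℂ) * bpt θ‖ < 1 := by rw [norm_r_bpt h0]; exact h1
  rw [← pois_anl hh hA hz]
  exact norm_pois_le_bdd hh hC hz

lemma cau_ser {F : ℝ → ℂ} (hF : Integrable F arcM) : ∀ z : ℂ, ‖z‖ < 1 → HasSum (fun n : ℕ => cf F n * z ^ n) (cau F z) :=
  fun _ hz => cau_hasSum hF hz

lemma tendsto_dil {h : ℝ → ℂ} (hh : Integrable h arcM) (hA : Anl h) :
    ∀ᵐ θ ∂arcM, Tendsto (fun n => cau h ((rad n : ℂ) * bpt θ)) atTop (𝓝 (h θ)) := by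
  filter_upwards [fatou_cau hh hA] with θ hθ
  exact hθ.comp rad_tendsto

lemma dil_pair {h F : ℝ → ℂ} (hh : Integrable h arcM) (hF : Integrable F arcM) {r : ℝ} (h0 : 0 ≤ r) (h1 : r < 1) :
    HasSum (fun n : ℕ => cf h n * (r:ℂ) ^ n * cf F (-(n:ℤ))) (∫ θ, cau h ((r:ℂ) * bpt θ) * F θ ∂arcM) := by
  have := series_pair (summable_dil (cau_ser hh) h0 h1) hF
  simp_rw [dil_eq (cau_ser hh) h0 h1]
  exact this

lemma int_dil_tendsto {h F : ℝ → ℂ} (hh : Integrable h arcM) (hA : Anl h) {C : ℝ} (hC : ∀ᵐ θ ∂arcM, ‖h θ‖ ≤ C)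
    (hF : Integrable F arcM) :
    Tendsto (fun n => ∫ θ, cau h ((rad n : ℂ) * bpt θ) * F θ ∂arcM) atTop (𝓝 (∫ θ, h θ * F θ ∂arcM)) := by
  refine tendsto_integral_of_dominated_convergence (fun θ => C * ‖F θ‖) ?_ (hF.norm.const_mul C) ?_ ?_
  · intro n
    exact (continuous_dil (cau_analytic hh) (rad_mem n).1.le (rad_mem n).2).aestronglyMeasurable.mul hF.1
  · intro n
    refine Eventually.of_forall fun θ => ?_
    rw [norm_mul]
    gcongr
    exact dil_bdd hh hA hC (rad_mem n).1.le (rad_mem n).2 θ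
  · filter_upwards [tendsto_dil hh hA] with θ h
    exact h.mul_const _

lemma int_mul_anl_zero {h F : ℝ → ℂ} (hh : Integrable h arcM) (hA : Anl h) {C : ℝ} (hC : ∀ᵐ θ ∂arcM, ‖h θ‖ ≤ C)
    (hF : Integrable F arcM) (hF0 : ∀ n : ℤ, n ≤ 0 → cf F n = 0) : ∫ θ, h θ * F θ ∂arcM = 0 := by
  have h1 := int_dil_tendsto hh hA hC hF
  have h2 : ∀ n, ∫ θ, cau h ((rad n : ℂ) * bpt θ) * F θ ∂arcM = 0 := by
    intro n
    have := dil_pair hh hF (rad_mem n).1.le (rad_mem n).2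
    have e : ∀ n : ℕ, cf F (-(n:ℤ)) = 0 := fun n => hF0 _ (by omega)
    simp only [e, mul_zero] at this
    exact this.unique hasSum_zero
  simp_rw [h2] at h1
  exact (tendsto_nhds_unique h1 tendsto_const_nhds)

lemma anl_bdd_mul {h F : ℝ → ℂ} (hh : AEStronglyMeasurable h arcM) (hA : Anl h) {C : ℝ} (hC : ∀ᵐ θ ∂arcM, ‖h θ‖ ≤ C)
    (hF : Integrable F arcM) (hFA : Anl F) : Anl (fun θ => h θ * F θ) := by
  intro m hm
  have hh' : Integrable h arcM := (LP.bdd zero_le_one hh hC).int le_rfl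
  simp only [cf, mul_assoc]
  refine int_mul_anl_zero hh' hA hC (hF.mul_bpt _) ?_
  intro n hn
  have : (fun θ => F θ * bpt θ ^ (-m)) = fun θ => bpt θ ^ (-m) * F θ := by ext; ring
  rw [this, cf_shift]
  exact hFA _ (by omega)

lemma cf_bdd_mul_zero {h F : ℝ → ℂ} (hh : AEStronglyMeasurable h arcM) (hA : Anl h) {C : ℝ} (hC : ∀ᵐ θ ∂arcM, ‖h θ‖ ≤ C)
    (hF : Integrable F arcM) (hFA : Anl F) (hF0 : cf F 0 = 0) : cf (fun θ => h θ * F θ) 0 = 0 := by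
  have hh' : Integrable h arcM := (LP.bdd zero_le_one hh hC).int le_rfl
  rw [cf_zero_eq]
  refine int_mul_anl_zero hh' hA hC hF ?_
  intro n hn
  rcases hn.lt_or_eq with h | h
  · exact hFA n h
  · rw [h, hF0]

lemma riesz_ptwise {p : ℝ} (hp : 1 < p) (hp2 : p ≤ 2) : ∃ A B : ℝ, 0 ≤ A ∧ 0 ≤ B ∧
    ∀ w : ℂ, 0 < w.re → ‖w‖ ^ p ≤ A * w.re ^ p - B * (w ^ (p:ℂ)).re := by
  have hpi := Real.pi_pos
  set γ : ℝ := (Real.pi / (2 * p) + Real.pi / 2) / 2 with hγ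
  have hpp : p * (Real.pi / (2 * p)) = Real.pi / 2 := by field_simp
  have h1 : Real.pi / (2 * p) < Real.pi / 2 := by
    have : 0 < Real.pi / (2 * p) := by positivity
    nlinarith
  have hγ2 : γ < Real.pi / 2 := by linarith
  have hγ0 : 0 < γ := by positivity
  have hγ1 : Real.pi / 2 < p * γ := by
    have : p * (Real.pi / (2 * p)) < p * γ := by
      apply mul_lt_mul_of_pos_left _ (by linarith); linarith
    linarith
  have hγ3 : p * γ ≤ Real.pi := by nlinarith
  have hc1 : Real.cos (p * γ) < 0 := Real.cos_neg_of_pi_div_two_lt_of_lt hγ1 (by linarith)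
  have hc2 : 0 < Real.cos γ := Real.cos_pos_of_mem_Ioo ⟨by linarith, hγ2⟩
  set B := 1 / (-Real.cos (p * γ)) with hB
  have hB0 : 0 < B := by apply one_div_pos.2; linarith
  have hcp : 0 < Real.cos γ ^ p := Real.rpow_pos_of_pos hc2 p
  set A := (1 + B) / Real.cos γ ^ p with hA
  have hA0 : 0 < A := by positivity
  refine ⟨A, B, hA0.le, hB0.le, ?_⟩
  intro w hw
  have hw0 : w ≠ 0 := by rintro rfl; simp at hw
  have hn : 0 < ‖w‖ := norm_pos_iff.2 hw0
  set φ := Complex.arg w with hφ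
  have hφ1 : |φ| < Real.pi / 2 := Complex.abs_arg_lt_pi_div_two_iff.2 (Or.inl hw)
  have e1 : w.re = ‖w‖ * Real.cos φ := (Complex.norm_mul_cos_arg w).symm
  have e2 : (w ^ (p:ℂ)).re = ‖w‖ ^ p * Real.cos (p * φ) := by
    rw [Complex.cpow_def_of_ne_zero hw0, Complex.exp_re]
    have a1 : (Complex.log w * (p:ℂ)).re = Real.log ‖w‖ * p := by simp [Complex.log_re]
    have a2 : (Complex.log w * (p:ℂ)).im = p * φ := by simp [Complex.log_im, hφ]; ring
    rw [a1, a2, Real.rpow_def_of_pos hn]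
  have hcφ : 0 < Real.cos φ := Real.cos_pos_of_mem_Ioo ⟨by linarith [neg_abs_le φ], by linarith [le_abs_self φ]⟩
  rw [e1, e2, Real.mul_rpow hn.le hcφ.le]
  have key : 1 ≤ A * Real.cos φ ^ p - B * Real.cos (p * φ) := by
    have ec : Real.cos φ = Real.cos |φ| := (Real.cos_abs φ).symm
    have ecp : Real.cos (p * φ) = Real.cos (p * |φ|) := by
      rw [← Real.cos_abs (p * φ), abs_mul, abs_of_pos (by linarith : (0:ℝ) < p)]
    rcases le_total γ |φ| with h | h
    · have : Real.cos (p * |φ|) ≤ Real.cos (p * γ) := by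
        apply Real.cos_le_cos_of_nonneg_of_le_pi (by positivity) (by nlinarith)
        gcongr
      have h5 : B * Real.cos (p * φ) ≤ B * Real.cos (p * γ) := by rw [ecp]; gcongr
      have h6 : B * Real.cos (p * γ) = -1 := by rw [hB, div_mul_eq_mul_div, one_mul, div_neg, div_self hc1.ne]
      have h7 : 0 ≤ A * Real.cos φ ^ p := by positivity
      linarith
    · have : Real.cos γ ≤ Real.cos |φ| := by
        apply Real.cos_le_cos_of_nonneg_of_le_pi (abs_nonneg _) (by linarith) h
      have h5 : A * Real.cos γ ^ p ≤ A * Real.cos φ ^ p := by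
        rw [ec]; gcongr
      have h6 : A * Real.cos γ ^ p = 1 + B := by rw [hA]; field_simp
      have h7 : B * Real.cos (p * φ) ≤ B * 1 := by gcongr; exact Real.cos_le_one _
      linarith
  have h8 : 0 < ‖w‖ ^ p := Real.rpow_pos_of_pos hn p
  nlinarith

lemma mean_value {g : ℂ → ℂ} (hg : AnalyticOnDisc g) {r : ℝ} (h0 : 0 ≤ r) (h1 : r < 1) :
    ∫ θ, g ((r:ℂ) * bpt θ) ∂arcM = g 0 := by
  obtain ⟨a, ha⟩ := taylor_disc hg
  have h := cf_dil ha h0 h1 0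
  rw [cf_zero_eq] at h
  rw [h]
  have h2 := ha 0 (by simp)
  have h3 := hasSum_single (f := fun n => a n * (0:ℂ) ^ n) 0 (by intro n hn; simp [hn])
  have := h2.unique h3
  simpa using this.symm

lemma pk_zero (t : ℝ) : pk 0 t = 1 := by simp [pk]

lemma riesz_pos {p : ℝ} (hp : 1 < p) (hp2 : p ≤ 2) : ∃ C : ℝ, 0 ≤ C ∧ ∀ u : ℝ → ℝ, (∀ t, 0 ≤ u t) →
    Integrable u arcM → Integrable (fun t => u t ^ p) arcM → ∀ r : ℝ, 0 ≤ r → r < 1 →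
    hMean p (cau (fun t => (u t : ℂ))) r ≤ C * ∫ t, u t ^ p ∂arcM := by
  obtain ⟨A, B, hA, hB, hAB⟩ := riesz_ptwise hp hp2
  refine ⟨2 ^ p * (A + 1), by positivity, ?_⟩
  intro u hu0 hu hup r h0 h1
  have hp0 : 0 ≤ p := by linarith
  have huc : Integrable (fun t => (u t : ℂ)) arcM := hu.ofReal
  by_cases hz : ∫ t, u t ∂arcM = 0
  · have hz' : u =ᵐ[arcM] 0 := (integral_eq_zero_iff_of_nonneg hu0 hu).1 hz
    have e1 : ∀ z, cau (fun t => (u t : ℂ)) z = 0 := by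
      intro z
      rw [cau, integral_eq_zero_of_ae]
      filter_upwards [hz'] with t ht
      simp [ht]
    have e2 : 0 ≤ ∫ t, u t ^ p ∂arcM := integral_nonneg fun t => Real.rpow_nonneg (hu0 t) p
    have e3 : hMean p (cau (fun t => (u t : ℂ))) r = 0 := by
      simp [hMean, e1, Real.zero_rpow (by linarith : p ≠ 0)]
    rw [e3]; positivity
  · set c : ℝ := ∫ t, u t ∂arcM with hc
    have hc0 : cf (fun t => (u t : ℂ)) 0 = c := by rw [cf_zero_eq, integral_complex_ofReal]
    set f : ℂ → ℂ := fun z => 2 * cau (fun t => (u t : ℂ)) z - c with hf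
    have hfA : AnalyticOnDisc f := ((cau_analytic huc).const_mul 2).sub_const _
    have hre : ∀ z, ‖z‖ < 1 → (f z).re = ∫ t, u t * pk z t ∂arcM := by
      intro z hz
      have h1 := pois_eq huc hz
      have h2 := pois_re huc hz
      simp only [Complex.conj_ofReal, hc0, Complex.ofReal_re, Complex.ofReal_im, zero_mul, integral_zero] at h1 h2
      rw [h2] at h1
      have := congrArg Complex.re h1
      simp at this
      rw [this, hf]; simp; ring
    have hpos : ∀ z, ‖z‖ < 1 → 0 < (f z).re := by
      intro z hz'
      rw [hre z hz']
      have hnn : ∀ t, 0 ≤ u t * pk z t := fun t => mul_nonneg (hu0 t) (pk_nonneg hz' t)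
      refine lt_of_le_of_ne (integral_nonneg hnn) fun h => ?_
      have h2 := (integral_eq_zero_iff_of_nonneg hnn (rint_mul_pk hu hz')).1 h.symm
      apply hz
      rw [hc]
      apply integral_eq_zero_of_ae
      filter_upwards [h2] with t ht
      rcases mul_eq_zero.1 ht with h | h
      · exact h
      · exact absurd h (pk_pos hz' t).ne'
    have hgA : AnalyticOnDisc (fun z => f z ^ (p:ℂ)) := by
      refine DifferentiableOn.cpow hfA (differentiableOn_const _) ?_
      intro z hz
      exact Or.inl (hpos z (mem_uDisc.1 hz))
    have hmv := mean_value hgA h0 h1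
    have hf0 : f 0 = c := by
      simp only [hf]; rw [cau_zero, hc0]; ring
    have hcpos : 0 ≤ c := integral_nonneg hu0
    have hmv2 : 0 ≤ (∫ θ, f ((r:ℂ) * bpt θ) ^ (p:ℂ) ∂arcM).re := by
      rw [hmv, hf0, ← Complex.ofReal_cpow hcpos, Complex.ofReal_re]
      positivity
    have hi1 : Integrable (fun θ => f ((r:ℂ) * bpt θ) ^ (p:ℂ)) arcM :=
      memLp_one_iff_integrable.1 (memLp_dil hgA h0 h1 1)
    have hi1r : Integrable (fun θ => (f ((r:ℂ) * bpt θ) ^ (p:ℂ)).re) arcM := hi1.re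
    have hi2 := integrable_dil_rpow hfA hp0 h0 h1
    have hnb : ∀ θ, ‖(r:ℂ) * bpt θ‖ < 1 := fun θ => by rw [norm_r_bpt h0]; exact h1
    have hre2 : ∀ θ, (f ((r:ℂ) * bpt θ)).re = ‖pois (fun t => (u t : ℂ)) ((r:ℂ) * bpt θ)‖ := by
      intro θ
      rw [pois_re huc (hnb θ)]
      simp only [Complex.ofReal_re, Complex.ofReal_im, zero_mul, integral_zero, Complex.ofReal_zero, add_zero]
      rw [← hre _ (hnb θ), Complex.norm_of_nonneg (hpos _ (hnb θ)).le]
    have hi3 : Integrable (fun θ => (f ((r:ℂ) * bpt θ)).re ^ p) arcM := by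
      refine Integrable.mono' hi2 ?_ ?_
      · refine Continuous.aestronglyMeasurable ?_
        exact (Real.continuous_rpow_const hp0).comp (Complex.continuous_re.comp (continuous_dil hfA h0 h1))
      · refine Eventually.of_forall fun θ => ?_
        rw [Real.norm_of_nonneg (Real.rpow_nonneg (hpos _ (hnb θ)).le p)]
        exact Real.rpow_le_rpow (hpos _ (hnb θ)).le (Complex.re_le_norm _) hp0
    have hjen : ∫ θ, (f ((r:ℂ) * bpt θ)).re ^ p ∂arcM ≤ ∫ t, u t ^ p ∂arcM := by
      simp_rw [hre2]
      have := jensen (F := fun t => (u t : ℂ)) hp.le huc (by simpa [abs_of_nonneg (hu0 _)] using hup) h0 h1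
      simpa [abs_of_nonneg (hu0 _)] using this
    have hF : ∫ θ, ‖f ((r:ℂ) * bpt θ)‖ ^ p ∂arcM ≤ A * ∫ t, u t ^ p ∂arcM := by
      calc ∫ θ, ‖f ((r:ℂ) * bpt θ)‖ ^ p ∂arcM 
          ≤ ∫ θ, (A * (f ((r:ℂ) * bpt θ)).re ^ p - B * (f ((r:ℂ) * bpt θ) ^ (p:ℂ)).re) ∂arcM := by
            refine integral_mono hi2 ((hi3.const_mul A).sub (hi1r.const_mul B)) fun θ => ?_
            exact hAB _ (hpos _ (hnb θ))
        _ = A * ∫ θ, (f ((r:ℂ) * bpt θ)).re ^ p ∂arcM - B * ∫ θ, (f ((r:ℂ) * bpt θ) ^ (p:ℂ)).re ∂arcM := by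
            rw [integral_sub (hi3.const_mul A) (hi1r.const_mul B), integral_const_mul, integral_const_mul]
        _ ≤ A * ∫ θ, (f ((r:ℂ) * bpt θ)).re ^ p ∂arcM := by
            have : ∫ θ, (f ((r:ℂ) * bpt θ) ^ (p:ℂ)).re ∂arcM = (∫ θ, f ((r:ℂ) * bpt θ) ^ (p:ℂ) ∂arcM).re := integral_re hi1
            rw [this]
            nlinarith
        _ ≤ _ := by gcongr
    have hcp : c ^ p ≤ ∫ t, u t ^ p ∂arcM := by
      have := rpow_pois_le hu hu0 hp.le hup (z := 0) (by simp)
      simpa [pk_zero] using this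
    have hLP : LP p (fun θ => f ((r:ℂ) * bpt θ)) := ⟨(continuous_dil hfA h0 h1).aestronglyMeasurable, hi2⟩
    have hLc : LP p (fun _ : ℝ => (c:ℂ)) := ⟨aestronglyMeasurable_const, integrable_const _⟩
    have := lp_add_le (H := fun θ => cau (fun t => (u t : ℂ)) ((r:ℂ) * bpt θ)) hp0 hLP hLc (Eventually.of_forall fun θ => by
      have e : cau (fun t => (u t : ℂ)) ((r:ℂ) * bpt θ) = (f ((r:ℂ) * bpt θ) + c) / 2 := by simp only [hf]; ring
      have e2 := norm_add_le (f ((r:ℂ) * bpt θ)) c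
      have e3 := norm_nonneg (f ((r:ℂ) * bpt θ) + c)
      rw [e, norm_div, Complex.norm_ofNat]; linarith)
    have e4 : ∫ θ : ℝ, ‖(c:ℂ)‖ ^ p ∂arcM = c ^ p := by simp [abs_of_nonneg hcpos]
    rw [e4] at this
    calc hMean p (cau fun t => (u t : ℂ)) r ≤ _ := this
      _ ≤ 2 ^ p * (A * ∫ t, u t ^ p ∂arcM + ∫ t, u t ^ p ∂arcM) := by gcongr
      _ = _ := by ring

lemma cau_lin {F G : ℝ → ℂ} (hF : Integrable F arcM) (hG : Integrable G arcM) (a b : ℂ) {z : ℂ} (hz : ‖z‖ < 1) :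
    cau (fun t => a * F t + b * G t) z = a * cau F z + b * cau G z := by
  have h1 := (integrable_mul_ck hF hz).const_mul a
  have h2 := (integrable_mul_ck hG hz).const_mul b
  simp only [cau]
  rw [← integral_const_mul, ← integral_const_mul, ← integral_add h1 h2]
  congr 1; ext t; ring

/-- M. Riesz bound -/
def RB (p : ℝ) : Prop := ∃ C : ℝ, 0 ≤ C ∧ ∀ D : ℝ → ℂ, LP p D → ∀ r : ℝ, 0 ≤ r → r < 1 →
    hMean p (cau D) r ≤ C * ∫ t, ‖D t‖ ^ p ∂arcM

lemma riesz_low {p : ℝ} (hp : 1 < p) (hp2 : p ≤ 2) : RB p := by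
  obtain ⟨C, hC, hCu⟩ := riesz_pos hp hp2
  have hp0 : 0 ≤ p := by linarith
  have hreal : ∀ u : ℝ → ℝ, ∀ N, LP p (fun t => (u t : ℂ)) → ∫ t, ‖(u t : ℂ)‖ ^ p ∂arcM ≤ N → ∀ r : ℝ, 0 ≤ r → r < 1 →
      hMean p (cau (fun t => (u t : ℂ))) r ≤ 2 ^ p * (2 * C) * N := by
    intro u N hu hN r h0 h1
    have key : ∀ v : ℝ → ℝ, (∀ t, 0 ≤ v t) → AEStronglyMeasurable v arcM → (∀ t, v t ≤ ‖(u t:ℂ)‖) → 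
        Integrable (fun t => (v t : ℂ)) arcM ∧ hMean p (cau (fun t => (v t : ℂ))) r ≤ C * N := by
      intro v hv hvm hvu
      have hL : LP p (fun t => (v t : ℂ)) := by
        refine LP.of_le (C := 1) hp0 (Complex.continuous_ofReal.comp_aestronglyMeasurable hvm) hu ?_
        exact Eventually.of_forall fun t => by rw [Complex.norm_of_nonneg (hv t), one_mul]; exact hvu t
      have hL2 : Integrable (fun t => v t ^ p) arcM := by simpa [abs_of_nonneg (hv _)] using hL.2
      have hLi : Integrable v arcM := by simpa using (hL.int hp.le).re
      refine ⟨hL.int hp.le, (hCu v hv hLi hL2 r h0 h1).trans ?_⟩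
      gcongr
      refine le_trans ?_ hN
      exact integral_mono hL2 hu.2 fun t => Real.rpow_le_rpow (hv t) (hvu t) hp0
    have hum : AEStronglyMeasurable u arcM := by simpa using (hu.int hp.le).re.1
    obtain ⟨a1, a2⟩ := key (fun t => max (u t) 0) (fun t => le_max_right _ _) (hum.sup aestronglyMeasurable_const)
      (fun t => by simpa using le_abs_self (u t))
    obtain ⟨b1, b2⟩ := key (fun t => max (-u t) 0) (fun t => le_max_right _ _) (hum.neg.sup aestronglyMeasurable_const)
      (fun t => by simpa using neg_le_abs (u t))
    have hnb : ∀ θ, ‖(r:ℂ) * bpt θ‖ < 1 := fun θ => by rw [norm_r_bpt h0]; exact h1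
    have hLP : ∀ F, Integrable F arcM → LP p (fun θ => cau F ((r:ℂ) * bpt θ)) := fun F hF =>
      ⟨(continuous_dil (cau_analytic hF) h0 h1).aestronglyMeasurable, integrable_dil_rpow (cau_analytic hF) hp0 h0 h1⟩
    have := lp_add_le (H := fun θ => cau (fun t => (u t : ℂ)) ((r:ℂ) * bpt θ)) hp0 (hLP _ a1) (hLP _ b1)
      (Eventually.of_forall fun θ => by
        have e := cau_lin a1 b1 1 (-1) (hnb θ)
        have e2 : (fun t => (u t : ℂ)) = fun t => 1 * ((max (u t) 0 : ℝ):ℂ) + (-1) * ((max (-u t) 0 : ℝ):ℂ) := by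
          ext t
          rcases le_total (u t) 0 with h | h
          · simp [max_eq_right h, max_eq_left (neg_nonneg.2 h)]
          · simp [max_eq_left h, max_eq_right (neg_nonpos.2 h)]
        rw [e2, e]
        refine (norm_add_le _ _).trans ?_
        simp)
    calc _ ≤ _ := this
      _ ≤ 2 ^ p * (C * N + C * N) := by
        apply mul_le_mul_of_nonneg_left _ (by positivity)
        exact add_le_add a2 b2
      _ = _ := by ring
  refine ⟨2 ^ p * (2 * (2 ^ p * (2 * C))), by positivity, ?_⟩
  intro D hD r h0 h1
  have hnb : ∀ θ, ‖(r:ℂ) * bpt θ‖ < 1 := fun θ => by rw [norm_r_bpt h0]; exact h1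
  have hLP : ∀ F, Integrable F arcM → LP p (fun θ => cau F ((r:ℂ) * bpt θ)) := fun F hF =>
      ⟨(continuous_dil (cau_analytic hF) h0 h1).aestronglyMeasurable, integrable_dil_rpow (cau_analytic hF) hp0 h0 h1⟩
  have hDi := hD.int hp.le
  have key : ∀ v : ℝ → ℝ, AEStronglyMeasurable v arcM → (∀ t, |v t| ≤ ‖D t‖) → 
      Integrable (fun t => (v t : ℂ)) arcM ∧ hMean p (cau (fun t => (v t : ℂ))) r ≤ 2 ^ p * (2 * C) * ∫ t, ‖D t‖ ^ p ∂arcM := by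
    intro v hv hvu
    have hL : LP p (fun t => (v t : ℂ)) := by
      refine LP.of_le (C := 1) hp0 (Complex.continuous_ofReal.comp_aestronglyMeasurable hv) hD ?_
      exact Eventually.of_forall fun t => by simpa using hvu t
    refine ⟨hL.int hp.le, hreal v _ hL ?_ r h0 h1⟩
    refine integral_mono hL.2 hD.2 fun t => Real.rpow_le_rpow (norm_nonneg _) ?_ hp0
    simpa using hvu t
  obtain ⟨a1, a2⟩ := key (fun t => (D t).re) (Complex.continuous_re.comp_aestronglyMeasurable hD.1) (fun t => Complex.abs_re_le_norm _)
  obtain ⟨b1, b2⟩ := key (fun t => (D t).im) (Complex.continuous_im.comp_aestronglyMeasurable hD.1) (fun t => Complex.abs_im_le_norm _)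
  have := lp_add_le (H := fun θ => cau D ((r:ℂ) * bpt θ)) hp0 (hLP _ a1) (hLP _ b1)
    (Eventually.of_forall fun θ => by
      have e := cau_lin a1 b1 1 I (hnb θ)
      have e2 : D = fun t => 1 * ((D t).re:ℂ) + I * ((D t).im:ℂ) := by
        ext t
        rw [one_mul, mul_comm]; exact (Complex.re_add_im _).symm
      rw [← e2] at e
      rw [e]
      refine (norm_add_le _ _).trans ?_
      simp)
  calc _ ≤ _ := this
    _ ≤ 2 ^ p * (2 ^ p * (2 * C) * ∫ t, ‖D t‖ ^ p ∂arcM + 2 ^ p * (2 * C) * ∫ t, ‖D t‖ ^ p ∂arcM) := by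
      apply mul_le_mul_of_nonneg_left _ (by positivity)
      exact add_le_add a2 b2
    _ = _ := by ring

lemma cf_eq_of_cau {F G : ℝ → ℂ} (hF : Integrable F arcM) (hG : Integrable G arcM)
    (h : ∀ z, ‖z‖ < 1 → cau F z = cau G z) (n : ℤ) (hn : 0 ≤ n) : cf F n = cf G n := by
  have h1 := cf_dil (cau_ser hF) (r := 1/2) (by norm_num) (by norm_num) n
  have h2 := cf_dil (cau_ser hG) (r := 1/2) (by norm_num) (by norm_num) n
  have e : ∀ θ, cau F (((1/2:ℝ):ℂ) * bpt θ) = cau G (((1/2:ℝ):ℂ) * bpt θ) := fun θ => h _ (by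
    rw [norm_r_bpt (by norm_num)]; norm_num)
  simp_rw [e] at h1
  rw [h1, if_pos hn, if_pos hn, Int.toNat_of_nonneg hn] at h2
  exact mul_right_cancel₀ (pow_ne_zero _ (by norm_num)) h2

lemma RB.proj {p : ℝ} (hp : 1 ≤ p) (h : RB p) : ∃ C : ℝ, 0 ≤ C ∧ ∀ D : ℝ → ℂ, LP p D →
    ∃ E, LP p E ∧ Anl E ∧ (∀ n : ℤ, 0 ≤ n → cf E n = cf D n) ∧ ∫ t, ‖E t‖ ^ p ∂arcM ≤ C * ∫ t, ‖D t‖ ^ p ∂arcM := by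
  obtain ⟨C, hC, hCD⟩ := h
  refine ⟨C, hC, ?_⟩
  intro D hD
  have hDi := hD.int hp
  have hb : ∀ x ∈ hMean p (cau D) '' Ioo 0 1, x ≤ C * ∫ t, ‖D t‖ ^ p ∂arcM := by
    rintro _ ⟨r, hr, rfl⟩
    exact hCD D hD r hr.1.le hr.2
  have hH : MemHp p (cau D) := ⟨cau_analytic hDi, ⟨_, hb⟩⟩
  obtain ⟨E, h1, h2, h3, h4, h5, h6⟩ := T1 hp hH
  refine ⟨E, ⟨h1.1, h2⟩, h3, cf_eq_of_cau h1 hDi h5, h6.trans ?_⟩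
  refine csSup_le ?_ hb
  exact ⟨_, ⟨1/2, by norm_num, rfl⟩⟩

lemma cf_pois_dil {D : ℝ → ℂ} (hD : Integrable D arcM) {r : ℝ} (h0 : 0 ≤ r) (h1 : r < 1) (n : ℤ) (hn : 0 ≤ n) :
    cf (fun θ => pois D ((r:ℂ) * bpt θ)) n = cf (fun θ => cau D ((r:ℂ) * bpt θ)) n := by
  have hnb : ∀ θ, ‖(r:ℂ) * bpt θ‖ < 1 := fun θ => by rw [norm_r_bpt h0]; exact h1
  simp_rw [pois_eq hD (hnb _)]
  have i1 : Integrable (fun θ => cau D ((r:ℂ) * bpt θ)) arcM :=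
      memLp_one_iff_integrable.1 (memLp_dil (cau_analytic hD) h0 h1 1)
  have i2 : Integrable (fun θ => cau (fun t => conj (D t)) ((r:ℂ) * bpt θ)) arcM :=
      memLp_one_iff_integrable.1 (memLp_dil (cau_analytic hD.conj') h0 h1 1)
  have i3 : Integrable (fun θ => cau D ((r:ℂ) * bpt θ) + conj (cau (fun t => conj (D t)) ((r:ℂ) * bpt θ))) arcM := i1.add i2.conj'
  rw [cf_sub i3 (integrable_const _), cf_add i1 i2.conj', cf_conj, cf_const,
    cf_dil (cau_ser hD.conj') h0 h1]
  rcases hn.lt_or_eq with h | h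
  · rw [if_neg (by omega), if_neg (by omega)]; simp
  · subst h
    simp [cf_conj]

lemma riesz_high {p : ℝ} (hp : 2 < p) : RB p := by
  have hpq : p.HolderConjugate (p / (p - 1)) := Real.HolderConjugate.conjExponent (by linarith)
  set q := p / (p - 1) with hq
  have hq1 : 1 < q := hpq.symm.lt
  have hp0 : 0 < p := by linarith
  have hq2 : q ≤ 2 := by rw [hq, div_le_iff₀ (by linarith)]; linarith
  obtain ⟨C, hC, hP⟩ := (riesz_low hq1 hq2).proj hq1.le
  refine ⟨C ^ (p - 1), by positivity, ?_⟩
  intro D hD r h0 h1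
  have hDi := hD.int (by linarith)
  set E : ℝ → ℂ := fun θ => cau D ((r:ℂ) * bpt θ) with hE
  set Dr : ℝ → ℂ := fun θ => pois D ((r:ℂ) * bpt θ) with hDr
  have hEc : Continuous E := continuous_dil (cau_analytic hDi) h0 h1
  have hE2 : MemLp E 2 arcM := memLp_dil (cau_analytic hDi) h0 h1 2
  have hEA : Anl E := fun n hn => by
    rw [hE, cf_dil (cau_ser hDi) h0 h1, if_neg (by omega)]
  obtain ⟨K, hK⟩ := bdd_dil (cau_analytic hDi) h0 h1
  have hDrc : Continuous Dr := continuous_cau_r hDi h0 h1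
  have hDrp : LP p Dr ∧ ∫ θ, ‖Dr θ‖ ^ p ∂arcM ≤ ∫ θ, ‖D θ‖ ^ p ∂arcM := by
    refine ⟨?_, jensen (by linarith) hDi hD.2 h0 h1⟩
    have hnb : ∀ θ, ‖(r:ℂ) * bpt θ‖ < 1 := fun θ => by rw [norm_r_bpt h0]; exact h1
    refine LP.bdd (C := ∫ t, ‖D t‖ * ((1 - r ^ 2) / (1 - r) ^ 2) ∂arcM) hp0.le hDrc.aestronglyMeasurable ?_
    refine Eventually.of_forall fun θ => (norm_pois_le (hnb θ)).trans ?_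
    refine integral_mono (rint_mul_pk hDi.norm (hnb θ)) (hDi.norm.mul_const _) fun t => ?_
    simp only
    gcongr
    exact (le_abs_self _).trans (pk2_bdd h0 h1 θ t)
  have hDr2 : MemLp Dr 2 arcM := hDrp.1.mem2 hp.le
  set ψ : ℝ → ℂ := fun θ => E θ * ((‖E θ‖ ^ (p - 2) : ℝ) : ℂ) with hψ
  have hψc : Continuous ψ := hEc.mul (Complex.continuous_ofReal.comp
    ((Real.continuous_rpow_const (by linarith)).comp hEc.norm))
  have hψn : ∀ θ, ‖ψ θ‖ = ‖E θ‖ ^ (p - 1) := by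
    intro θ
    rw [hψ, norm_mul, Complex.norm_of_nonneg (by positivity)]
    rcases (norm_nonneg (E θ)).eq_or_lt with h | h
    · rw [← h, Real.zero_rpow (by linarith), Real.zero_rpow (by linarith), zero_mul]
    · rw [show p - 1 = 1 + (p - 2) by ring, Real.rpow_add h, Real.rpow_one]
  have hψq : ∀ θ, ‖ψ θ‖ ^ q = ‖E θ‖ ^ p := by
    intro θ
    rw [hψn, ← Real.rpow_mul (norm_nonneg _), hq]
    congr 1; field_simp [show p - 1 ≠ 0 by linarith]
  have hEp : LP p E := LP.bdd hp0.le hEc.aestronglyMeasurable (Eventually.of_forall hK)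
  have hψLq : LP q ψ := ⟨hψc.aestronglyMeasurable, by simp_rw [hψq]; exact hEp.2⟩
  have hψ2 : MemLp ψ 2 arcM := by
    refine memLp2_iff.2 (LP.bdd (C := K ^ (p - 1)) (by norm_num) hψc.aestronglyMeasurable (Eventually.of_forall fun θ => ?_))
    rw [hψn]
    exact Real.rpow_le_rpow (norm_nonneg _) (hK θ) (by linarith)
  obtain ⟨G, hG, hGA, hGc, hGn⟩ := hP ψ hψLq
  obtain ⟨G2, hG2, hG2A, hG2c⟩ := l2_proj hψ2
  have hGG : G =ᵐ[arcM] G2 := by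
    refine ae_eq_of_cf (hG.int hq1.le) hG2.int2 fun n => ?_
    rcases lt_or_ge n 0 with h | h
    · rw [hGA n h, hG2A n h]
    · rw [hGc n h, hG2c n h]
  set X := ∫ θ, ‖E θ‖ ^ p ∂arcM with hX
  set N := ∫ θ, ‖D θ‖ ^ p ∂arcM with hN
  have hX0 : 0 ≤ X := integral_nonneg fun θ => by positivity
  have hN0 : 0 ≤ N := integral_nonneg fun θ => by positivity
  have e1 : ∫ θ, ψ θ * conj (E θ) ∂arcM = (X : ℂ) := by
    rw [hX, ← integral_complex_ofReal]
    congr 1; ext θ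
    have : ψ θ * conj (E θ) = (E θ * conj (E θ)) * ((‖E θ‖ ^ (p - 2) : ℝ) : ℂ) := by simp only [hψ]; ring
    rw [this, Complex.mul_conj, Complex.normSq_eq_norm_sq, ← Complex.ofReal_mul]
    congr 1
    rcases (norm_nonneg (E θ)).eq_or_lt with h | h
    · rw [← h, Real.zero_rpow (by linarith), Real.zero_rpow (by linarith)]; simp
    · rw [← Real.rpow_natCast, ← Real.rpow_add h]; norm_num
  have e2 := l2_inner_anl hψ2 hG2 hE2 hEA (fun n hn => (hG2c n hn).symm)
  have e3 := l2_inner_anl hDr2 hE2 hG2 hG2A (fun n hn => cf_pois_dil hDi h0 h1 n hn)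
  have e4 : (X:ℂ) = conj (∫ θ, Dr θ * conj (G θ) ∂arcM) := by
    have : ∫ θ, Dr θ * conj (G θ) ∂arcM = ∫ θ, Dr θ * conj (G2 θ) ∂arcM := by
      refine integral_congr_ae ?_
      filter_upwards [hGG] with θ h; rw [h]
    rw [this, e3, ← integral_conj, ← e1, e2]
    congr 1; ext θ; simp [mul_comm]
  have e5 : X ≤ ∫ θ, ‖Dr θ‖ * ‖G θ‖ ∂arcM := by
    have : ‖(X:ℂ)‖ = X := Complex.norm_of_nonneg hX0
    rw [← this, e4, RCLike.norm_conj]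
    refine (norm_integral_le_integral_norm _).trans (le_of_eq ?_)
    simp
  have hm : ∀ s : ℝ, 0 < s → ∀ F, LP s F → MemLp (fun θ => ‖F θ‖) (ENNReal.ofReal s) arcM := by
    intro s hs F hF
    refine MemLp.norm ?_
    rw [← integrable_norm_rpow_iff hF.1 (by simpa using hs) ENNReal.ofReal_ne_top, ENNReal.toReal_ofReal hs.le]
    exact hF.2
  have e6 := integral_mul_le_Lp_mul_Lq_of_nonneg hpq (μ := arcM) (f := fun θ => ‖Dr θ‖) (g := fun θ => ‖G θ‖)
    (Eventually.of_forall fun θ => norm_nonneg _) (Eventually.of_forall fun θ => norm_nonneg _)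
    (hm p hp0 _ hDrp.1) (hm q (by linarith) _ hG)
  simp_rw [hψq] at hGn
  have hq0 : 0 < q := by linarith
  have e7 : X ≤ N ^ (1/p) * (C * X) ^ (1/q) := by
    refine e5.trans (e6.trans ?_)
    have a1 : 0 ≤ ∫ θ, ‖Dr θ‖ ^ p ∂arcM := integral_nonneg fun θ => by positivity
    have a2 : 0 ≤ ∫ θ, ‖G θ‖ ^ q ∂arcM := integral_nonneg fun θ => by positivity
    gcongr
    exact hDrp.2
  show X ≤ C ^ (p - 1) * N
  rcases hX0.eq_or_lt with h | h
  · rw [← h]; positivity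
  rw [Real.mul_rpow hC hX0] at e7
  have hsum : 1/p + 1/q = 1 := by simpa using hpq.inv_add_inv_eq_one
  have e8 : X = X ^ (1/p) * X ^ (1/q) := by rw [← Real.rpow_add h, hsum, Real.rpow_one]
  have hXq : 0 < X ^ (1/q) := Real.rpow_pos_of_pos h _
  have e9 : X ^ (1/p) ≤ N ^ (1/p) * C ^ (1/q) := by
    refine le_of_mul_le_mul_right ?_ hXq
    rw [← e8]; linarith
  have e10 := Real.rpow_le_rpow (by positivity) e9 hp0.le
  rw [Real.mul_rpow (by positivity) (by positivity), ← Real.rpow_mul hX0, ← Real.rpow_mul hN0, ← Real.rpow_mul hC] at e10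
  have a3 : 1 / p * p = 1 := by field_simp
  have a4 : 1 / q * p = p - 1 := by rw [hq]; field_simp
  rw [a3, a4, Real.rpow_one, Real.rpow_one] at e10
  linarith

lemma riesz {p : ℝ} (hp : 1 < p) : ∃ C : ℝ, 0 ≤ C ∧ ∀ D : ℝ → ℂ, LP p D →
    ∃ E, LP p E ∧ Anl E ∧ (∀ n : ℤ, 0 ≤ n → cf E n = cf D n) ∧ ∫ t, ‖E t‖ ^ p ∂arcM ≤ C * ∫ t, ‖D t‖ ^ p ∂arcM := by
  rcases le_or_gt p 2 with h | h
  · exact (riesz_low hp h).proj hp.le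
  · exact (riesz_high h).proj hp.le

lemma lp2_inner (f g : Lp ℂ 2 arcM) : inner ℂ f g = ∫ θ, g θ * conj (f θ) ∂arcM := by
  rw [L2.inner_def]
  rfl

lemma lp2_norm (f : Lp ℂ 2 arcM) : ‖f‖ ^ 2 = ∫ θ, ‖f θ‖ ^ 2 ∂arcM := by
  have h := lp2_inner f f
  rw [inner_self_eq_norm_sq_to_K] at h
  have h2 : ∫ θ, f θ * conj (f θ) ∂arcM = ((∫ θ, ‖f θ‖ ^ 2 ∂arcM : ℝ) : ℂ) := by
    rw [← integral_complex_ofReal]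
    congr 1; ext θ
    rw [Complex.mul_conj, Complex.normSq_eq_norm_sq]
  rw [h2] at h
  apply Complex.ofReal_injective
  rw [← h]; simp

lemma l2_decomp {S : Set (ℝ → ℂ)} (h0 : (fun _ => 0) ∈ S) (hadd : ∀ F ∈ S, ∀ G ∈ S, (fun θ => F θ + G θ) ∈ S)
    (hsmul : ∀ c : ℂ, ∀ F ∈ S, (fun θ => c * F θ) ∈ S) (hae : ∀ F ∈ S, ∀ G, F =ᵐ[arcM] G → G ∈ S)
    (hS : ∀ F ∈ S, MemLp F 2 arcM) {F : ℝ → ℂ} (hF : MemLp F 2 arcM) :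
    ∃ F1 F2, MemLp F1 2 arcM ∧ MemLp F2 2 arcM ∧ (∀ᵐ θ ∂arcM, F θ = F1 θ + F2 θ) ∧
      (∀ ε > (0:ℝ), ∃ G ∈ S, ∫ θ, ‖F1 θ - G θ‖ ^ 2 ∂arcM < ε) ∧ ∀ G ∈ S, ∫ θ, F2 θ * conj (G θ) ∂arcM = 0 := by
  let W : Submodule ℂ (Lp ℂ 2 arcM) :=
    { carrier := {x | (x : ℝ → ℂ) ∈ S}
      zero_mem' := hae _ h0 _ (Lp.coeFn_zero ℂ 2 arcM).symm
      add_mem' := fun {x y} hx hy => hae _ (hadd _ hx _ hy) _ (Lp.coeFn_add x y).symm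
      smul_mem' := fun c x hx => hae _ (hsmul c _ hx) _ (Lp.coeFn_smul c x).symm }
  let x := hF.toLp F
  let V := W.topologicalClosure
  have : CompleteSpace V := W.isClosed_topologicalClosure.completeSpace_coe
  obtain ⟨y, hy, z, hz, hxyz⟩ := V.exists_add_mem_mem_orthogonal x
  refine ⟨y, z, Lp.memLp y, Lp.memLp z, ?_, ?_, ?_⟩
  · filter_upwards [hF.coeFn_toLp, Lp.coeFn_add y z] with θ h1 h2
    rw [← h1]
    change x θ = _
    rw [hxyz, h2]; rfl
  · intro ε hε
    have hy' : y ∈ closure (W : Set (Lp ℂ 2 arcM)) := hy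
    obtain ⟨w, hw, hd⟩ := Metric.mem_closure_iff.1 hy' (Real.sqrt ε) (Real.sqrt_pos.2 hε)
    refine ⟨w, hw, ?_⟩
    rw [dist_eq_norm] at hd
    have h1 := lp2_norm (y - w)
    have h2 : ∫ θ, ‖(y - w : Lp ℂ 2 arcM) θ‖ ^ 2 ∂arcM = ∫ θ, ‖y θ - w θ‖ ^ 2 ∂arcM := by
      refine integral_congr_ae ?_
      filter_upwards [Lp.coeFn_sub y w] with θ h
      rw [h]; rfl
    rw [← h2, ← h1]
    have := Real.lt_sqrt (norm_nonneg (y - w)) |>.1 hd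
    exact this
  · intro G hG
    have hG' : (hS G hG).toLp G ∈ W := hae _ hG _ (hS G hG).coeFn_toLp.symm
    have := (Submodule.mem_orthogonal V z).1 hz _ (W.le_topologicalClosure hG')
    rw [lp2_inner] at this
    rw [← this]
    refine integral_congr_ae ?_
    filter_upwards [(hS G hG).coeFn_toLp] with θ h
    rw [h]

lemma l2_self_zero {F : ℝ → ℂ} (hF : MemLp F 2 arcM) (h : ∫ θ, F θ * conj (F θ) ∂arcM = 0) : F =ᵐ[arcM] 0 := by
  have h2 : ∫ θ, F θ * conj (F θ) ∂arcM = ((∫ θ, ‖F θ‖ ^ 2 ∂arcM : ℝ) : ℂ) := by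
    rw [← integral_complex_ofReal]
    congr 1; ext θ
    rw [Complex.mul_conj, Complex.normSq_eq_norm_sq]
  rw [h2] at h
  have h3 : ∫ θ, ‖F θ‖ ^ 2 ∂arcM = 0 := by exact_mod_cast h
  have h4 : Integrable (fun θ => ‖F θ‖ ^ 2) arcM := by simpa using (memLp2_iff.1 hF).2
  rw [integral_eq_zero_iff_of_nonneg (fun θ => by positivity) h4] at h3
  filter_upwards [h3] with θ h
  simpa using h

/-- Cauchy--Schwarz -/
lemma l2_cs {F G : ℝ → ℂ} (hF : MemLp F 2 arcM) (hG : MemLp G 2 arcM) :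
    ‖∫ θ, F θ * conj (G θ) ∂arcM‖ ^ 2 ≤ (∫ θ, ‖F θ‖ ^ 2 ∂arcM) * ∫ θ, ‖G θ‖ ^ 2 ∂arcM := by
  have h1 : inner ℂ (hG.toLp G) (hF.toLp F) = ∫ θ, F θ * conj (G θ) ∂arcM := by
    rw [lp2_inner]
    refine integral_congr_ae ?_
    filter_upwards [hF.coeFn_toLp, hG.coeFn_toLp] with θ a b
    rw [a, b]
  have e : ∀ F : ℝ → ℂ, ∀ hF : MemLp F 2 arcM, ‖hF.toLp F‖ ^ 2 = ∫ θ, ‖F θ‖ ^ 2 ∂arcM := by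
    intro F hF
    rw [lp2_norm]
    refine integral_congr_ae ?_
    filter_upwards [hF.coeFn_toLp] with θ a
    rw [a]
  have h2 := norm_inner_le_norm (𝕜 := ℂ) (hG.toLp G) (hF.toLp F)
  rw [← h1, ← e F hF, ← e G hG, ← mul_pow, mul_comm ‖hF.toLp F‖]
  exact pow_le_pow_left₀ (norm_nonneg _) h2 2

/-- orthogonality passes to L2 limits -/
lemma l2_perp_closure {S : Set (ℝ → ℂ)} (hS : ∀ F ∈ S, MemLp F 2 arcM) {F K : ℝ → ℂ} (hF : MemLp F 2 arcM) (hK : MemLp K 2 arcM)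
    (hc : ∀ ε > (0:ℝ), ∃ G ∈ S, ∫ θ, ‖F θ - G θ‖ ^ 2 ∂arcM < ε) (h : ∀ G ∈ S, ∫ θ, G θ * conj (K θ) ∂arcM = 0) :
    ∫ θ, F θ * conj (K θ) ∂arcM = 0 := by
  by_contra hne
  have hpos : 0 < ‖∫ θ, F θ * conj (K θ) ∂arcM‖ ^ 2 := by positivity
  set B := ∫ θ, ‖K θ‖ ^ 2 ∂arcM with hB
  have hB0 : 0 ≤ B := integral_nonneg fun θ => by positivity
  obtain ⟨G, hG, hd⟩ := hc (‖∫ θ, F θ * conj (K θ) ∂arcM‖ ^ 2 / (B + 1)) (by positivity)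
  have h1 := l2_cs (hF.sub (hS G hG)) hK
  have h2 : ∫ θ, (F - G) θ * conj (K θ) ∂arcM = ∫ θ, F θ * conj (K θ) ∂arcM := by
    have e : (fun θ => (F - G) θ * conj (K θ)) = fun θ => F θ * conj (K θ) - G θ * conj (K θ) := by
      ext θ; simp [sub_mul]
    rw [e, integral_sub (l2_mul_int hF hK.conj') (l2_mul_int (hS G hG) hK.conj'), h G hG, sub_zero]
  rw [h2] at h1
  rw [lt_div_iff₀ (by linarith)] at hd
  have h3 : 0 ≤ ∫ θ, ‖F θ - G θ‖ ^ 2 ∂arcM := integral_nonneg fun θ => by positivity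
  simp only [Pi.sub_apply] at h1
  nlinarith

lemma l2_conj_zero {F G : ℝ → ℂ} (h : ∫ θ, F θ * conj (G θ) ∂arcM = 0) : ∫ θ, G θ * conj (F θ) ∂arcM = 0 := by
  have : ∫ θ, G θ * conj (F θ) ∂arcM = conj (∫ θ, F θ * conj (G θ) ∂arcM) := by
    rw [← integral_conj]; congr 1; ext θ; simp [mul_comm]
  rw [this, h]; simp

lemma cf_eq_inner (F : ℝ → ℂ) (n : ℤ) : cf F n = ∫ θ, F θ * conj (bpt θ ^ n) ∂arcM := by
  simp [cf, conj_bpt]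

/-- backward shift on boundary functions -/
def bs (F : ℝ → ℂ) : ℝ → ℂ := fun θ => bpt θ ^ (-1:ℤ) * (F θ - cf F 0)

lemma beurling {S : Set (ℝ → ℂ)} (h0 : (fun _ => 0) ∈ S) (hadd : ∀ F ∈ S, ∀ G ∈ S, (fun θ => F θ + G θ) ∈ S)
    (hsmul : ∀ c : ℂ, ∀ F ∈ S, (fun θ => c * F θ) ∈ S) (hae : ∀ F ∈ S, ∀ G, F =ᵐ[arcM] G → G ∈ S)
    (hS : ∀ F ∈ S, MemLp F 2 arcM) (hSA : ∀ F ∈ S, Anl F) (hB : ∀ F ∈ S, bs F ∈ S) :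
    (∀ F, MemLp F 2 arcM → Anl F → ∀ ε > (0:ℝ), ∃ G ∈ S, ∫ θ, ‖F θ - G θ‖ ^ 2 ∂arcM < ε) ∨
    ∃ Θ : ℝ → ℂ, MemLp Θ 2 arcM ∧ Anl Θ ∧ (∀ᵐ θ ∂arcM, ‖Θ θ‖ = 1) ∧
      (∀ F ∈ S, ∀ n : ℤ, 0 ≤ n → cf (fun θ => F θ * conj (Θ θ)) n = 0) ∧
      ∀ F, MemLp F 2 arcM → Anl F → (∀ n : ℤ, 0 ≤ n → cf (fun θ => F θ * conj (Θ θ)) n = 0) →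
        ∀ ε > (0:ℝ), ∃ G ∈ S, ∫ θ, ‖F θ - G θ‖ ^ 2 ∂arcM < ε := by
  set N : Set (ℝ → ℂ) := {G | MemLp G 2 arcM ∧ Anl G ∧ ∀ F ∈ S, ∫ θ, F θ * conj (G θ) ∂arcM = 0} with hN
  -- closure criterion
  have hcl : ∀ F, MemLp F 2 arcM → Anl F → (∀ G ∈ N, ∫ θ, F θ * conj (G θ) ∂arcM = 0) →
      ∀ ε > (0:ℝ), ∃ G ∈ S, ∫ θ, ‖F θ - G θ‖ ^ 2 ∂arcM < ε := by
    intro F hF hFA hFN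
    obtain ⟨F1, F2, m1, m2, hs, hc, ho⟩ := l2_decomp h0 hadd hsmul hae hS hF
    have hF1A : Anl F1 := by
      intro n hn
      rw [cf_eq_inner]
      refine l2_perp_closure hS m1 (memLp_bpt n) hc fun G hG => ?_
      rw [← cf_eq_inner]; exact hSA G hG n hn
    have hF2A : Anl F2 := by
      refine anl_congr (anl_sub hF.int2 m1.int2 hFA hF1A) ?_
      filter_upwards [hs] with θ h; rw [h]; ring
    have hF2N : F2 ∈ N := ⟨m2, hF2A, fun G hG => l2_conj_zero (ho G hG)⟩
    have h1 := hFN F2 hF2N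
    have h2 : ∫ θ, F1 θ * conj (F2 θ) ∂arcM = 0 := l2_perp_closure hS m1 m2 hc hF2N.2.2
    have h3 : ∫ θ, F2 θ * conj (F2 θ) ∂arcM = 0 := by
      have : ∫ θ, F θ * conj (F2 θ) ∂arcM = ∫ θ, F1 θ * conj (F2 θ) ∂arcM + ∫ θ, F2 θ * conj (F2 θ) ∂arcM := by
        rw [← integral_add (l2_mul_int m1 m2.conj') (l2_mul_int m2 m2.conj')]
        refine integral_congr_ae ?_
        filter_upwards [hs] with θ h; rw [h]; ring
      rw [h1, h2, zero_add] at this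
      exact this.symm
    have h4 := l2_self_zero m2 h3
    intro ε hε
    obtain ⟨G, hG, hd⟩ := hc ε hε
    refine ⟨G, hG, lt_of_le_of_lt (le_of_eq ?_) hd⟩
    refine integral_congr_ae ?_
    filter_upwards [hs, h4] with θ a b
    rw [a, b]; simp
  -- N is a shift invariant closed subspace
  have hN0 : (fun _ => 0) ∈ N := ⟨MemLp.zero', anl_const 0, fun F _ => by simp⟩
  have hNadd : ∀ F ∈ N, ∀ G ∈ N, (fun θ => F θ + G θ) ∈ N := by
    intro F hF G hG
    refine ⟨hF.1.add hG.1, anl_add hF.1.int2 hG.1.int2 hF.2.1 hG.2.1, fun K hK => ?_⟩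
    simp only [map_add, mul_add]
    rw [integral_add (l2_mul_int (hS K hK) hF.1.conj') (l2_mul_int (hS K hK) hG.1.conj'), hF.2.2 K hK, hG.2.2 K hK, add_zero]
  have hNsmul : ∀ c : ℂ, ∀ F ∈ N, (fun θ => c * F θ) ∈ N := by
    intro c F hF
    refine ⟨hF.1.const_mul c, anl_smul hF.2.1 c, fun K hK => ?_⟩
    have : (fun θ => K θ * conj (c * F θ)) = fun θ => conj c * (K θ * conj (F θ)) := by
      ext θ; simp; ring
    rw [this, integral_const_mul, hF.2.2 K hK, mul_zero]
  have hNae : ∀ F ∈ N, ∀ G, F =ᵐ[arcM] G → G ∈ N := by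
    intro F hF G h
    refine ⟨hF.1.ae_eq h, anl_congr hF.2.1 h, fun K hK => ?_⟩
    rw [← hF.2.2 K hK]
    refine integral_congr_ae ?_
    filter_upwards [h] with θ h; rw [h]
  have hNs : ∀ G ∈ N, (fun θ => bpt θ ^ (1:ℤ) * G θ) ∈ N := by
    intro G hG
    refine ⟨hG.1.bpt_mul 1, fun n hn => ?_, fun F hF => ?_⟩
    · rw [cf_shift]; exact hG.2.1 _ (by omega)
    · have e : (fun θ => F θ * conj (bpt θ ^ (1:ℤ) * G θ)) = fun θ => bs F θ * conj (G θ) + cf F 0 * (bpt θ ^ (-1:ℤ) * conj (G θ)) := by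
        ext θ
        simp only [bs, map_mul, zpow_one, zpow_neg, conj_bpt]; ring
      rw [e, integral_add (l2_mul_int (hS _ (hB F hF)) hG.1.conj') ((l2_mul_int (memLp_bpt _) hG.1.conj').const_mul _),
        hG.2.2 _ (hB F hF), integral_const_mul]
      have : ∫ θ, bpt θ ^ (-1:ℤ) * conj (G θ) ∂arcM = 0 := by
        refine l2_conj_zero ?_
        rw [← cf_eq_inner]; exact hG.2.1 _ (by norm_num)
      rw [this]; simp
  have hNsn : ∀ n : ℕ, ∀ G ∈ N, (fun θ => bpt θ ^ (n:ℤ) * G θ) ∈ N := by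
    intro n G hG
    induction n with
    | zero => simpa using hG
    | succ n ih =>
      have := hNs _ ih
      convert this using 2 with θ
      push_cast
      rw [← mul_assoc, ← zpow_add₀ (bpt_ne_zero θ), add_comm]
  by_cases hex : ∃ n : ℕ, ∃ G ∈ N, cf G n ≠ 0
  swap
  · left
    intro F hF hFA
    refine hcl F hF hFA fun G hG => ?_
    push Not at hex
    have hG0 : G =ᵐ[arcM] 0 := by
      refine ae_zero_of_cf hG.1.int2 fun n => ?_
      rcases lt_or_ge n 0 with h | h
      · exact hG.2.1 n h
      · lift n to ℕ using h
        exact hex n G hG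
    apply integral_eq_zero_of_ae
    filter_upwards [hG0] with θ h
    simp [h]
  right
  classical
  set m := Nat.find hex with hm
  obtain ⟨G0, hG0, hG0m⟩ := Nat.find_spec hex
  have hmin : ∀ G ∈ N, cf G ((m:ℤ) - 1) = 0 := by
    intro G hG
    rcases Nat.eq_zero_or_pos m with h | h
    · rw [h]; exact hG.2.1 _ (by norm_num)
    · have := Nat.find_min hex (m := m - 1) (by omega)
      push Not at this
      have := this G hG
      rwa [Nat.cast_sub h] at this
  obtain ⟨K, K2, k1, k2, hs, hc, ho⟩ := l2_decomp hN0 hNadd hNsmul hNae (fun F hF => hF.1) (memLp_bpt m)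
  have hKN : K ∈ N := by
    refine ⟨k1, fun n hn => ?_, fun F hF => ?_⟩
    · rw [cf_eq_inner]
      refine l2_perp_closure (fun F hF => hF.1) k1 (memLp_bpt n) hc fun G hG => ?_
      rw [← cf_eq_inner]; exact hG.2.1 n hn
    · refine l2_conj_zero (l2_perp_closure (fun F hF => hF.1) k1 (hS F hF) hc fun G hG => ?_)
      exact l2_conj_zero (hG.2.2 F hF)
  have hKr : ∀ G ∈ N, ∫ θ, G θ * conj (K θ) ∂arcM = cf G m := by
    intro G hG
    have h1 : ∫ θ, G θ * conj (bpt θ ^ (m:ℤ)) ∂arcM = ∫ θ, G θ * conj (K θ) ∂arcM + ∫ θ, G θ * conj (K2 θ) ∂arcM := by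
      rw [← integral_add (l2_mul_int hG.1 k1.conj') (l2_mul_int hG.1 k2.conj')]
      refine integral_congr_ae ?_
      filter_upwards [hs] with θ h; rw [h]; simp; ring
    rw [← cf_eq_inner, l2_conj_zero (ho G hG), add_zero] at h1
    exact h1.symm
  have hKw : ∀ n : ℤ, 0 < n → ∀ G ∈ N, ∫ θ, (bpt θ ^ n * G θ) * conj (K θ) ∂arcM = 0 := by
    intro n hn G hG
    lift n to ℕ using hn.le
    have h1 := hNsn (n - 1) G hG
    have h2 := hNs _ h1
    have e : ∀ θ, bpt θ ^ (1:ℤ) * (bpt θ ^ ((n - 1 : ℕ):ℤ) * G θ) = bpt θ ^ (n:ℤ) * G θ := by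
      intro θ
      rw [← mul_assoc, ← zpow_add₀ (bpt_ne_zero θ)]; congr 2; omega
    have h3 := hKr _ h2
    rw [cf_shift, hmin _ h1] at h3
    simp_rw [e] at h3
    exact h3
  set c := ∫ θ, ‖K θ‖ ^ 2 ∂arcM with hcdef
  have hcK : ∫ θ, K θ * conj (K θ) ∂arcM = (c : ℂ) := by
    rw [hcdef, ← integral_complex_ofReal]
    congr 1; ext θ
    rw [Complex.mul_conj, Complex.normSq_eq_norm_sq]
  have hc0 : 0 ≤ c := integral_nonneg fun θ => by positivity
  have hcpos : 0 < c := by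
    refine lt_of_le_of_ne hc0 fun h => ?_
    rw [← h] at hcK
    have hK0 := l2_self_zero k1 (by simpa using hcK)
    apply hG0m
    change cf G0 m = 0
    rw [← hKr G0 hG0]
    apply integral_eq_zero_of_ae
    filter_upwards [hK0] with θ h
    simp [h]
  set s : ℝ := (Real.sqrt c)⁻¹ with hsdef
  have hss : s * s * c = 1 := by
    rw [hsdef, ← mul_inv, Real.mul_self_sqrt hc0, inv_mul_cancel₀ hcpos.ne']
  set Θ : ℝ → ℂ := fun θ => (s:ℂ) * K θ with hΘ
  have hΘN : Θ ∈ N := hNsmul _ K hKN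
  have hΘw : ∀ n : ℤ, 0 < n → ∀ G ∈ N, ∫ θ, (bpt θ ^ n * G θ) * conj (Θ θ) ∂arcM = 0 := by
    intro n hn G hG
    have e : (fun θ => (bpt θ ^ n * G θ) * conj (Θ θ)) = fun θ => (s:ℂ) * ((bpt θ ^ n * G θ) * conj (K θ)) := by
      ext θ; simp [hΘ]; ring
    rw [e, integral_const_mul, hKw n hn G hG, mul_zero]
  have hΘ1 : ∀ᵐ θ ∂arcM, ‖Θ θ‖ = 1 := by
    have hi : Integrable (fun θ => Θ θ * conj (Θ θ)) arcM := l2_mul_int hΘN.1 hΘN.1.conj'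
    have hneg : ∀ n : ℤ, n < 0 → cf (fun θ => Θ θ * conj (Θ θ)) n = 0 := by
      intro n hn
      rw [← hΘw (-n) (by omega) Θ hΘN, cf]
      congr 1; ext θ; ring
    have := ae_eq_of_cf hi (integrable_const (1:ℂ)) (fun n => by
      rw [cf_const]
      rcases lt_trichotomy n 0 with h | h | h
      · rw [hneg n h, if_neg h.ne]
      · subst h
        rw [if_pos rfl, cf_zero_eq]
        have e : (fun θ => Θ θ * conj (Θ θ)) = fun θ => ((s:ℂ) * s) * (K θ * conj (K θ)) := by
          ext θ; simp [hΘ]; ring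
        rw [e, integral_const_mul, hcK]
        exact_mod_cast hss
      · have h2 := cf_conj (fun θ => Θ θ * conj (Θ θ)) n
        rw [hneg (-n) (by omega), map_zero] at h2
        rw [if_neg h.ne', ← h2]
        congr 1; ext θ; simp [mul_comm])
    filter_upwards [this] with θ h
    rw [Complex.mul_conj, Complex.normSq_eq_norm_sq] at h
    have h' : ‖Θ θ‖ ^ 2 = 1 := by exact_mod_cast h
    have := norm_nonneg (Θ θ)
    nlinarith
  refine ⟨Θ, hΘN.1, hΘN.2.1, hΘ1, ?_, ?_⟩
  · intro F hF n hn
    lift n to ℕ using hn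
    rw [← (hNsn n Θ hΘN).2.2 F hF, cf]
    congr 1; ext θ; simp [conj_bpt]; ring
  · intro F hF hFA hF0
    refine hcl F hF hFA fun G hG => ?_
    have hbd : ∀ᵐ θ ∂arcM, ‖conj (Θ θ)‖ ≤ 1 := by
      filter_upwards [hΘ1] with θ h; simp [h]
    have mF : MemLp (fun θ => F θ * conj (Θ θ)) 2 arcM := by
      have := (memLp2_iff.1 hF).bdd_mul (by norm_num) hΘN.1.conj'.1 hbd
      refine memLp2_iff.2 (this.congr (Eventually.of_forall fun θ => mul_comm _ _))
    have mG : MemLp (fun θ => G θ * conj (Θ θ)) 2 arcM := by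
      have := (memLp2_iff.1 hG.1).bdd_mul (by norm_num) hΘN.1.conj'.1 hbd
      refine memLp2_iff.2 (this.congr (Eventually.of_forall fun θ => mul_comm _ _))
    have h1 := l2_inner mF mG
    have h2 : ∀ n, cf (fun θ => F θ * conj (Θ θ)) n * conj (cf (fun θ => G θ * conj (Θ θ)) n) = 0 := by
      intro n
      rcases lt_or_ge n 0 with h | h
      · have : cf (fun θ => G θ * conj (Θ θ)) n = 0 := by
          rw [← hΘw (-n) (by omega) G hG, cf]
          congr 1; ext θ; ring
        rw [this]; simp
      · rw [hF0 n h, zero_mul]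
    simp only [h2] at h1
    have h3 := h1.unique hasSum_zero
    rw [← h3]
    refine integral_congr_ae ?_
    filter_upwards [hΘ1] with θ h
    have : conj (Θ θ) * Θ θ = 1 := by
      rw [mul_comm, Complex.mul_conj, Complex.normSq_eq_norm_sq, h]; simp
    simp only [map_mul, Complex.conj_conj]
    calc F θ * conj (G θ) = F θ * conj (G θ) * (conj (Θ θ) * Θ θ) := by rw [this, mul_one]
      _ = _ := by ring

/-- closed backward-shift invariant subspaces of boundary functions -/
structure BInv (p : ℝ) (M : Set (ℝ → ℂ)) : Prop where
  lp : ∀ F ∈ M, LP p F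
  anl : ∀ F ∈ M, Anl F
  zero : (fun _ => (0:ℂ)) ∈ M
  add : ∀ F ∈ M, ∀ G ∈ M, (fun θ => F θ + G θ) ∈ M
  smul : ∀ c : ℂ, ∀ F ∈ M, (fun θ => c * F θ) ∈ M
  ae : ∀ F ∈ M, ∀ G, F =ᵐ[arcM] G → G ∈ M
  closed : ∀ F, LP p F → Anl F → (∀ ε > (0:ℝ), ∃ G ∈ M, ∫ θ, ‖F θ - G θ‖ ^ p ∂arcM < ε) → F ∈ M
  shift : ∀ F ∈ M, bs F ∈ M

lemma BInv.closed_seq {p : ℝ} {M : Set (ℝ → ℂ)} (hM : BInv p M) {F : ℝ → ℂ} (hF : LP p F) (hA : Anl F) {G : ℕ → ℝ → ℂ}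
    (hG : ∀ n, G n ∈ M) (h : Tendsto (fun n => ∫ θ, ‖F θ - G n θ‖ ^ p ∂arcM) atTop (𝓝 0)) : F ∈ M := by
  refine hM.closed F hF hA fun ε hε => ?_
  obtain ⟨n, hn⟩ := (h.eventually (gt_mem_nhds hε)).exists
  exact ⟨G n, hG n, hn⟩

lemma bs_cf {F : ℝ → ℂ} (hF : Integrable F arcM) (n : ℤ) (hn : n ≠ -1) : cf (bs F) n = cf F (n + 1) := by
  unfold bs
  rw [cf_shift, cf_sub hF (integrable_const _), cf_const, if_neg (by omega), sub_zero]
  congr 1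

lemma bs_cf' {F : ℝ → ℂ} (hF : Integrable F arcM) : cf (bs F) (-1) = 0 := by
  unfold bs
  rw [cf_shift, cf_sub hF (integrable_const _), cf_const, if_pos (by omega)]
  simp

lemma bs_anl {F : ℝ → ℂ} (hF : Integrable F arcM) (hA : Anl F) : Anl (bs F) := by
  intro n hn
  by_cases h : n = -1
  · rw [h, bs_cf' hF]
  · rw [bs_cf hF n h]; exact hA _ (by omega)

lemma bs_int {F : ℝ → ℂ} (hF : Integrable F arcM) : Integrable (bs F) arcM := by
  have := (hF.sub (integrable_const (cf F 0))).mul_bpt (-1)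
  refine this.congr (Eventually.of_forall fun θ => ?_)
  simp [bs, mul_comm]

lemma BInv.iter {p : ℝ} {M : Set (ℝ → ℂ)} (hp : 1 ≤ p) (hM : BInv p M) {F : ℝ → ℂ} (hF : F ∈ M) (j : ℕ) :
    (bs^[j] F) ∈ M ∧ ∀ n : ℤ, 0 ≤ n → cf (bs^[j] F) n = cf F (n + j) := by
  induction j with
  | zero => exact ⟨hF, fun n _ => by simp⟩
  | succ j ih =>
    rw [Function.iterate_succ_apply']
    refine ⟨hM.shift _ ih.1, fun n hn => ?_⟩
    rw [bs_cf ((hM.lp _ ih.1).int hp) n (by omega), ih.2 _ (by omega)]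
    congr 1; push_cast; ring

/-- the Toeplitz-type action of conj h on F stays in M -/
def TM (p : ℝ) (M : Set (ℝ → ℂ)) (F h : ℝ → ℂ) : Prop :=
  ∀ E, LP p E → Anl E → (∀ n : ℤ, 0 ≤ n → cf E n = cf (fun θ => conj (h θ) * F θ) n) → E ∈ M

lemma cf_finsum (F : ℝ → ℂ) (hF : Integrable F arcM) (b : ℕ → ℂ) (N : ℕ) (n : ℤ) :
    cf (fun θ => conj (∑ j ∈ Finset.range N, b j * bpt θ ^ j) * F θ) n =
      ∑ j ∈ Finset.range N, conj (b j) * cf F (n + j) := by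
  have e : ∀ θ, conj (∑ j ∈ Finset.range N, b j * bpt θ ^ j) * F θ * bpt θ ^ (-n) =
      ∑ j ∈ Finset.range N, conj (b j) * (F θ * bpt θ ^ (-(n + j))) := by
    intro θ
    rw [map_sum, Finset.sum_mul, Finset.sum_mul]
    refine Finset.sum_congr rfl fun j _ => ?_
    rw [map_mul, map_pow, conj_bpt, neg_add, zpow_add₀ (bpt_ne_zero θ) (-n), zpow_neg (bpt θ) (j:ℤ), zpow_natCast, inv_pow]
    ring
  simp only [cf]
  simp_rw [e]
  rw [integral_finset_sum]
  · refine Finset.sum_congr rfl fun j _ => ?_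
    rw [integral_const_mul]
  · intro j _
    exact (hF.mul_bpt _).const_mul _

lemma TM_poly {p : ℝ} {M : Set (ℝ → ℂ)} (hp : 1 ≤ p) (hM : BInv p M) {F : ℝ → ℂ} (hF : F ∈ M) (b : ℕ → ℂ) (N : ℕ) :
    TM p M F (fun θ => ∑ j ∈ Finset.range N, b j * bpt θ ^ j) := by
  have key : ∀ N, ∃ G ∈ M, ∀ n : ℤ, 0 ≤ n → cf G n = ∑ j ∈ Finset.range N, conj (b j) * cf F (n + j) := by
    intro N
    induction N with
    | zero => exact ⟨_, hM.zero, fun n _ => by rw [cf_const]; simp⟩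
    | succ N ih =>
      obtain ⟨G, hG, hGc⟩ := ih
      obtain ⟨h1, h2⟩ := hM.iter hp hF N
      refine ⟨_, hM.add _ hG _ (hM.smul (conj (b N)) _ h1), fun n hn => ?_⟩
      rw [cf_add ((hM.lp _ hG).int hp) (((hM.lp _ h1).int hp).const_mul _), cf_smul, hGc n hn, h2 n hn,
        Finset.sum_range_succ]
  intro E hE hA hEc
  obtain ⟨G, hG, hGc⟩ := key N
  refine hM.ae G hG E (ae_eq_of_cf ((hM.lp _ hG).int hp) (hE.int hp) fun n => ?_)
  rcases lt_or_ge n 0 with h | h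
  · rw [hA n h, hM.anl _ hG n h]
  · rw [hEc n h, hGc n h, cf_finsum F ((hM.lp _ hF).int hp)]

lemma TM_lim {p : ℝ} {M : Set (ℝ → ℂ)} (hp : 1 < p) (hM : BInv p M) {F : ℝ → ℂ} (hF : F ∈ M) {h : ℝ → ℂ} {H : ℕ → ℝ → ℂ}
    {C : ℝ} (hm : AEStronglyMeasurable h arcM) (hHm : ∀ n, AEStronglyMeasurable (H n) arcM) (hb : ∀ᵐ θ ∂arcM, ‖h θ‖ ≤ C)
    (hHb : ∀ n, ∀ᵐ θ ∂arcM, ‖H n θ‖ ≤ C)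
    (hlim : ∀ᵐ θ ∂arcM, Tendsto (fun n => H n θ) atTop (𝓝 (h θ))) (hT : ∀ n, TM p M F (H n)) : TM p M F h := by
  intro E hE hA hEc
  have hp0 : 0 < p := by linarith
  obtain ⟨K, hK, hR⟩ := riesz hp
  have hFL := hM.lp F hF
  have cm : ∀ {k : ℝ → ℂ}, AEStronglyMeasurable k arcM → AEStronglyMeasurable (fun θ => conj (k θ)) arcM :=
    fun hk => Complex.continuous_conj.comp_aestronglyMeasurable hk
  have L1 : LP p (fun θ => conj (h θ) * F θ) := hFL.bdd_mul hp0.le (cm hm) (C := C) (by simpa using hb)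
  have L2 : ∀ n, LP p (fun θ => conj (H n θ) * F θ) := fun n => hFL.bdd_mul hp0.le (cm (hHm n)) (C := C) (by simpa using hHb n)
  choose X hX1 hX2 hX3 hX4 using fun n => hR _ ((L2 n).sub hp0.le L1)
  refine hM.closed_seq (G := fun n θ => E θ + X n θ) hE hA (fun n => ?_) ?_
  · refine hT n _ (hE.add hp0.le (hX1 n)) (anl_add (hE.int hp.le) ((hX1 n).int hp.le) hA (hX2 n)) fun k hk => ?_
    rw [cf_add (hE.int hp.le) ((hX1 n).int hp.le), hEc k hk, hX3 n k hk, cf_sub ((L2 n).int hp.le) (L1.int hp.le)]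
    ring
  · have hd : Tendsto (fun n => ∫ θ, ‖conj (H n θ) * F θ - conj (h θ) * F θ‖ ^ p ∂arcM) atTop (𝓝 0) := by
      refine lp_dom hp0 (g := fun θ => 2 * |C| * ‖F θ‖) (fun n => ((L2 n).1.sub L1.1)) ?_ ?_ ?_
      · have e : ∀ θ, (2 * |C| * ‖F θ‖) ^ p = (2 * |C|) ^ p * ‖F θ‖ ^ p := fun θ =>
          Real.mul_rpow (by positivity) (norm_nonneg _)
        simp_rw [e]
        exact hFL.2.const_mul _
      · intro n
        filter_upwards [hb, hHb n] with θ a b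
        rw [← sub_mul, norm_mul]
        gcongr
        refine (norm_sub_le _ _).trans ?_
        simp only [RCLike.norm_conj]
        have := le_abs_self C
        linarith
      · filter_upwards [hlim] with θ hθ
        have h1 : Tendsto (fun n => conj (H n θ)) atTop (𝓝 (conj (h θ))) := (Complex.continuous_conj.tendsto _).comp hθ
        have h2 := (h1.mul_const (F θ)).sub_const (conj (h θ) * F θ)
        simpa using h2
    refine squeeze_zero (fun n => integral_nonneg fun θ => by positivity) (fun n => ?_) (by simpa using hd.const_mul K)
    have e : ∀ θ, ‖E θ - (E θ + X n θ)‖ = ‖X n θ‖ := fun θ => by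
      rw [sub_add_cancel_left, norm_neg]
    simp_rw [e]
    exact hX4 n

lemma TM_bdd {p : ℝ} {M : Set (ℝ → ℂ)} (hp : 1 < p) (hM : BInv p M) {F : ℝ → ℂ} (hF : F ∈ M) {h : ℝ → ℂ}
    {C : ℝ} (hm : AEStronglyMeasurable h arcM) (hA : Anl h) (hb : ∀ᵐ θ ∂arcM, ‖h θ‖ ≤ C) : TM p M F h := by
  have hi : Integrable h arcM := (LP.bdd zero_le_one hm hb).int le_rfl
  have hdm : ∀ n, AEStronglyMeasurable (fun θ => cau h ((rad n : ℂ) * bpt θ)) arcM := fun n =>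
    (continuous_dil (cau_analytic hi) (rad_mem n).1.le (rad_mem n).2).aestronglyMeasurable
  refine TM_lim hp hM hF (H := fun n θ => cau h ((rad n : ℂ) * bpt θ)) (C := C) hm hdm hb
    (fun n => Eventually.of_forall fun θ => dil_bdd hi hA hb (rad_mem n).1.le (rad_mem n).2 θ) (tendsto_dil hi hA) fun n => ?_
  have hs := summable_dil (cau_ser hi) (rad_mem n).1.le (rad_mem n).2
  set b : ℕ → ℂ := fun k => cf h k * (rad n : ℂ) ^ k with hbdef
  have hbs : Summable fun k => ‖b k‖ := hs
  have hsum : ∀ θ, HasSum (fun k => b k * bpt θ ^ k) (cau h ((rad n : ℂ) * bpt θ)) := by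
    intro θ
    rw [dil_eq (cau_ser hi) (rad_mem n).1.le (rad_mem n).2]
    exact (Summable.of_norm (by simpa using hbs)).hasSum
  refine TM_lim hp hM hF (H := fun N θ => ∑ j ∈ Finset.range N, b j * bpt θ ^ j) (C := ∑' k, ‖b k‖) (hdm n) ?_ ?_ ?_ ?_ ?_
  · intro N
    refine Continuous.aestronglyMeasurable ?_
    exact continuous_finset_sum _ fun j _ => continuous_const.mul (continuous_bpt.pow j)
  · refine Eventually.of_forall fun θ => ?_
    rw [← (hsum θ).tsum_eq]
    refine (norm_tsum_le_tsum_norm (by simpa using hbs)).trans (le_of_eq ?_)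
    simp
  · intro N
    refine Eventually.of_forall fun θ => (norm_sum_le _ _).trans ?_
    simp only [norm_mul, norm_pow, norm_bpt, one_pow, mul_one]
    exact hbs.sum_le_tsum _ fun _ _ => norm_nonneg _
  · exact Eventually.of_forall fun θ => (hsum θ).tendsto_sum_nat
  · intro N
    exact TM_poly hp.le hM hF b N

lemma half_ne {w : ℂ} (hw : -1/2 < w.re) (m : ℕ) : (1/2:ℝ) ≤ ‖1 + w / ((m:ℂ) + 1)‖ := by
  have h1 : (1 + w / ((m:ℂ) + 1)).re = 1 + w.re / ((m:ℝ) + 1) := by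
    have : ((m:ℂ) + 1) = (((m:ℝ) + 1 : ℝ) : ℂ) := by push_cast; rfl
    rw [this, Complex.add_re, Complex.div_ofReal_re, Complex.one_re]
  have h2 : (1/2:ℝ) ≤ (1 + w / ((m:ℂ) + 1)).re := by
    rw [h1]
    have hm : (0:ℝ) < (m:ℝ) + 1 := by positivity
    have : -1/2 ≤ w.re / ((m:ℝ)+1) := by
      rw [le_div_iff₀ hm]; nlinarith [(Nat.cast_nonneg m : (0:ℝ) ≤ m)]
    linarith
  exact h2.trans (Complex.re_le_norm _)

lemma one_le_of_re {w : ℂ} (m : ℕ) : 1 + w.re / ((m:ℝ) + 1) ≤ ‖1 + w / ((m:ℂ) + 1)‖ := by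
  have h1 : (1 + w / ((m:ℂ) + 1)).re = 1 + w.re / ((m:ℝ) + 1) := by
    have : ((m:ℂ) + 1) = (((m:ℝ) + 1 : ℝ) : ℂ) := by push_cast; rfl
    rw [this, Complex.add_re, Complex.div_ofReal_re, Complex.one_re]
  rw [← h1]; exact Complex.re_le_norm _

lemma tendsto_one_add_div (w : ℂ) : Tendsto (fun m : ℕ => 1 + w / ((m:ℂ) + 1)) atTop (𝓝 1) := by
  have : Tendsto (fun m : ℕ => w / (((m + 1 : ℕ) : ℂ))) atTop (𝓝 0) :=
    (tendsto_const_div_atTop_nhds_zero_nat (𝕜 := ℂ) w).comp (tendsto_add_atTop_nat 1)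
  have h2 := this.const_add (1:ℂ)
  simpa using h2

/-- outer multiplier `1/(1+V/(m+1))` for `Re V = u ≥ 0` -/
lemma omult {V : ℝ → ℂ} (hV : Integrable V arcM) (hA : Anl V) (h0 : ∀ᵐ θ ∂arcM, 0 ≤ (V θ).re)
    (hc : ∀ z, ‖z‖ < 1 → 0 ≤ (cau V z).re) (m : ℕ) :
    AEStronglyMeasurable (fun θ => (1 + V θ / ((m:ℂ) + 1))⁻¹) arcM ∧ Anl (fun θ => (1 + V θ / ((m:ℂ) + 1))⁻¹) ∧
    (∀ᵐ θ ∂arcM, ‖(1 + V θ / ((m:ℂ) + 1))⁻¹‖ ≤ 1) ∧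
    (∀ᵐ θ ∂arcM, ‖(1 + V θ / ((m:ℂ) + 1))⁻¹‖ * (1 + (V θ).re / ((m:ℝ) + 1)) ≤ 1) := by
  have key := anl_comp hV hA (Φ := fun w => (1 + w / ((m:ℂ) + 1))⁻¹) (U := {w | -1/2 < w.re}) (C := 2)
    (isOpen_lt continuous_const Complex.continuous_re) ?_ ?_ ?_ ?_
  · refine ⟨key.1, key.2.2.1, ?_, ?_⟩
    · filter_upwards [h0] with θ h
      rw [norm_inv]
      apply inv_le_one_of_one_le₀
      have := one_le_of_re (w := V θ) m
      have : 0 ≤ (V θ).re / ((m:ℝ)+1) := by positivity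
      linarith
    · filter_upwards [h0] with θ h
      rw [norm_inv]
      have h1 := one_le_of_re (w := V θ) m
      have h2 : 0 ≤ (V θ).re / ((m:ℝ)+1) := by positivity
      rw [inv_mul_le_iff₀ (by linarith)]; linarith
  · intro w hw
    apply DifferentiableAt.differentiableWithinAt
    apply DifferentiableAt.inv
    · fun_prop
    · intro h
      have := half_ne hw m
      rw [h, norm_zero] at this; norm_num at this
  · intro w hw
    rw [norm_inv]
    have := half_ne hw m
    rw [inv_le_comm₀ (by linarith) (by norm_num)]; linarith
  · intro z hz; have := hc z hz; show -1/2 < (cau V z).re; linarith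
  · filter_upwards [h0] with θ h; show -1/2 < (V θ).re; linarith

lemma emult {F : ℝ → ℂ} (hF : Integrable F arcM) : ∃ E : ℕ → ℝ → ℂ, (∀ m, AEStronglyMeasurable (E m) arcM) ∧
    (∀ m, Anl (E m)) ∧ (∀ m, ∀ᵐ θ ∂arcM, ‖E m θ‖ ≤ 1) ∧ (∀ m, ∃ C : ℝ, ∀ᵐ θ ∂arcM, ‖E m θ * F θ‖ ≤ C) ∧
    ∀ᵐ θ ∂arcM, Tendsto (fun m => E m θ) atTop (𝓝 1) := by
  have hu : MemLp (fun θ => ‖F θ‖ ^ (1/2:ℝ)) 2 arcM := by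
    rw [memLp_two_iff_integrable_sq]
    · refine hF.norm.congr (Eventually.of_forall fun θ => ?_)
      simp only
      rw [← Real.rpow_natCast, ← Real.rpow_mul (norm_nonneg _)]; norm_num
    · exact (hF.1.norm.aemeasurable.pow_const _).aestronglyMeasurable
  obtain ⟨V, hV, hA, hre, hcau, -⟩ := schwarz hu
  have hu0 : ∀ θ, 0 ≤ ‖F θ‖ ^ (1/2:ℝ) := fun θ => by positivity
  have h0 : ∀ᵐ θ ∂arcM, 0 ≤ (V θ).re := by filter_upwards [hre] with θ h; rw [h]; exact hu0 θ
  have hc : ∀ z, ‖z‖ < 1 → 0 ≤ (cau V z).re := fun z hz => by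
    rw [hcau z hz]; exact re_cau_ge (hu.integrable (by norm_num)) (Eventually.of_forall hu0) hz
  have key := fun m => omult hV.int2 hA h0 hc m
  refine ⟨fun m θ => (1 + V θ / ((m:ℂ) + 1))⁻¹ * (1 + V θ / ((m:ℂ) + 1))⁻¹, fun m => (key m).1.mul (key m).1,
    fun m => anl_bdd_mul (key m).1 (key m).2.1 (key m).2.2.1 ((LP.bdd zero_le_one (key m).1 (key m).2.2.1).int le_rfl) (key m).2.1,
    fun m => ?_, fun m => ⟨((m:ℝ)+1)^2, ?_⟩, ?_⟩
  · filter_upwards [(key m).2.2.1] with θ h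
    rw [norm_mul]; nlinarith [norm_nonneg ((1 + V θ / ((m:ℂ) + 1))⁻¹)]
  · filter_upwards [(key m).2.2.2, hre, h0] with θ h h1 h2
    set x := ‖(1 + V θ / ((m:ℂ) + 1))⁻¹‖ with hx
    have hx0 : 0 ≤ x := norm_nonneg _
    rw [norm_mul, norm_mul, ← hx]
    have hF2 : ‖F θ‖ = (V θ).re ^ 2 := by
      rw [h1, ← Real.rpow_natCast, ← Real.rpow_mul (norm_nonneg _)]; norm_num
    rw [hF2]
    have hm : (0:ℝ) < (m:ℝ)+1 := by positivity
    have h3 : x * (V θ).re ≤ (m:ℝ)+1 := by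
      have : x * ((V θ).re / ((m:ℝ)+1)) ≤ 1 := by nlinarith
      rw [← mul_div_assoc, div_le_iff₀ hm] at this; linarith
    have : x * x * (V θ).re ^ 2 = (x * (V θ).re)^2 := by ring
    rw [this]
    exact pow_le_pow_left₀ (by positivity) h3 2
  · refine Eventually.of_forall fun θ => ?_
    have := (tendsto_one_add_div (V θ)).inv₀ one_ne_zero
    simpa using this.mul this

/-- approximation scheme: if `D n → 0` boundedly in `L^p` and `F + D n` has the same analytic projection as
some conj-multiplier image, then we get elements of `M` converging to `F`. -/
lemma approx_scheme {p : ℝ} {M : Set (ℝ → ℂ)} (hp : 1 < p) (hM : BInv p M) {F : ℝ → ℂ} (hF : LP p F) (hA : Anl F)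
    {m h : ℕ → ℝ → ℂ} (hm : ∀ n, m n ∈ M) (hh : ∀ n, AEStronglyMeasurable (h n) arcM) (hhA : ∀ n, Anl (h n))
    (hhb : ∀ n, ∀ᵐ θ ∂arcM, ‖h n θ‖ ≤ 1) {g : ℝ → ℝ} (hg : Integrable (fun θ => g θ ^ p) arcM)
    (hD : ∀ n, ∀ᵐ θ ∂arcM, ‖conj (h n θ) * m n θ - F θ‖ ≤ g θ)
    (h0 : ∀ᵐ θ ∂arcM, Tendsto (fun n => conj (h n θ) * m n θ - F θ) atTop (𝓝 0)) :
    ∃ G : ℕ → ℝ → ℂ, (∀ n, G n ∈ M) ∧ (∀ n, ∀ k : ℤ, 0 ≤ k → cf (G n) k = cf (fun θ => conj (h n θ) * m n θ) k) ∧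
      Tendsto (fun n => ∫ θ, ‖F θ - G n θ‖ ^ p ∂arcM) atTop (𝓝 0) := by
  obtain ⟨C, hC0, hC⟩ := riesz hp
  have hp0 : 0 ≤ p := by linarith
  have hhc : ∀ n, AEStronglyMeasurable (fun θ => conj (h n θ)) arcM := fun n =>
    Complex.continuous_conj.comp_aestronglyMeasurable (hh n)
  have hhm : ∀ n, LP p (fun θ => conj (h n θ) * m n θ) := fun n =>
    (hM.lp _ (hm n)).bdd_mul hp0 (hhc n) (C := 1) (by simpa using hhb n)
  have hDL : ∀ n, LP p (fun θ => conj (h n θ) * m n θ - F θ) := fun n => (hhm n).sub hp0 hF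
  choose X hX hXA hXc hXb using fun n => hC _ (hDL n)
  have hcf : ∀ n, ∀ k : ℤ, 0 ≤ k → cf (fun θ => F θ + X n θ) k = cf (fun θ => conj (h n θ) * m n θ) k := by
    intro n k hk
    rw [cf_add (hF.int hp.le) ((hX n).int hp.le), hXc n k hk, cf_sub ((hhm n).int hp.le) (hF.int hp.le)]; ring
  refine ⟨fun n θ => F θ + X n θ, fun n => ?_, hcf, ?_⟩
  · exact TM_bdd hp hM (hm n) (hh n) (hhA n) (hhb n) _ (hF.add hp0 (hX n))
      (anl_add (hF.int hp.le) ((hX n).int hp.le) hA (hXA n)) (hcf n)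
  · have h1 := (lp_dom (by linarith) (fun n => (hDL n).1) hg hD h0).const_mul C
    rw [mul_zero] at h1
    refine squeeze_zero (fun n => integral_nonneg fun θ => by positivity) (fun n => ?_) h1
    simpa using hXb n

lemma cdense {p : ℝ} {M : Set (ℝ → ℂ)} (hp : 1 < p) (hM : BInv p M) {F : ℝ → ℂ} (hF : F ∈ M) :
    ∃ G : ℕ → ℝ → ℂ, (∀ n, G n ∈ M) ∧ (∀ n, MemLp (G n) 2 arcM) ∧ 
      Tendsto (fun n => ∫ θ, ‖F θ - G n θ‖ ^ p ∂arcM) atTop (𝓝 0) := by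
  have hp0 : 0 ≤ p := by linarith
  have hL := hM.lp F hF
  have hFi := hL.int hp.le
  obtain ⟨E, hE, hEA, hEb, hEF, hE1⟩ := emult hFi
  have hg : LP p (fun θ => 2 * F θ) := hL.smul hp0 2
  have hap := approx_scheme hp hM hL (hM.anl F hF) (m := fun _ => F) (h := E) (g := fun θ => ‖2 * F θ‖) (fun _ => hF) hE hEA hEb
    hg.2 ?_ ?_
  · obtain ⟨G, hG, hGc, hGt⟩ := hap
    refine ⟨G, hG, fun n => ?_, hGt⟩
    obtain ⟨C, hC⟩ := hEF n
    have h2 : MemLp (fun θ => conj (E n θ) * F θ) 2 arcM := 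
      memLp2_iff.2 (LP.bdd (by norm_num) ((Complex.continuous_conj.comp_aestronglyMeasurable (hE n)).mul hFi.1) (C := C) (by simpa using hC))
    obtain ⟨P, hP, hPA, hPc⟩ := l2_proj h2
    have : P =ᵐ[arcM] G n := by
      apply ae_eq_of_cf hP.int2 ((hM.lp _ (hG n)).int hp.le)
      intro k
      rcases lt_or_ge k 0 with hk | hk
      · rw [hPA k hk, hM.anl _ (hG n) k hk]
      · rw [hPc k hk, hGc n k hk]
    exact (memLp_congr_ae this).1 hP
  · intro n
    filter_upwards [hEb n] with θ h
    have : conj (E n θ) * F θ - F θ = (conj (E n θ) - 1) * F θ := by ring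
    rw [this, norm_mul, norm_mul]
    gcongr
    calc ‖conj (E n θ) - 1‖ ≤ ‖conj (E n θ)‖ + ‖(1:ℂ)‖ := norm_sub_le _ _
      _ ≤ ‖(2:ℂ)‖ := by simp; linarith
  · filter_upwards [hE1] with θ h
    have h1 : Tendsto (fun n => conj (E n θ)) atTop (𝓝 1) := by
      simpa [Function.comp_def] using (Complex.continuous_conj.tendsto 1).comp h
    simpa using (h1.mul_const (F θ)).sub_const (F θ)

lemma ddense {p : ℝ} {M : Set (ℝ → ℂ)} (hp : 1 < p) (hM : BInv p M) {F : ℝ → ℂ} (hF : LP p F) (hA : Anl F) (hF2 : MemLp F 2 arcM)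
    (h : ∀ ε > (0:ℝ), ∃ G ∈ M, MemLp G 2 arcM ∧ ∫ θ, ‖F θ - G θ‖ ^ 2 ∂arcM < ε) : F ∈ M := by
  have hp0 : 0 ≤ p := by linarith
  choose m hm hm2 hmε using fun n : ℕ => h (1 / ((n:ℝ) + 1)) (by positivity)
  have hlim : Tendsto (fun n => ∫ θ, ‖F θ - m n θ‖ ^ 2 ∂arcM) atTop (𝓝 0) :=
    squeeze_zero (fun n => integral_nonneg fun θ => by positivity) (fun n => (hmε n).le) tendsto_one_div_add_atTop_nhds_zero_nat
  have hu : ∀ n, MemLp (fun θ => ‖F θ - m n θ‖) 2 arcM := fun n => (hF2.sub (hm2 n)).norm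
  choose V hV hVA hre hcau hVb _ _ using fun n => schwarz (hu n)
  have hVlim : Tendsto (fun n => ∫ θ, ‖V n θ‖ ^ 2 ∂arcM) atTop (𝓝 0) := by
    have := hlim.const_mul 4
    rw [mul_zero] at this
    exact squeeze_zero (fun n => integral_nonneg fun θ => by positivity) hVb this
  obtain ⟨φ, hφ, hφl⟩ := ae_subseq (g := fun n θ => ‖V n θ‖ ^ 2) (fun n => (memLp_two_iff_integrable_sq_norm (hV n).1).1 (hV n))
    (fun n θ => by positivity) hVlim
  have hr0 : ∀ n, ∀ᵐ θ ∂arcM, 0 ≤ (V n θ).re := fun n => by filter_upwards [hre n] with θ h; rw [h]; positivity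
  have hc : ∀ n z, ‖z‖ < 1 → 0 ≤ (cau (V n) z).re := fun n z hz => by
    rw [hcau n z hz]; exact re_cau_ge ((hu n).integrable (by norm_num)) (Eventually.of_forall fun θ => norm_nonneg _) hz
  have key := fun n => omult (hV n).int2 (hVA n) (hr0 n) (hc n) 0
  simp only [Nat.cast_zero, zero_add, div_one] at key
  have hg : LP p (fun θ => ((1 + 2 * ‖F θ‖ : ℝ) : ℂ)) := by
    have := (LP.bdd (p := p) hp0 (aestronglyMeasurable_const (b := (1:ℂ))) (C := 1) (by simp)).add hp0
      ((LP.of_le hp0 (F := fun θ => ((‖F θ‖:ℝ):ℂ)) (C := 1) (Complex.continuous_ofReal.comp_aestronglyMeasurable hF.1.norm) hF (by simp)).smul hp0 2)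
    simpa using this
  have hVt : ∀ᵐ θ ∂arcM, Tendsto (fun n => V (φ n) θ) atTop (𝓝 0) := by
    filter_upwards [hφl] with θ h
    rw [tendsto_zero_iff_norm_tendsto_zero]
    have := (Real.continuous_sqrt.tendsto 0).comp h
    simpa [Function.comp_def, Real.sqrt_sq] using this
  have hap := approx_scheme hp hM hF hA (m := fun n => m (φ n)) (h := fun n θ => (1 + V (φ n) θ)⁻¹)
    (g := fun θ => 1 + 2 * ‖F θ‖) (fun n => hm _) (fun n => (key _).1) (fun n => (key _).2.1) (fun n => (key _).2.2.1) ?_ ?_ ?_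
  · obtain ⟨G, hG, -, hGt⟩ := hap
    exact hM.closed_seq hF hA hG hGt
  · refine hg.2.congr (Eventually.of_forall fun θ => ?_)
    simp only
    rw [Complex.norm_real, Real.norm_of_nonneg (by positivity)]
  · intro n
    filter_upwards [(key (φ n)).2.2.2, (key (φ n)).2.2.1, hre (φ n)] with θ h1 h2 h3
    set x := (1 + V (φ n) θ)⁻¹
    have e : conj x * m (φ n) θ - F θ = (conj x - 1) * F θ - conj x * (F θ - m (φ n) θ) := by ring
    rw [e]
    refine (norm_sub_le _ _).trans ?_
    rw [norm_mul, norm_mul, ← h3, RCLike.norm_conj]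
    have : ‖conj x - 1‖ ≤ 2 := (norm_sub_le _ _).trans (by simp; linarith)
    have := mul_le_mul_of_nonneg_right this (norm_nonneg (F θ))
    have h4 := norm_nonneg x
    nlinarith
  · have hlr : ∀ᵐ θ ∂arcM, ∀ n, (V n θ).re = ‖F θ - m n θ‖ := ae_all_iff.2 hre
    filter_upwards [hVt, hlr] with θ h h1
    have h2 : Tendsto (fun n => F θ - m (φ n) θ) atTop (𝓝 0) := by
      rw [tendsto_zero_iff_norm_tendsto_zero]
      simp_rw [← h1]
      simpa [Function.comp_def] using (Complex.continuous_re.tendsto 0).comp h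
    have h3 : Tendsto (fun n => m (φ n) θ) atTop (𝓝 (F θ)) := by
      simpa using (tendsto_const_nhds (x := F θ)).sub h2
    have h4 : Tendsto (fun n => conj ((1 + V (φ n) θ)⁻¹)) atTop (𝓝 1) := by
      have h5 : Tendsto (fun n => (1 + V (φ n) θ)⁻¹) atTop (𝓝 1) := by
        have := (h.const_add (1:ℂ)).inv₀ (by simp)
        simpa using this
      simpa [Function.comp_def] using (Complex.continuous_conj.tendsto 1).comp h5
    simpa using (h4.mul h3).sub_const (F θ)

lemma ddense1 {M : Set (ℝ → ℂ)} (hM : BInv 1 M) {F : ℝ → ℂ} (hA : Anl F) (hF2 : MemLp F 2 arcM)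
    (h : ∀ ε > (0:ℝ), ∃ G ∈ M, MemLp G 2 arcM ∧ ∫ θ, ‖F θ - G θ‖ ^ 2 ∂arcM < ε) : F ∈ M := by
  refine hM.closed F ((memLp2_iff.1 hF2).mono_exp zero_le_one (by norm_num)) hA fun ε hε => ?_
  obtain ⟨G, hG, hG2, hGε⟩ := h (ε ^ 2 / 4) (by positivity)
  refine ⟨G, hG, ?_⟩
  have hd := hF2.sub hG2
  have hi : Integrable (fun θ => ‖F θ - G θ‖ ^ 2) arcM := (memLp_two_iff_integrable_sq_norm hd.1).1 hd
  calc ∫ θ, ‖F θ - G θ‖ ^ (1:ℝ) ∂arcM ≤ ∫ θ, (ε / 4 + ‖F θ - G θ‖ ^ 2 / ε) ∂arcM := by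
        apply integral_mono
        · simpa using hd.int2.norm
        · exact (integrable_const _).add (hi.div_const _)
        · intro θ
          simp only [Real.rpow_one]
          rw [← sub_nonneg]
          have : ε / 4 + ‖F θ - G θ‖ ^ 2 / ε - ‖F θ - G θ‖ = (ε / 2 - ‖F θ - G θ‖) ^ 2 / ε := by field_simp; ring
          rw [this]; positivity
    _ = ε / 4 + (∫ θ, ‖F θ - G θ‖ ^ 2 ∂arcM) / ε := by
        rw [integral_add (integrable_const _) (hi.div_const _)]
        simp [integral_div]
    _ < ε / 4 + (ε ^ 2 / 4) / ε := by gcongr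
    _ ≤ ε := by field_simp; norm_num

lemma l1_norm {F : ℝ → ℂ} (hF : Integrable F arcM) : ‖hF.toL1 F‖ = ∫ θ, ‖F θ‖ ∂arcM := by
  rw [L1.norm_eq_integral_norm]
  exact integral_congr_ae (by filter_upwards [hF.coeFn_toL1] with θ h; rw [h])

lemma l2_le_sq {F : ℝ → ℂ} (hF : MemLp F 2 arcM) : (∫ θ, ‖F θ‖ ∂arcM) ^ 2 ≤ ∫ θ, ‖F θ‖ ^ 2 ∂arcM := by
  have h1 : MemLp (fun θ => ((‖F θ‖:ℝ):ℂ)) 2 arcM := hF.norm.ofReal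
  have h2 : MemLp (fun _ : ℝ => (1:ℂ)) 2 arcM := memLp_const 1
  have := l2_cs h1 h2
  simp only [map_one, mul_one, integral_complex_ofReal, Complex.norm_real, norm_norm, norm_one, one_pow, integral_const, smul_eq_mul, Measure.real, measure_univ, ENNReal.toReal_one, Real.norm_eq_abs, sq_abs] at this
  exact this

lemma l1_dual (f : StrongDual ℂ (ℝ →₁[arcM] ℂ)) : ∃ φ : ℝ → ℂ, AEStronglyMeasurable φ arcM ∧ (∀ᵐ θ ∂arcM, ‖φ θ‖ ≤ ‖f‖) ∧
    ∀ F (hF : Integrable F arcM), f (hF.toL1 F) = ∫ θ, F θ * conj (φ θ) ∂arcM := by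
  let g : Lp ℂ 2 arcM →ₗ[ℂ] ℂ :=
    { toFun := fun x => f ((Lp.memLp x).int2.toL1 x)
      map_add' := fun x y => by
        rw [← map_add, ← Integrable.toL1_add]
        congr 1
        rw [Integrable.toL1_eq_toL1_iff]
        exact Lp.coeFn_add x y
      map_smul' := fun c x => by
        rw [RingHom.id_apply, ← map_smul, ← Integrable.toL1_smul]
        congr 1
        rw [Integrable.toL1_eq_toL1_iff]
        exact Lp.coeFn_smul c x }
  have hgb : ∀ x, ‖g x‖ ≤ ‖f‖ * ‖x‖ := by
    intro x
    refine (f.le_opNorm _).trans ?_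
    gcongr
    rw [l1_norm]
    have h1 := l2_le_sq (Lp.memLp x)
    rw [← lp2_norm] at h1
    exact (abs_le_of_sq_le_sq' h1 (norm_nonneg x)).2
  let g' : StrongDual ℂ (Lp ℂ 2 arcM) := g.mkContinuous ‖f‖ hgb
  let φ := (InnerProductSpace.toDual ℂ (Lp ℂ 2 arcM)).symm g'
  have hφ : ∀ G (hG : MemLp G 2 arcM), f (hG.int2.toL1 G) = ∫ θ, G θ * conj (φ θ) ∂arcM := by
    intro G hG
    have h1 : inner ℂ φ (hG.toLp G) = g' (hG.toLp G) := InnerProductSpace.toDual_symm_apply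
    rw [lp2_inner] at h1
    have h2 : g' (hG.toLp G) = f (hG.int2.toL1 G) := by
      show f _ = f _
      congr 1
      rw [Integrable.toL1_eq_toL1_iff]
      exact hG.coeFn_toLp
    rw [← h2, ← h1]
    exact integral_congr_ae (by filter_upwards [hG.coeFn_toLp] with θ h; rw [h])
  have hφ2 : MemLp φ 2 arcM := Lp.memLp φ
  have hφm : StronglyMeasurable (φ : ℝ → ℂ) := Lp.stronglyMeasurable φ
  have hb : ∀ᵐ θ ∂arcM, ‖φ θ‖ ≤ ‖f‖ := by
    let A : Set ℝ := {θ | ‖f‖ < ‖φ θ‖}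
    have hAm : MeasurableSet A := measurableSet_lt measurable_const hφm.norm.measurable
    have hG : MemLp (A.indicator (φ : ℝ → ℂ)) 2 arcM := hφ2.indicator hAm
    have h1 := hφ _ hG
    have h2 := f.le_opNorm (hG.int2.toL1 _)
    rw [h1, l1_norm] at h2
    have e : ∫ θ, A.indicator (φ : ℝ → ℂ) θ * conj (φ θ) ∂arcM = ((∫ θ, A.indicator (fun θ => ‖φ θ‖ ^ 2) θ ∂arcM : ℝ) : ℂ) := by
      rw [← integral_complex_ofReal]
      congr 1; ext θ
      by_cases h : θ ∈ A
      · simp [h, Complex.mul_conj, Complex.normSq_eq_norm_sq]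
      · simp [h]
    have hi2 : Integrable (A.indicator (fun θ => ‖φ θ‖ ^ 2)) arcM := ((memLp_two_iff_integrable_sq_norm hφ2.1).1 hφ2).indicator hAm
    rw [e, Complex.norm_real, Real.norm_of_nonneg (integral_nonneg fun θ => by
      by_cases h : θ ∈ A <;> simp [h]), ← integral_const_mul, ← sub_nonneg, ← integral_sub (hG.int2.norm.const_mul _) hi2] at h2
    have h3 : ∀ θ, 0 ≤ A.indicator (fun θ => ‖φ θ‖ ^ 2) θ - ‖f‖ * ‖A.indicator (φ : ℝ → ℂ) θ‖ := by
      intro θ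
      by_cases h : θ ∈ A
      · have : ‖f‖ < ‖φ θ‖ := h
        simp only [h, indicator_of_mem]
        nlinarith [norm_nonneg f]
      · simp [h]
    have h4 : ∫ θ, (A.indicator (fun θ => ‖φ θ‖ ^ 2) θ - ‖f‖ * ‖A.indicator (φ : ℝ → ℂ) θ‖) ∂arcM = 0 := by
      refine le_antisymm ?_ (integral_nonneg h3)
      have : ∫ θ, (A.indicator (fun θ => ‖φ θ‖ ^ 2) θ - ‖f‖ * ‖A.indicator (φ : ℝ → ℂ) θ‖) ∂arcM
        = - ∫ θ, (‖f‖ * ‖A.indicator (φ : ℝ → ℂ) θ‖ - A.indicator (fun θ => ‖φ θ‖ ^ 2) θ) ∂arcM := by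
        rw [← integral_neg]; congr 1; ext θ; ring
      linarith
    rw [integral_eq_zero_iff_of_nonneg h3 (hi2.sub (hG.int2.norm.const_mul _))] at h4
    filter_upwards [h4] with θ h
    by_contra hc
    have hA : θ ∈ A := not_le.1 hc
    have hlt : ‖f‖ < ‖φ θ‖ := hA
    simp only [hA, indicator_of_mem, Pi.zero_apply] at h
    nlinarith [norm_nonneg f]
  refine ⟨φ, hφm.aestronglyMeasurable, hb, fun F hF => ?_⟩
  -- density
  obtain ⟨E, hE, hEA, hEb, hEF, hE1⟩ := emult hF
  have hm : ∀ n, MemLp (fun θ => E n θ * F θ) 2 arcM := fun n => by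
    obtain ⟨C, hC⟩ := hEF n
    exact memLp2_iff.2 (LP.bdd (by norm_num) ((hE n).mul hF.1) hC)
  have t1 : Tendsto (fun n => ∫ θ, (E n θ * F θ) * conj (φ θ) ∂arcM) atTop (𝓝 (∫ θ, F θ * conj (φ θ) ∂arcM)) := by
    refine tendsto_integral_of_dominated_convergence (fun θ => ‖F θ‖ * ‖f‖) (fun n => ((hm n).1.mul hφ2.conj'.1)) (hF.norm.mul_const _) (fun n => ?_) ?_
    · filter_upwards [hEb n, hb] with θ h1 h2
      rw [norm_mul, norm_mul, RCLike.norm_conj]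
      have := mul_le_mul_of_nonneg_right h1 (norm_nonneg (F θ))
      exact mul_le_mul (by linarith) h2 (norm_nonneg _) (norm_nonneg _)
    · filter_upwards [hE1] with θ h
      simpa using (h.mul_const (F θ)).mul_const (conj (φ θ))
  have t2 : Tendsto (fun n => f ((hm n).int2.toL1 _)) atTop (𝓝 (f (hF.toL1 F))) := by
    refine (f.continuous.tendsto _).comp ?_
    rw [tendsto_iff_norm_sub_tendsto_zero]
    have := lp_dom (p := 1) one_pos (A := fun n θ => E n θ * F θ - F θ) (g := fun θ => 2 * ‖F θ‖) (fun n => (hm n).1.sub hF.1) (by simpa using hF.norm.const_mul 2) (fun n => ?_) ?_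
    · refine this.congr fun n => ?_
      rw [← Integrable.toL1_sub, l1_norm]
      simp
    · filter_upwards [hEb n] with θ h
      have h1 : ‖E n θ - 1‖ ≤ 2 := (norm_sub_le _ _).trans (by simp; linarith)
      have e : E n θ * F θ - F θ = (E n θ - 1) * F θ := by ring
      rw [e, norm_mul]; gcongr
    · filter_upwards [hE1] with θ h
      simpa using (h.mul_const (F θ)).sub_const (F θ)
  refine tendsto_nhds_unique t2 (t1.congr fun n => ?_)
  rw [hφ _ (hm n)]

lemma hb1 {S : Set (ℝ → ℂ)} (h0 : (fun _ => 0) ∈ S) (hadd : ∀ F ∈ S, ∀ G ∈ S, (fun θ => F θ + G θ) ∈ S)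
    (hsmul : ∀ c : ℂ, ∀ F ∈ S, (fun θ => c * F θ) ∈ S) (hae : ∀ F ∈ S, ∀ G, F =ᵐ[arcM] G → G ∈ S)
    (hS : ∀ F ∈ S, Integrable F arcM) {F : ℝ → ℂ} (hF : Integrable F arcM)
    (hn : ∀ φ : ℝ → ℂ, ∀ C : ℝ, AEStronglyMeasurable φ arcM → (∀ᵐ θ ∂arcM, ‖φ θ‖ ≤ C) → 
      (∀ G ∈ S, ∫ θ, G θ * φ θ ∂arcM = 0) → ∫ θ, F θ * φ θ ∂arcM = 0) :
    ∀ ε > (0:ℝ), ∃ G ∈ S, ∫ θ, ‖F θ - G θ‖ ^ (1:ℝ) ∂arcM < ε := by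
  let W : Submodule ℂ (Lp ℂ 1 arcM) :=
    { carrier := {x | (x : ℝ → ℂ) ∈ S}
      zero_mem' := hae _ h0 _ (Lp.coeFn_zero ℂ 1 arcM).symm
      add_mem' := fun {x y} hx hy => hae _ (hadd _ hx _ hy) _ (Lp.coeFn_add x y).symm
      smul_mem' := fun c x hx => hae _ (hsmul c _ hx) _ (Lp.coeFn_smul c x).symm }
  have hmem : hF.toL1 F ∈ W.topologicalClosure := by
    by_contra hx
    obtain ⟨f, u, hu1, hu2⟩ := RCLike.geometric_hahn_banach_point_closed (𝕜 := ℂ)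
      (W.topologicalClosure.restrictScalars ℝ).convex W.isClosed_topologicalClosure hx
    have hu0 : u < 0 := by simpa using hu2 0 (zero_mem _)
    have hW : ∀ b ∈ W, f b = 0 := by
      intro b hb
      by_contra hfb
      have h1 := hu2 ((u / f b) • b) (W.le_topologicalClosure (W.smul_mem _ hb))
      rw [map_smul, smul_eq_mul, div_mul_cancel₀ _ hfb] at h1
      simp at h1
    obtain ⟨φ, hφ, hφb, hφf⟩ := l1_dual f
    have := hn (fun θ => conj (φ θ)) ‖f‖ (Complex.continuous_conj.comp_aestronglyMeasurable hφ) (by simpa using hφb) (fun G hG => by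
      rw [← hφf G (hS G hG)]
      exact hW _ (hae _ hG _ (hS G hG).coeFn_toL1.symm))
    rw [← hφf F hF] at this
    rw [this] at hu1
    simp at hu1; linarith
  intro ε hε
  obtain ⟨w, hw, hd⟩ := Metric.mem_closure_iff.1 (show hF.toL1 F ∈ closure (W : Set (Lp ℂ 1 arcM)) from hmem) ε hε
  refine ⟨w, hw, ?_⟩
  rw [dist_eq_norm, L1.norm_eq_integral_norm] at hd
  refine lt_of_le_of_lt (le_of_eq ?_) hd
  refine integral_congr_ae ?_
  filter_upwards [Lp.coeFn_sub (hF.toL1 F) w, hF.coeFn_toL1] with θ h1 h2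
  rw [h1, Real.rpow_one, Pi.sub_apply, h2]

lemma bs_pair {M : Set (ℝ → ℂ)} (hM : BInv 1 M) {F ψ : ℝ → ℂ} (hF : F ∈ M) {C : ℝ} (hψ : AEStronglyMeasurable ψ arcM)
    (hC : ∀ᵐ θ ∂arcM, ‖ψ θ‖ ≤ C) (j : ℕ) (n : ℤ) :
    cf (fun θ => bs^[j] F θ * ψ θ) n = cf (fun θ => F θ * ψ θ) (n + j) -
      ∑ k ∈ Finset.range j, cf F k * cf ψ (n + j - k) := by
  induction j generalizing n with
  | zero => simp
  | succ j ih =>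
    have hG := hM.iter le_rfl hF j
    have hGi := (hM.lp _ hG.1).int le_rfl
    have hψi : Integrable ψ arcM := (LP.bdd zero_le_one hψ hC).int le_rfl
    have e : (fun θ => bs^[j+1] F θ * ψ θ) = fun θ => bpt θ ^ (-1:ℤ) * (bs^[j] F θ * ψ θ - cf F j * ψ θ) := by
      ext θ
      rw [Function.iterate_succ_apply']
      have := hG.2 0 le_rfl
      rw [zero_add] at this
      unfold bs at this ⊢
      rw [this]; ring
    have hi : Integrable (fun θ => bs^[j] F θ * ψ θ) arcM := hGi.mul_bdd hψ hC
    rw [e, cf_shift, cf_sub hi (hψi.const_mul _), cf_smul, ih, Finset.sum_range_succ]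
    push_cast
    have a1 : n - -1 + (j:ℤ) = n + (j + 1) := by ring
    have a2 : n - -1 = n + (j+1) - j := by ring
    rw [a1, a2]; ring

lemma bs_pair_zero {M : Set (ℝ → ℂ)} (hM : BInv 1 M) {F ψ : ℝ → ℂ} (hF : F ∈ M) {C : ℝ} (hψ : AEStronglyMeasurable ψ arcM)
    (hC : ∀ᵐ θ ∂arcM, ‖ψ θ‖ ≤ C) (h : ∀ G ∈ M, ∫ θ, G θ * ψ θ ∂arcM = 0) (j : ℕ) :
    cf (fun θ => F θ * ψ θ) j = ∑ k ∈ Finset.range j, cf F k * cf ψ ((j:ℤ) - k) := by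
  have h1 := bs_pair hM hF hψ hC j 0
  rw [cf_zero_eq, h _ (hM.iter le_rfl hF j).1] at h1
  simp only [zero_add] at h1
  rw [eq_comm, sub_eq_zero] at h1
  exact h1

/-- the strictly analytic part of a bounded (or `L²`) function -/
lemma strict_part {ψ : ℝ → ℂ} (hψ : MemLp ψ 2 arcM) : ∃ K, MemLp K 2 arcM ∧ Anl K ∧ cf K 0 = 0 ∧
    ∀ n : ℤ, 0 < n → cf K n = cf ψ n := by
  obtain ⟨P, hP, hPA, hPc⟩ := l2_proj (hψ.bpt_mul (-1))
  have key : ∀ n, cf (fun t => bpt t ^ (1:ℤ) * P t) n = cf P (n - 1) := fun n => cf_shift _ _ _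
  refine ⟨fun t => bpt t ^ (1:ℤ) * P t, hP.bpt_mul 1, fun n hn => ?_, ?_, fun n hn => ?_⟩
  · rw [key]; exact hPA _ (by omega)
  · rw [key]; exact hPA _ (by omega)
  · rw [key, hPc _ (by omega), cf_shift]; congr 1; ring

lemma l2_dil_tendsto {K : ℝ → ℂ} (hK : MemLp K 2 arcM) (hA : Anl K) :
    Tendsto (fun n => ∫ θ, ‖cau K ((rad n:ℂ) * bpt θ) - K θ‖ ^ 2 ∂arcM) atTop (𝓝 0) := by
  have hd : ∀ n, MemLp (fun θ => cau K ((rad n:ℂ) * bpt θ)) 2 arcM := fun n => memLp_dil (cau_analytic hK.int2) (rad_mem n).1.le (rad_mem n).2 2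
  have hs := fun n => (l2_parseval ((hd n).sub hK)).tsum_eq
  have hc : ∀ n (k : ℤ), cf ((fun θ => cau K ((rad n:ℂ) * bpt θ)) - K) k = cf K k * ((rad n : ℂ) ^ k.toNat - 1) := by
    intro n k
    have := cf_sub (hd n).int2 hK.int2 k
    rw [cf_dil (cau_ser hK.int2) (rad_mem n).1.le (rad_mem n).2] at this
    refine this.trans ?_
    split_ifs with h
    · rw [Int.toNat_of_nonneg h]; ring
    · rw [hA k (by omega)]; simp
  have h1 : Tendsto (fun n => ∑' k : ℤ, ‖cf ((fun θ => cau K ((rad n:ℂ) * bpt θ)) - K) k‖ ^ 2) atTop (𝓝 (∑' k : ℤ, 0)) := by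
    refine tendsto_tsum_of_dominated_convergence (bound := fun k => ‖cf K k‖ ^ 2) (l2_parseval hK).summable ?_ ?_
    · intro k
      have : Tendsto (fun n => ‖cf K k * ((rad n : ℂ) ^ k.toNat - 1)‖ ^ 2) atTop (𝓝 (‖cf K k * ((1:ℂ) ^ k.toNat - 1)‖ ^ 2)) := by
        have hr : Tendsto (fun n => (rad n : ℂ)) atTop (𝓝 (1:ℂ)) := by
          have := (Complex.continuous_ofReal.tendsto 1).comp rad_tendsto'
          simpa [Function.comp_def] using this
        exact (((hr.pow _).sub_const 1).const_mul _).norm.pow 2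
      simp_rw [hc]
      simpa using this
    · refine Eventually.of_forall fun n k => ?_
      rw [hc, norm_mul, mul_pow, Real.norm_of_nonneg (by positivity)]
      have h2 : ‖(rad n : ℂ) ^ k.toNat - 1‖ ≤ 1 := by
        have : (rad n : ℂ) ^ k.toNat - 1 = ((rad n ^ k.toNat - 1 : ℝ) : ℂ) := by push_cast; rfl
        rw [this, Complex.norm_real, Real.norm_eq_abs, abs_le]
        have a := pow_le_one₀ (n := k.toNat) (rad_mem n).1.le (rad_mem n).2.le
        have b := pow_nonneg (rad_mem n).1.le k.toNat
        constructor <;> linarith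
      have h3 : ‖(rad n : ℂ) ^ k.toNat - 1‖ ^ 2 ≤ 1 := pow_le_one₀ (norm_nonneg _) h2
      nlinarith [sq_nonneg ‖cf K k‖]
  rw [tsum_zero] at h1
  exact h1.congr hs

lemma cau_mul {h F : ℝ → ℂ} (hh : AEStronglyMeasurable h arcM) (hA : Anl h) {C : ℝ} (hC : ∀ᵐ θ ∂arcM, ‖h θ‖ ≤ C)
    (hF : Integrable F arcM) (hFA : Anl F) {z : ℂ} (hz : ‖z‖ < 1) : cau (fun θ => h θ * F θ) z = cau h z * cau F z := by
  have hhi : Integrable h arcM := (LP.bdd zero_le_one hh hC).int le_rfl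
  have hb : ∀ z : ℂ, ‖z‖ < 1 → ‖cau h z‖ ≤ C := fun z hz => by
    rw [← pois_anl hhi hA hz]; exact norm_pois_le_bdd hhi hC hz
  have hC0 : 0 ≤ C := (norm_nonneg _).trans (hb 0 (by simp))
  have hm : MemHp 1 (fun z => cau h z * cau F z) := by
    refine ⟨(cau_analytic hhi).mul (cau_analytic hF), ⟨C * ∫ θ, ‖F θ‖ ^ (1:ℝ) ∂arcM, ?_⟩⟩
    rintro _ ⟨r, hr, rfl⟩
    have hr0 := hr.1.le
    refine le_trans ?_ (mul_le_mul_of_nonneg_left (T2 le_rfl hF (by simpa using hF.norm) hFA hr0 hr.2) hC0)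
    unfold hMean
    rw [← integral_const_mul]
    refine integral_mono_of_nonneg (Eventually.of_forall fun θ => by positivity) ?_ (Eventually.of_forall fun θ => ?_)
    · exact (integrable_dil_rpow (cau_analytic hF) zero_le_one hr0 hr.2).const_mul _
    · simp only [Real.rpow_one, norm_mul]
      gcongr
      exact hb _ (by rw [norm_r_bpt hr0]; exact hr.2)
  obtain ⟨G, hG, -, hGA, hGb, hGc, -⟩ := T1 le_rfl hm
  have hb2 : BoundaryFn (fun z => cau h z * cau F z) (fun θ => h θ * F θ) := by
    filter_upwards [fatou_cau hhi hA, fatou_cau hF hFA] with θ h1 h2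
    exact h1.mul h2
  have := bdry_unique hb2 hGb
  rw [← hGc z hz]
  unfold cau
  exact integral_congr_ae (by filter_upwards [this] with θ h; rw [h])

lemma cf_fk {F K ψ : ℝ → ℂ} (hF : Integrable F arcM) (hK : Integrable K arcM) (hK0 : cf K 0 = 0)
    (hKc : ∀ n : ℤ, 0 < n → cf K n = cf ψ n) (hFA : Anl F) (hKA : Anl K) {r : ℝ} (h0 : 0 ≤ r) (h1 : r < 1) (n : ℕ) :
    cf (fun θ => cau F ((r:ℂ) * bpt θ) * cau K ((r:ℂ) * bpt θ)) n =
      (r:ℂ) ^ n * ∑ k ∈ Finset.range n, cf F k * cf ψ ((n:ℤ) - k) := by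
  have dF := cf_dil (cau_ser hF) h0 h1
  have dK := cf_dil (cau_ser hK) h0 h1
  rw [cf_mul_nat (memLp_dil (cau_analytic hF) h0 h1 2) (memLp_dil (cau_analytic hK) h0 h1 2)
    (fun n hn => by rw [dF, if_neg (by omega)]) (fun n hn => by rw [dK, if_neg (by omega)]),
    Finset.sum_range_succ, Finset.mul_sum]
  rw [dK, if_pos (by omega)]
  simp only [sub_self, Int.toNat_zero, Nat.cast_zero, hK0, zero_mul, mul_zero, add_zero]
  refine Finset.sum_congr rfl fun k hk => ?_
  have hk := Finset.mem_range.1 hk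
  rw [dF, dK, if_pos (by omega), if_pos (by omega), ← hKc _ (by omega)]
  have e : ((n:ℤ) - k).toNat = n - k := by omega
  rw [e, Int.toNat_natCast, Nat.cast_sub hk.le]
  have : (r:ℂ) ^ n = (r:ℂ) ^ k * (r:ℂ) ^ (n - k) := by rw [← pow_add]; congr 1; omega
  rw [this]; ring

lemma c1_key {M : Set (ℝ → ℂ)} (hM : BInv 1 M) {F ψ h K : ℝ → ℂ} (hF : F ∈ M) {C D B : ℝ} (hψ : AEStronglyMeasurable ψ arcM)
    (hC : ∀ᵐ θ ∂arcM, ‖ψ θ‖ ≤ C) (hz : ∀ G ∈ M, ∫ θ, G θ * ψ θ ∂arcM = 0)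
    (hh : AEStronglyMeasurable h arcM) (hhA : Anl h) (hD : ∀ᵐ θ ∂arcM, ‖h θ‖ ≤ D) (hB : ∀ᵐ θ ∂arcM, ‖h θ * F θ‖ ≤ B)
    (hK : MemLp K 2 arcM) (hKA : Anl K) (hK0 : cf K 0 = 0) (hKc : ∀ n : ℤ, 0 < n → cf K n = cf ψ n) :
    ∫ θ, conj (h θ) * F θ * ψ θ ∂arcM = ∫ θ, conj (h θ) * F θ * K θ ∂arcM := by
  have hFi : Integrable F arcM := (hM.lp _ hF).int le_rfl
  have hFA := hM.anl _ hF
  have hhi : Integrable h arcM := (LP.bdd zero_le_one hh hD).int le_rfl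
  have hhF : AEStronglyMeasurable (fun θ => h θ * F θ) arcM := hh.mul hFi.1
  have hhFA : Anl (fun θ => h θ * F θ) := anl_bdd_mul hh hhA hD hFi hFA
  have hhFi : Integrable (fun θ => h θ * F θ) arcM := (LP.bdd zero_le_one hhF hB).int le_rfl
  have hFψ : Integrable (fun θ => F θ * ψ θ) arcM := hFi.mul_bdd hψ hC
  have hcoef := bs_pair_zero hM hF hψ hC hz
  have r0 := fun n => (rad_mem n).1.le
  have r1 := fun n => (rad_mem n).2
  have rr0 : ∀ n, 0 ≤ rad n ^ 2 := fun n => by positivity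
  have rr1 : ∀ n, rad n ^ 2 < 1 := fun n => pow_lt_one₀ (r0 n) (r1 n) (by norm_num)
  -- equality of dilated integrals
  have heq : ∀ n, ∫ θ, cau h (((rad n ^ 2 : ℝ):ℂ) * bpt θ) * conj (F θ * ψ θ) ∂arcM =
      ∫ θ, cau h ((rad n : ℂ) * bpt θ) * conj (cau F ((rad n : ℂ) * bpt θ) * cau K ((rad n : ℂ) * bpt θ)) ∂arcM := by
    intro n
    have hfk : Integrable (fun θ => cau F ((rad n : ℂ) * bpt θ) * cau K ((rad n : ℂ) * bpt θ)) arcM :=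
      l2_mul_int (memLp_dil (cau_analytic hFi) (r0 n) (r1 n) 2) (memLp_dil (cau_analytic hK.int2) (r0 n) (r1 n) 2)
    have s1 := dil_pair hhi hFψ.conj' (rr0 n) (rr1 n)
    have s2 := dil_pair hhi hfk.conj' (r0 n) (r1 n)
    refine s1.unique ?_
    convert s2 using 2 with k
    rw [cf_conj, cf_conj, neg_neg, cf_fk hFi hK.int2 hK0 hKc hFA hKA (r0 n) (r1 n), hcoef]
    simp only [map_mul, map_pow, Complex.conj_ofReal, Complex.ofReal_pow]
    ring
  -- left limit
  have L1 : Tendsto (fun n => ∫ θ, cau h (((rad n ^ 2 : ℝ):ℂ) * bpt θ) * conj (F θ * ψ θ) ∂arcM) atTop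
      (𝓝 (∫ θ, h θ * conj (F θ * ψ θ) ∂arcM)) := by
    refine tendsto_integral_of_dominated_convergence (fun θ => D * ‖F θ * ψ θ‖) (fun n => ?_) (hFψ.norm.const_mul _) (fun n => ?_) ?_
    · exact (continuous_dil (cau_analytic hhi) (rr0 n) (rr1 n)).aestronglyMeasurable.mul hFψ.conj'.1
    · refine Eventually.of_forall fun θ => ?_
      rw [norm_mul, RCLike.norm_conj]
      gcongr
      exact dil_bdd hhi hhA hD (rr0 n) (rr1 n) θ
    · filter_upwards [fatou_cau hhi hhA] with θ hθ
      refine Tendsto.mul_const _ (hθ.comp ?_)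
      refine tendsto_nhdsWithin_iff.2 ⟨?_, Eventually.of_forall fun n => rr1 n⟩
      simpa using rad_tendsto'.pow 2
  -- right limit
  let A : ℕ → ℝ → ℂ := fun n θ => cau h ((rad n : ℂ) * bpt θ) * conj (cau F ((rad n : ℂ) * bpt θ))
  have hAb : ∀ n θ, ‖A n θ‖ ≤ B := by
    intro n θ
    have hz1 : ‖(rad n : ℂ) * bpt θ‖ < 1 := by rw [norm_r_bpt (r0 n)]; exact r1 n
    have := dil_bdd hhFi hhFA hB (r0 n) (r1 n) θ
    rw [cau_mul hh hhA hD hFi hFA hz1] at this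
    simpa [A] using this
  have hAm : ∀ n, AEStronglyMeasurable (A n) arcM := fun n =>
    ((continuous_dil (cau_analytic hhi) (r0 n) (r1 n)).mul (Complex.continuous_conj.comp (continuous_dil (cau_analytic hFi) (r0 n) (r1 n)))).aestronglyMeasurable
  have hAt : ∀ᵐ θ ∂arcM, Tendsto (fun n => A n θ) atTop (𝓝 (h θ * conj (F θ))) := by
    filter_upwards [tendsto_dil hhi hhA, tendsto_dil hFi hFA] with θ h1 h2
    exact h1.mul ((Complex.continuous_conj.tendsto _).comp h2)
  have hB0 : 0 ≤ B := (norm_nonneg _).trans (hAb 0 0)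
  have hkd : ∀ n, MemLp (fun θ => cau K ((rad n : ℂ) * bpt θ)) 2 arcM := fun n => memLp_dil (cau_analytic hK.int2) (r0 n) (r1 n) 2
  have R1 : Tendsto (fun n => ∫ θ, A n θ * conj (K θ) ∂arcM) atTop (𝓝 (∫ θ, h θ * conj (F θ) * conj (K θ) ∂arcM)) := by
    refine tendsto_integral_of_dominated_convergence (fun θ => B * ‖K θ‖) (fun n => (hAm n).mul hK.conj'.1) (hK.int2.norm.const_mul _) (fun n => ?_) ?_
    · refine Eventually.of_forall fun θ => ?_
      rw [norm_mul, RCLike.norm_conj]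
      exact mul_le_mul_of_nonneg_right (hAb n θ) (norm_nonneg _)
    · filter_upwards [hAt] with θ hθ using hθ.mul_const _
  have R2 : Tendsto (fun n => ∫ θ, A n θ * conj (cau K ((rad n : ℂ) * bpt θ) - K θ) ∂arcM) atTop (𝓝 0) := by
    have hs : Tendsto (fun n => B * Real.sqrt (∫ θ, ‖cau K ((rad n:ℂ) * bpt θ) - K θ‖ ^ 2 ∂arcM)) atTop (𝓝 0) := by
      have := ((Real.continuous_sqrt.tendsto 0).comp (l2_dil_tendsto hK hKA)).const_mul B
      simpa [Function.comp_def] using this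
    refine squeeze_zero_norm (fun n => ?_) hs
    calc ‖∫ θ, A n θ * conj (cau K ((rad n : ℂ) * bpt θ) - K θ) ∂arcM‖ ≤ ∫ θ, B * ‖cau K ((rad n : ℂ) * bpt θ) - K θ‖ ∂arcM := by
          refine norm_integral_le_of_norm_le (((hkd n).sub hK).int2.norm.const_mul B) (Eventually.of_forall fun θ => ?_)
          rw [norm_mul, RCLike.norm_conj]
          exact mul_le_mul_of_nonneg_right (hAb n θ) (norm_nonneg _)
      _ = B * ∫ θ, ‖cau K ((rad n : ℂ) * bpt θ) - K θ‖ ∂arcM := integral_const_mul _ _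
      _ ≤ _ := by
          gcongr
          exact Real.le_sqrt_of_sq_le (l2_le_sq ((hkd n).sub hK))
  have R : Tendsto (fun n => ∫ θ, cau h ((rad n : ℂ) * bpt θ) * conj (cau F ((rad n : ℂ) * bpt θ) * cau K ((rad n : ℂ) * bpt θ)) ∂arcM) atTop
      (𝓝 (∫ θ, h θ * conj (F θ) * conj (K θ) ∂arcM)) := by
    have := R1.add R2
    rw [add_zero] at this
    refine this.congr fun n => ?_
    rw [← integral_add]
    · congr 1; ext θ; simp only [A, map_mul, map_sub]; ring
    · exact hK.int2.conj'.bdd_mul (hAm n) (Eventually.of_forall (hAb n))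
    · exact ((hkd n).sub hK).int2.conj'.bdd_mul (hAm n) (Eventually.of_forall (hAb n))
  have fin := tendsto_nhds_unique (L1.congr heq) R
  have := congrArg conj fin
  rw [← integral_conj, ← integral_conj] at this
  simp only [map_mul, Complex.conj_conj] at this
  simpa [mul_assoc] using this

/-- pairing of the analytic projection with a bounded function -/
lemma proj_pair {X E ψ K : ℝ → ℂ} (hX : MemLp X 2 arcM) (hE : MemLp E 2 arcM) (hEA : Anl E)
    (hEc : ∀ n : ℤ, 0 ≤ n → cf E n = cf X n) (hψ : MemLp ψ 2 arcM)
    (hK : MemLp K 2 arcM) (hKA : Anl K) (hK0 : cf K 0 = 0) (hKc : ∀ n : ℤ, 0 < n → cf K n = cf ψ n) :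
    ∫ θ, E θ * ψ θ ∂arcM = ∫ θ, X θ * ψ θ ∂arcM - ∫ θ, X θ * K θ ∂arcM := by
  have hL : MemLp (fun θ => conj (ψ θ - K θ)) 2 arcM := (hψ.sub hK).conj'
  have hLA : Anl (fun θ => conj (ψ θ - K θ)) := by
    intro n hn
    rw [cf_conj, cf_sub hψ.int2 hK.int2, hKc _ (by omega), sub_self, map_zero]
  have h1 := l2_inner_anl hE hX hL hLA hEc
  simp only [Complex.conj_conj] at h1
  have hEK : ∫ θ, E θ * K θ ∂arcM = 0 := by
    have := cf_mul_nat hE hK hEA hKA 0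
    simp [hK0] at this
    rw [← this, cf_zero_eq]
  have e1 : ∫ θ, E θ * (ψ θ - K θ) ∂arcM = ∫ θ, E θ * ψ θ ∂arcM - ∫ θ, E θ * K θ ∂arcM := by
    rw [← integral_sub (l2_mul_int hE hψ) (l2_mul_int hE hK)]; congr 1; ext θ; ring
  have e2 : ∫ θ, X θ * (ψ θ - K θ) ∂arcM = ∫ θ, X θ * ψ θ ∂arcM - ∫ θ, X θ * K θ ∂arcM := by
    rw [← integral_sub (l2_mul_int hX hψ) (l2_mul_int hX hK)]; congr 1; ext θ; ring
  rw [e1, e2, hEK, sub_zero] at h1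
  exact h1

lemma c1 {M : Set (ℝ → ℂ)} (hM : BInv 1 M) {F h E : ℝ → ℂ} (hF : F ∈ M) {D B : ℝ} 
    (hh : AEStronglyMeasurable h arcM) (hhA : Anl h) (hD : ∀ᵐ θ ∂arcM, ‖h θ‖ ≤ D) (hB : ∀ᵐ θ ∂arcM, ‖h θ * F θ‖ ≤ B)
    (hE : MemLp E 2 arcM) (hEA : Anl E) (hEc : ∀ n : ℤ, 0 ≤ n → cf E n = cf (fun θ => conj (h θ) * F θ) n) : E ∈ M := by
  have hFi : Integrable F arcM := (hM.lp _ hF).int le_rfl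
  refine hM.closed E ((memLp2_iff.1 hE).mono_exp zero_le_one (by norm_num)) hEA ?_
  refine hb1 hM.zero hM.add hM.smul hM.ae (fun F hF => (hM.lp F hF).int le_rfl) hE.int2 ?_
  intro ψ C hψ hC hz
  have hψ2 : MemLp ψ 2 arcM := memLp2_iff.2 (LP.bdd (by norm_num) hψ hC)
  obtain ⟨K, hK, hKA, hK0, hKc⟩ := strict_part hψ2
  have hX : MemLp (fun θ => conj (h θ) * F θ) 2 arcM := memLp2_iff.2 (LP.bdd (by norm_num)
    ((Complex.continuous_conj.comp_aestronglyMeasurable hh).mul hFi.1) (C := B) (by simpa using hB))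
  rw [proj_pair hX hE hEA hEc hψ2 hK hKA hK0 hKc, c1_key hM hF hψ hC hz hh hhA hD hB hK hKA hK0 hKc, sub_self]

/-- holomorphic function on the strip with bounded imaginary part and large real part -/
def stripS (w : ℂ) : ℂ := (4 - w ^ 2) ^ (1/2 : ℂ)

lemma stripS_pos {w : ℂ} (hw : |w.re| < 1) : 0 < (4 - w ^ 2).re := by
  obtain ⟨h1, h2⟩ := abs_lt.1 hw
  have : (4 - w ^ 2).re = 4 - w.re ^ 2 + w.im ^ 2 := by
    simp [sq]; ring
  rw [this]; nlinarith [sq_nonneg w.im]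

lemma stripS_sq {w : ℂ} : stripS w ^ 2 = 4 - w ^ 2 := by
  unfold stripS
  rw [← Complex.cpow_nat_mul]; simp

lemma stripS_re {w : ℂ} (hw : |w.re| < 1) : 0 < (stripS w).re := by
  have h := stripS_pos hw
  have hne : (4 - w ^ 2) ≠ 0 := fun h0 => by rw [h0] at h; simp at h
  unfold stripS
  rw [Complex.cpow_def_of_ne_zero hne, Complex.exp_re]
  apply mul_pos (Real.exp_pos _)
  have e : (Complex.log (4 - w ^ 2) * (1/2:ℂ)).im = (4 - w ^ 2).arg / 2 := by
    have : (1/2:ℂ) = ((1/2:ℝ):ℂ) := by norm_num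
    rw [this, Complex.im_mul_ofReal, Complex.log_im]; ring
  rw [e]
  apply Real.cos_pos_of_mem_Ioo
  have h1 := Complex.neg_pi_lt_arg (4 - w ^ 2)
  have h2 := Complex.abs_arg_lt_pi_div_two_iff.2 (Or.inl h)
  obtain ⟨h3, h4⟩ := abs_lt.1 h2
  constructor <;> linarith [Real.pi_pos]

lemma stripS_bounds {w : ℂ} (hw : |w.re| < 1) : |w.im| ≤ (stripS w).re ∧ |(stripS w).im| ≤ 1 := by
  have h0 := stripS_re hw
  have hs := stripS_sq (w := w)
  set s := stripS w
  have hre : s.re ^ 2 - s.im ^ 2 = 4 - w.re ^ 2 + w.im ^ 2 := by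
    have := congrArg Complex.re hs
    simp [sq] at this; nlinarith
  have him : s.re * s.im = - (w.re * w.im) := by
    have := congrArg Complex.im hs
    simp [sq] at this; nlinarith
  obtain ⟨h1, h2⟩ := abs_lt.1 hw
  have hy : |w.im| ≤ s.re := by
    apply abs_le_of_sq_le_sq _ h0.le
    nlinarith [sq_nonneg s.im]
  refine ⟨hy, ?_⟩
  have h3 : s.re * |s.im| = |w.re| * |w.im| := by
    have := congrArg abs him
    rw [abs_mul, abs_neg, abs_mul, abs_of_pos h0] at this; exact this
  by_contra hc
  push Not at hc
  have : |w.re| * |w.im| ≤ 1 * s.re := mul_le_mul hw.le hy (abs_nonneg _) zero_le_one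
  nlinarith

lemma stripS_diff : DifferentiableOn ℂ stripS {w | |w.re| < 1} := by
  intro w hw
  apply DifferentiableAt.differentiableWithinAt
  unfold stripS
  apply DifferentiableAt.cpow_const
  · fun_prop
  · exact Or.inl (stripS_pos hw)

/-- the multiplier symbols -/
def sH (m : ℕ) (w : ℂ) : ℂ := (1 + stripS w / ((m:ℂ) + 1))⁻¹

lemma sH_ne {w : ℂ} (hw : |w.re| < 1) (m : ℕ) : 1 + stripS w / ((m:ℂ) + 1) ≠ 0 := by
  intro h
  have := half_ne (w := stripS w) (by linarith [stripS_re hw]) m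
  rw [h, norm_zero] at this; norm_num at this

lemma sH_bounds {w : ℂ} (hw : |w.re| < 1) (m : ℕ) : ‖sH m w‖ ≤ 1 ∧ ‖sH m w‖ * |w.im| ≤ (m:ℝ) + 1 ∧
    ‖conj (sH m w) - sH m w‖ * ((m:ℝ) + 1) ≤ 2 * ‖sH m w‖ := by
  have h0 := stripS_re hw
  obtain ⟨hy, hi⟩ := stripS_bounds hw
  have h1 := one_le_of_re (w := stripS w) m
  have hne := sH_ne hw m
  have hm : (0:ℝ) < (m:ℝ) + 1 := by positivity
  unfold sH
  set s := stripS w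
  set D := 1 + s / ((m:ℂ) + 1) with hD
  have h2 : 0 ≤ s.re / ((m:ℝ) + 1) := by positivity
  have hDp : 0 < ‖D‖ := norm_pos_iff.2 hne
  have hb : ‖D⁻¹‖ ≤ 1 := by rw [norm_inv]; exact inv_le_one_of_one_le₀ (by linarith)
  refine ⟨hb, ?_, ?_⟩
  · rw [norm_inv, inv_mul_le_iff₀ hDp]
    have : s.re ≤ ‖D‖ * ((m:ℝ)+1) := by
      rw [← div_le_iff₀ hm]; linarith
    linarith
  · have e : conj D⁻¹ - D⁻¹ = (s - conj s) / ((m:ℂ)+1) * (D⁻¹ * conj D⁻¹) := by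
      have hne' : conj D ≠ 0 := (_root_.map_ne_zero _).2 hne
      have : conj D = 1 + conj s / ((m:ℂ) + 1) := by rw [hD]; simp
      have h4 : D - conj D = (s - conj s) / ((m:ℂ)+1) := by rw [this, hD]; ring
      rw [← h4, map_inv₀]
      field_simp
    have h5 : ‖s - conj s‖ ≤ 2 := by
      have : s - conj s = ((2 * s.im : ℝ) : ℂ) * I := by rw [Complex.sub_conj]; 
      rw [this, norm_mul, Complex.norm_real, Complex.norm_I, mul_one, Real.norm_eq_abs, abs_mul]
      norm_num; linarith
    have h6 : ‖((m:ℂ)+1)‖ = (m:ℝ)+1 := by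
      have : ((m:ℂ) + 1) = (((m:ℝ) + 1 : ℝ) : ℂ) := by push_cast; rfl
      rw [this, Complex.norm_real, Real.norm_of_nonneg hm.le]
    rw [e, norm_mul, norm_div, h6, norm_mul, RCLike.norm_conj]
    have h7 : ‖s - conj s‖ / ((m:ℝ)+1) * (‖D⁻¹‖ * ‖D⁻¹‖) * ((m:ℝ)+1) = ‖s - conj s‖ * (‖D⁻¹‖ * ‖D⁻¹‖) := by field_simp
    rw [h7]
    have h8 := norm_nonneg D⁻¹
    calc ‖s - conj s‖ * (‖D⁻¹‖ * ‖D⁻¹‖) ≤ 2 * (‖D⁻¹‖ * 1) := by gcongr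
      _ = _ := by ring

lemma sH_comp {u : ℝ → ℝ} (hm : AEStronglyMeasurable u arcM) {c : ℝ} (hc : c < 1) (hu : ∀ᵐ θ ∂arcM, |u θ| ≤ c) {V : ℝ → ℂ} (hV : MemLp V 2 arcM) (hA : Anl V)
    (hre : ∀ᵐ θ ∂arcM, (V θ).re = u θ) (hcau : ∀ z, ‖z‖ < 1 → (cau V z).re = ∫ t, u t * pk z t ∂arcM) (m : ℕ) :
    AEStronglyMeasurable (fun θ => sH m (V θ)) arcM ∧ Anl (fun θ => sH m (V θ)) := by
  have hui : Integrable u arcM := Integrable.of_bound hm c (by simpa using hu)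
  have key := anl_comp hV.int2 hA (Φ := sH m) (U := {w | |w.re| < 1}) (C := 1)
    (isOpen_lt (by fun_prop) continuous_const) ?_ (fun w hw => (sH_bounds hw m).1) ?_ ?_
  · exact ⟨key.1, key.2.2.1⟩
  · intro w hw
    unfold sH
    exact ((((stripS_diff w hw)).div_const _).const_add 1).inv (sH_ne hw m)
  · intro z hz
    show |(cau V z).re| < 1
    have h1 := re_cau_ge (c := -c) hui (by filter_upwards [hu] with θ h using (abs_le.1 h).1) hz
    have h2 := re_cau_ge (u := fun θ => - u θ) (c := -c) hui.neg (by filter_upwards [hu] with θ h using neg_le_neg (abs_le.1 h).2) hz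
    simp only [neg_mul, integral_neg] at h2
    rw [hcau z hz, abs_lt]
    constructor <;> linarith
  · filter_upwards [hre, hu] with θ h1 h2
    show |(V θ).re| < 1
    rw [h1]; linarith

lemma sH_tendsto (w : ℂ) : Tendsto (fun m => sH m w) atTop (𝓝 1) := by
  have := (tendsto_one_add_div (stripS w)).inv₀ one_ne_zero
  simpa [sH] using this

lemma sH_prod {a b N y1 y2 : ℝ} {H1 H2 : ℂ} (hN : 1 ≤ N) (ha : ‖H1‖ ≤ 1) (hb : ‖H2‖ ≤ 1) (h1 : ‖H1‖ * y1 ≤ N) (h2 : ‖H2‖ * y2 ≤ N)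
    (hy1 : 0 ≤ y1) (hy2 : 0 ≤ y2)
    (k1 : ‖conj H1 - H1‖ * N ≤ 2 * ‖H1‖) (k2 : ‖conj H2 - H2‖ * N ≤ 2 * ‖H2‖) :
    ‖H1 * H2‖ * (1 + y1 + y2) ≤ 3 * N ∧ ‖conj (H1 * H2) - H1 * H2‖ * (1 + y1 + y2) ≤ 12 := by
  have n1 := norm_nonneg H1
  have n2 := norm_nonneg H2
  have hA : ‖H1 * H2‖ * (1 + y1 + y2) ≤ 3 * N := by
    rw [norm_mul]
    have e1 : ‖H1‖ * ‖H2‖ * y1 ≤ N := by nlinarith [mul_nonneg n1 hy1]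
    have e2 : ‖H1‖ * ‖H2‖ * y2 ≤ N := by nlinarith [mul_nonneg n2 hy2]
    have e3 : ‖H1‖ * ‖H2‖ ≤ 1 := mul_le_one₀ ha n2 hb
    nlinarith
  refine ⟨hA, ?_⟩
  have e : conj (H1 * H2) - H1 * H2 = (conj H1 - H1) * conj H2 + H1 * (conj H2 - H2) := by rw [map_mul]; ring
  have hk : ‖conj (H1 * H2) - H1 * H2‖ * N ≤ 4 * ‖H1 * H2‖ := by
    rw [e]
    have := norm_add_le ((conj H1 - H1) * conj H2) (H1 * (conj H2 - H2))
    rw [norm_mul, norm_mul, RCLike.norm_conj] at this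
    rw [norm_mul]
    have f1 := mul_le_mul_of_nonneg_right k1 n2
    have f2 := mul_le_mul_of_nonneg_left k2 n1
    nlinarith
  set X := ‖conj (H1 * H2) - H1 * H2‖
  have f3 := mul_le_mul_of_nonneg_right hk (show 0 ≤ 1 + y1 + y2 by positivity)
  have : X * (1 + y1 + y2) * N ≤ 12 * N := by nlinarith
  exact le_of_mul_le_mul_right this (by linarith)

lemma hmult {b K : ℝ → ℂ} {B : ℝ} (hb : AEStronglyMeasurable b arcM) (hB : ∀ᵐ θ ∂arcM, ‖b θ‖ ≤ B)
    (hK : MemLp K 2 arcM) (hKA : Anl K) (hK0 : cf K 0 = 0) (hKc : ∀ n : ℤ, 0 < n → cf K n = cf b n) :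
    ∃ H : ℕ → ℝ → ℂ, ∃ C : ℝ, (∀ n, AEStronglyMeasurable (H n) arcM) ∧ (∀ n, Anl (H n)) ∧ (∀ n, ∀ᵐ θ ∂arcM, ‖H n θ‖ ≤ 1) ∧
      (∀ n, ∃ D : ℝ, ∀ᵐ θ ∂arcM, ‖H n θ * K θ‖ ≤ D) ∧ (∀ n, ∀ᵐ θ ∂arcM, ‖(conj (H n θ) - H n θ) * K θ‖ ≤ C) ∧
      ∀ᵐ θ ∂arcM, Tendsto (fun n => H n θ) atTop (𝓝 1) := by
  have hB0 : 0 ≤ B := by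
    obtain ⟨θ, h⟩ := hB.exists
    exact (norm_nonneg _).trans h
  have hbi : Integrable b arcM := (LP.bdd zero_le_one hb hB).int le_rfl
  set c : ℝ := (1 + B)⁻¹ with hc
  have hcp : 0 < c := by positivity
  have hcB : c * B < 1 := by rw [hc, inv_mul_lt_iff₀ (by positivity)]; linarith
  let u1 : ℝ → ℝ := fun θ => c * (b θ).re
  let u2 : ℝ → ℝ := fun θ => c * (b θ).im
  have hm1 : AEStronglyMeasurable u1 arcM := (Complex.continuous_re.comp_aestronglyMeasurable hb).const_mul c
  have hm2 : AEStronglyMeasurable u2 arcM := (Complex.continuous_im.comp_aestronglyMeasurable hb).const_mul c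
  have hb1 : ∀ᵐ θ ∂arcM, |u1 θ| ≤ c * B := by
    filter_upwards [hB] with θ h
    rw [abs_mul, abs_of_pos hcp]; gcongr; exact (Complex.abs_re_le_norm _).trans h
  have hb2 : ∀ᵐ θ ∂arcM, |u2 θ| ≤ c * B := by
    filter_upwards [hB] with θ h
    rw [abs_mul, abs_of_pos hcp]; gcongr; exact (Complex.abs_im_le_norm _).trans h
  obtain ⟨V1, hV1, hA1, hre1, hcau1, -, hz1, hn1⟩ := schwarz (u := u1) (MemLp.of_bound hm1 (c * B) (by simpa using hb1))
  obtain ⟨V2, hV2, hA2, hre2, hcau2, -, hz2, hn2⟩ := schwarz (u := u2) (MemLp.of_bound hm2 (c * B) (by simpa using hb2))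
  have hi1 : Integrable (fun θ => (u1 θ : ℂ)) arcM := (Integrable.of_bound hm1 (c*B) (by simpa using hb1)).ofReal
  have hi2 : Integrable (fun θ => (u2 θ : ℂ)) arcM := (Integrable.of_bound hm2 (c*B) (by simpa using hb2)).ofReal
  have hbc : ∀ n, (c:ℂ) * cf b n = cf (fun θ => (u1 θ : ℂ)) n + I * cf (fun θ => (u2 θ : ℂ)) n := by
    intro n
    rw [← cf_smul, ← cf_smul, ← cf_add hi1 (hi2.const_mul I)]
    congr 1; ext θ
    simp only [u1, u2]
    conv_lhs => rw [← Complex.re_add_im (b θ)]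
    push_cast; ring
  have hKe : ∀ᵐ θ ∂arcM, (2 * c : ℂ) * K θ = V1 θ + I * V2 θ - c * cf b 0 := by
    have hVi := hV1.int2.add (hV2.int2.const_mul I)
    apply ae_eq_of_cf (hK.int2.const_mul (2 * c:ℂ)) (hVi.sub (integrable_const _))
    intro n
    have e := cf_sub hVi (integrable_const ((c:ℂ) * cf b 0)) n
    have e2 := cf_add hV1.int2 (hV2.int2.const_mul I) n
    rw [cf_smul]
    refine Eq.trans ?_ e.symm
    rw [cf_const]
    refine Eq.trans ?_ (congrArg (· - _) e2.symm)
    rw [cf_smul]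
    rcases lt_trichotomy n 0 with h | h | h
    · rw [hKA n h, hA1 n h, hA2 n h, if_neg h.ne]; ring
    · subst h
      have a1 : cf V1 0 = cf (fun θ => (u1 θ : ℂ)) 0 := by rw [hz1, cf_zero_eq, integral_complex_ofReal]
      have a2 : cf V2 0 = cf (fun θ => (u2 θ : ℂ)) 0 := by rw [hz2, cf_zero_eq, integral_complex_ofReal]
      rw [hK0, if_pos rfl, hbc, a1, a2]; ring
    · rw [hKc n h, hn1 n h, hn2 n h, if_neg h.ne']
      linear_combination 2 * hbc n
  -- pointwise bound of K
  have hKb : ∃ D : ℝ, 0 ≤ D ∧ ∀ᵐ θ ∂arcM, ‖K θ‖ ≤ D * (1 + |(V1 θ).im| + |(V2 θ).im|) := by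
    refine ⟨(2 * c)⁻¹ * (2 + ‖(c:ℂ) * cf b 0‖), by positivity, ?_⟩
    filter_upwards [hKe, hre1, hre2, hb1, hb2] with θ h r1 r2 x1 x2
    have n1 : ‖V1 θ‖ ≤ 1 + |(V1 θ).im| := by
      refine (Complex.norm_le_abs_re_add_abs_im _).trans ?_
      rw [r1]; linarith
    have n2 : ‖V2 θ‖ ≤ 1 + |(V2 θ).im| := by
      refine (Complex.norm_le_abs_re_add_abs_im _).trans ?_
      rw [r2]; linarith
    have n3 : ‖(2 * c : ℂ) * K θ‖ ≤ ‖V1 θ‖ + ‖V2 θ‖ + ‖(c:ℂ) * cf b 0‖ := by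
      rw [h]
      refine (norm_sub_le _ _).trans ?_
      gcongr
      refine (norm_add_le _ _).trans ?_
      simp
    rw [norm_mul] at n3
    have n4 : ‖(2 * c : ℂ)‖ = 2 * c := by
      rw [norm_mul, Complex.norm_real, Real.norm_of_nonneg hcp.le]; simp
    rw [n4] at n3
    rw [mul_assoc, inv_mul_eq_div, le_div_iff₀ (by positivity)]
    have := norm_nonneg ((c:ℂ) * cf b 0)
    have a1 := abs_nonneg (V1 θ).im
    have a2 := abs_nonneg (V2 θ).im
    nlinarith
  obtain ⟨D, hD0, hD⟩ := hKb
  have k1 := sH_comp hm1 hcB hb1 hV1 hA1 hre1 hcau1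
  have k2 := sH_comp hm2 hcB hb2 hV2 hA2 hre2 hcau2
  have s1 : ∀ᵐ θ ∂arcM, |(V1 θ).re| < 1 := by filter_upwards [hre1, hb1] with θ h h'; rw [h]; linarith
  have s2 : ∀ᵐ θ ∂arcM, |(V2 θ).re| < 1 := by filter_upwards [hre2, hb2] with θ h h'; rw [h]; linarith
  have prodb : ∀ n : ℕ, ∀ᵐ θ ∂arcM, ‖sH n (V1 θ) * sH n (V2 θ)‖ * (1 + |(V1 θ).im| + |(V2 θ).im|) ≤ 3 * ((n:ℝ)+1) ∧
     ‖conj (sH n (V1 θ) * sH n (V2 θ)) - sH n (V1 θ) * sH n (V2 θ)‖ * (1 + |(V1 θ).im| + |(V2 θ).im|) ≤ 12 := by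
    intro n
    filter_upwards [s1, s2] with θ h1 h2
    obtain ⟨a1, a2, a3⟩ := sH_bounds h1 n
    obtain ⟨c1, c2, c3⟩ := sH_bounds h2 n
    exact sH_prod (a := 0) (b := 0) (by linarith [(Nat.cast_nonneg n : (0:ℝ) ≤ n)]) a1 c1 a2 c2 (abs_nonneg _) (abs_nonneg _) a3 c3
  refine ⟨fun n θ => sH n (V1 θ) * sH n (V2 θ), 12 * D, fun n => (k1 n).1.mul (k2 n).1, fun n => ?_, fun n => ?_, fun n => ⟨3 * ((n:ℝ)+1) * D, ?_⟩, fun n => ?_, ?_⟩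
  · have bd : ∀ᵐ θ ∂arcM, ‖sH n (V2 θ)‖ ≤ 1 := by filter_upwards [s2] with θ h using (sH_bounds h n).1
    exact anl_bdd_mul (k1 n).1 (k1 n).2 (C := 1) (by filter_upwards [s1] with θ h using (sH_bounds h n).1)
      ((LP.bdd zero_le_one (k2 n).1 bd).int le_rfl) (k2 n).2
  · filter_upwards [s1, s2] with θ h1 h2
    rw [norm_mul]; exact mul_le_one₀ (sH_bounds h1 n).1 (norm_nonneg _) (sH_bounds h2 n).1
  · filter_upwards [prodb n, hD] with θ h1 h2
    rw [norm_mul]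
    calc _ ≤ ‖sH n (V1 θ) * sH n (V2 θ)‖ * (D * (1 + |(V1 θ).im| + |(V2 θ).im|)) := by gcongr
      _ = ‖sH n (V1 θ) * sH n (V2 θ)‖ * (1 + |(V1 θ).im| + |(V2 θ).im|) * D := by ring
      _ ≤ _ := mul_le_mul_of_nonneg_right h1.1 hD0
  · filter_upwards [prodb n, hD] with θ h1 h2
    rw [norm_mul]
    calc _ ≤ ‖conj (sH n (V1 θ) * sH n (V2 θ)) - sH n (V1 θ) * sH n (V2 θ)‖ * (D * (1 + |(V1 θ).im| + |(V2 θ).im|)) := by gcongr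
      _ = ‖conj (sH n (V1 θ) * sH n (V2 θ)) - sH n (V1 θ) * sH n (V2 θ)‖ * (1 + |(V1 θ).im| + |(V2 θ).im|) * D := by ring
      _ ≤ _ := mul_le_mul_of_nonneg_right h1.2 hD0
  · refine Eventually.of_forall fun θ => ?_
    simpa using (sH_tendsto (V1 θ)).mul (sH_tendsto (V2 θ))

lemma c2_step {M : Set (ℝ → ℂ)} (hM : BInv 1 M) {F ψ h K : ℝ → ℂ} (hF : F ∈ M) {C D B : ℝ} (hψ : AEStronglyMeasurable ψ arcM)
    (hC : ∀ᵐ θ ∂arcM, ‖ψ θ‖ ≤ C) (hz : ∀ G ∈ M, MemLp G 2 arcM → ∫ θ, G θ * ψ θ ∂arcM = 0)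
    (hh : AEStronglyMeasurable h arcM) (hhA : Anl h) (hD : ∀ᵐ θ ∂arcM, ‖h θ‖ ≤ D) (hB : ∀ᵐ θ ∂arcM, ‖h θ * F θ‖ ≤ B)
    (hK : MemLp K 2 arcM) (hKA : Anl K) (hK0 : cf K 0 = 0) (hKc : ∀ n : ℤ, 0 < n → cf K n = cf ψ n) :
    ∫ θ, conj (h θ) * F θ * ψ θ ∂arcM = ∫ θ, (conj (h θ) - h θ) * F θ * K θ ∂arcM := by
  have hFi := (hM.lp F hF).int le_rfl
  have hFA := hM.anl F hF
  have hX : MemLp (fun θ => conj (h θ) * F θ) 2 arcM := by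
    refine MemLp.of_bound ((continuous_conj.comp_aestronglyMeasurable hh).mul hFi.1) B ?_
    filter_upwards [hB] with θ h1
    simpa [norm_mul] using h1
  have hY : MemLp (fun θ => h θ * F θ) 2 arcM := MemLp.of_bound (hh.mul hFi.1) B hB
  have hψ2 : MemLp ψ 2 arcM := MemLp.of_bound hψ C hC
  obtain ⟨P, hP, hPA, hPc⟩ := l2_proj hX
  have hPM : P ∈ M := c1 hM hF hh hhA hD hB hP hPA hPc
  have e1 := proj_pair hX hP hPA hPc hψ2 hK hKA hK0 hKc
  rw [hz P hPM hP] at e1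
  have hYA : Anl (fun θ => h θ * F θ) := anl_bdd_mul hh hhA hD hFi hFA
  have e2 : ∫ θ, h θ * F θ * K θ ∂arcM = 0 := by
    have := cf_mul_nat hY hK hYA hKA 0
    simp only [zero_add, Finset.range_one, Finset.sum_singleton, Nat.cast_zero, sub_zero, hK0, mul_zero] at this
    rw [← cf_zero_eq]; exact this
  have e3 : ∫ θ, (conj (h θ) - h θ) * F θ * K θ ∂arcM =
      ∫ θ, conj (h θ) * F θ * K θ ∂arcM - ∫ θ, h θ * F θ * K θ ∂arcM := by
    rw [← integral_sub (l2_mul_int hX hK) (l2_mul_int hY hK)]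
    congr 1; ext θ; ring
  rw [e3, e2, sub_zero]
  linear_combination -e1

lemma cdense1 {M : Set (ℝ → ℂ)} (hM : BInv 1 M) {F : ℝ → ℂ} (hF : F ∈ M) :
    ∀ ε > (0:ℝ), ∃ G ∈ M, MemLp G 2 arcM ∧ ∫ θ, ‖F θ - G θ‖ ^ (1:ℝ) ∂arcM < ε := by
  have hFi := (hM.lp F hF).int le_rfl
  have hFA := hM.anl F hF
  have key := hb1 (S := {G | G ∈ M ∧ MemLp G 2 arcM}) (F := F) ⟨hM.zero, memLp_const 0⟩
    (fun F hF G hG => ⟨hM.add F hF.1 G hG.1, hF.2.add hG.2⟩)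
    (fun c F hF => ⟨hM.smul c F hF.1, hF.2.const_mul c⟩)
    (fun F hF G h => ⟨hM.ae F hF.1 G h, (memLp_congr_ae h).1 hF.2⟩)
    (fun F hF => hF.2.int2) hFi ?_
  · intro ε hε
    obtain ⟨G, hG, h⟩ := key ε hε
    exact ⟨G, hG.1, hG.2, h⟩
  intro ψ C hψ hC hz
  have hψ2 : MemLp ψ 2 arcM := MemLp.of_bound hψ C hC
  obtain ⟨K, hK, hKA, hK0, hKc⟩ := strict_part hψ2
  obtain ⟨H, B, hHm, hHA, hH1, hHD, hHB, hHt⟩ := hmult hψ hC hK hKA hK0 hKc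
  obtain ⟨E, hEm, hEA, hE1, hEF, hEt⟩ := emult hFi
  have s1 : ∀ n m, ∫ θ, conj (H n θ * E m θ) * F θ * ψ θ ∂arcM =
      ∫ θ, (conj (H n θ * E m θ) - H n θ * E m θ) * F θ * K θ ∂arcM := by
    intro n m
    obtain ⟨B', hB'⟩ := hEF m
    refine c2_step (h := fun θ => H n θ * E m θ) (D := 1) (B := B') hM hF hψ hC (fun G h1 h2 => hz G ⟨h1, h2⟩) ((hHm n).mul (hEm m))
      (anl_bdd_mul (hHm n) (hHA n) (hH1 n) ((MemLp.of_bound (hEm m) 1 (hE1 m) : MemLp _ 2 arcM).int2) (hEA m)) ?_ ?_ hK hKA hK0 hKc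
    · filter_upwards [hH1 n, hE1 m] with θ h1 h2
      rw [norm_mul]; nlinarith [norm_nonneg (H n θ), norm_nonneg (E m θ)]
    · filter_upwards [hH1 n, hB'] with θ h1 h2
      rw [mul_assoc, norm_mul]; nlinarith [norm_nonneg (H n θ), norm_nonneg (E m θ * F θ)]
  have hcm : ∀ {f : ℝ → ℂ}, AEStronglyMeasurable f arcM → AEStronglyMeasurable (fun θ => conj (f θ)) arcM :=
    fun h => continuous_conj.comp_aestronglyMeasurable h
  have s2 : ∀ n, ∫ θ, conj (H n θ) * F θ * ψ θ ∂arcM = ∫ θ, (conj (H n θ) - H n θ) * F θ * K θ ∂arcM := by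
    intro n
    obtain ⟨D, hD⟩ := hHD n
    have t1 : Tendsto (fun m => ∫ θ, conj (H n θ * E m θ) * F θ * ψ θ ∂arcM) atTop (𝓝 (∫ θ, conj (H n θ) * F θ * ψ θ ∂arcM)) := by
      refine tendsto_integral_of_dominated_convergence (fun θ => |C| * ‖F θ‖) (fun m => ?_) (hFi.norm.const_mul _) (fun m => ?_) ?_
      · exact ((hcm ((hHm n).mul (hEm m))).mul hFi.1).mul hψ
      · filter_upwards [hH1 n, hE1 m, hC] with θ h1 h2 h3
        have h4 : ‖H n θ * E m θ‖ ≤ 1 := by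
          rw [norm_mul]; nlinarith [norm_nonneg (H n θ), norm_nonneg (E m θ)]
        rw [norm_mul, norm_mul, RCLike.norm_conj]
        have h5 : ‖H n θ * E m θ‖ * ‖F θ‖ ≤ ‖F θ‖ := mul_le_of_le_one_left (norm_nonneg _) h4
        have h6 := h3.trans (le_abs_self C)
        rw [mul_comm |C|]
        exact mul_le_mul h5 h6 (norm_nonneg _) (norm_nonneg _)
      · filter_upwards [hEt] with θ h1
        have : Tendsto (fun m => conj (H n θ * E m θ) * F θ * ψ θ) atTop (𝓝 (conj (H n θ * 1) * F θ * ψ θ)) :=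
          ((((continuous_conj.tendsto _).comp (h1.const_mul (H n θ)))).mul_const _).mul_const _
        simpa using this
    have t2 : Tendsto (fun m => ∫ θ, (conj (H n θ * E m θ) - H n θ * E m θ) * F θ * K θ ∂arcM) atTop (𝓝 (∫ θ, (conj (H n θ) - H n θ) * F θ * K θ ∂arcM)) := by
      refine tendsto_integral_of_dominated_convergence (fun θ => 2 * D * ‖F θ‖) (fun m => ?_) (hFi.norm.const_mul _) (fun m => ?_) ?_
      · exact (((hcm ((hHm n).mul (hEm m))).sub ((hHm n).mul (hEm m))).mul hFi.1).mul hK.1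
      · filter_upwards [hE1 m, hD] with θ h2 h3
        have h4 : ‖conj (H n θ * E m θ) - H n θ * E m θ‖ ≤ 2 * ‖H n θ‖ := by
          refine (norm_sub_le _ _).trans ?_
          rw [RCLike.norm_conj, norm_mul]; nlinarith [norm_nonneg (H n θ), norm_nonneg (E m θ)]
        rw [norm_mul, norm_mul]
        rw [norm_mul] at h3
        calc _ ≤ 2 * ‖H n θ‖ * ‖F θ‖ * ‖K θ‖ := by gcongr
          _ = 2 * (‖H n θ‖ * ‖K θ‖) * ‖F θ‖ := by ring
          _ ≤ _ := by gcongr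
      · filter_upwards [hEt] with θ h1
        have : Tendsto (fun m => (conj (H n θ * E m θ) - H n θ * E m θ) * F θ * K θ) atTop (𝓝 ((conj (H n θ * 1) - H n θ * 1) * F θ * K θ)) :=
          ((((continuous_conj.tendsto _).comp (h1.const_mul (H n θ))).sub (h1.const_mul (H n θ))).mul_const _).mul_const _
        simpa using this
    refine tendsto_nhds_unique t1 ?_
    simp_rw [s1 n]
    exact t2
  have t1 : Tendsto (fun n => ∫ θ, conj (H n θ) * F θ * ψ θ ∂arcM) atTop (𝓝 (∫ θ, F θ * ψ θ ∂arcM)) := by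
    refine tendsto_integral_of_dominated_convergence (fun θ => |C| * ‖F θ‖) (fun m => ?_) (hFi.norm.const_mul _) (fun n => ?_) ?_
    · exact ((hcm (hHm m)).mul hFi.1).mul hψ
    · filter_upwards [hH1 n, hC] with θ h4 h3
      rw [norm_mul, norm_mul, RCLike.norm_conj]
      have h5 : ‖H n θ‖ * ‖F θ‖ ≤ ‖F θ‖ := mul_le_of_le_one_left (norm_nonneg _) h4
      have h6 := h3.trans (le_abs_self C)
      rw [mul_comm |C|]
      exact mul_le_mul h5 h6 (norm_nonneg _) (norm_nonneg _)
    · filter_upwards [hHt] with θ h1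
      have : Tendsto (fun n => conj (H n θ) * F θ * ψ θ) atTop (𝓝 (conj 1 * F θ * ψ θ)) :=
          ((((continuous_conj.tendsto _).comp h1)).mul_const _).mul_const _
      simpa using this
  have t2 : Tendsto (fun n => ∫ θ, (conj (H n θ) - H n θ) * F θ * K θ ∂arcM) atTop (𝓝 (∫ θ, (0:ℂ) ∂arcM)) := by
    refine tendsto_integral_of_dominated_convergence (fun θ => B * ‖F θ‖) (fun m => ?_) (hFi.norm.const_mul _) (fun n => ?_) ?_
    · exact (((hcm (hHm m)).sub (hHm m)).mul hFi.1).mul hK.1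
    · filter_upwards [hHB n] with θ h3
      rw [norm_mul] at h3
      rw [norm_mul, norm_mul]
      calc _ = (‖conj (H n θ) - H n θ‖ * ‖K θ‖) * ‖F θ‖ := by ring
        _ ≤ _ := by gcongr
    · filter_upwards [hHt] with θ h1
      have : Tendsto (fun n => (conj (H n θ) - H n θ) * F θ * K θ) atTop (𝓝 ((conj 1 - 1) * F θ * K θ)) :=
          ((((continuous_conj.tendsto _).comp h1).sub h1).mul_const _).mul_const _
      simpa using this
  rw [integral_zero] at t2
  refine tendsto_nhds_unique t1 ?_
  simp_rw [s2]
  exact t2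

lemma sdense {p : ℝ} {M : Set (ℝ → ℂ)} (hp : 1 ≤ p) (hM : BInv p M) {F : ℝ → ℂ} (hF : F ∈ M) :
    ∀ ε > (0:ℝ), ∃ G ∈ M, MemLp G 2 arcM ∧ ∫ θ, ‖F θ - G θ‖ ^ p ∂arcM < ε := by
  rcases hp.eq_or_lt with h | h
  · subst h; exact cdense1 hM hF
  · intro ε hε
    obtain ⟨G, h1, h2, h3⟩ := cdense h hM hF
    obtain ⟨n, hn⟩ := (h3.eventually (gt_mem_nhds hε)).exists
    exact ⟨G n, h1 n, h2 n, hn⟩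

lemma sclos {p : ℝ} {M : Set (ℝ → ℂ)} (hp : 1 ≤ p) (hM : BInv p M) {F : ℝ → ℂ} (hF : LP p F) (hA : Anl F) (hF2 : MemLp F 2 arcM)
    (h : ∀ ε > (0:ℝ), ∃ G ∈ M, MemLp G 2 arcM ∧ ∫ θ, ‖F θ - G θ‖ ^ 2 ∂arcM < ε) : F ∈ M := by
  rcases hp.eq_or_lt with h' | h'
  · subst h'; exact ddense1 hM hA hF2 h
  · exact ddense h' hM hF hA hF2 h

lemma LP.bs {p : ℝ} (hp : 0 ≤ p) {F : ℝ → ℂ} (hF : LP p F) : LP p (bs F) :=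
  (hF.sub hp (LP.bdd hp aestronglyMeasurable_const (C := ‖cf F 0‖) (by simp))).bpt_mul (-1)

lemma full_binv {p : ℝ} (hp : 1 ≤ p) : BInv p {F | LP p F ∧ Anl F} := by
  have hp0 : 0 ≤ p := by linarith
  refine ⟨fun F h => h.1, fun F h => h.2, ⟨LP.bdd hp0 aestronglyMeasurable_const (C := 0) (by simp), anl_const 0⟩,
    fun F hF G hG => ⟨hF.1.add hp0 hG.1, anl_add (hF.1.int hp) (hG.1.int hp) hF.2 hG.2⟩,
    fun c F hF => ⟨hF.1.smul hp0 c, anl_smul hF.2 c⟩,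
    fun F hF G h => ⟨hF.1.congr h, anl_congr hF.2 h⟩,
    fun F h1 h2 _ => ⟨h1, h2⟩, fun F hF => ⟨hF.1.bs hp0, bs_anl (hF.1.int hp) hF.2⟩⟩

lemma l1_le_lp {p : ℝ} (hp : 1 ≤ p) {F : ℝ → ℂ} (hF : LP p F) :
    (∫ θ, ‖F θ‖ ∂arcM) ^ p ≤ ∫ θ, ‖F θ‖ ^ p ∂arcM := by
  have := rpow_pois_le (hF.int hp).norm (fun t => norm_nonneg _) hp hF.2 (z := 0) (by simp)
  simpa [pk_zero] using this

def KT (p : ℝ) (Θ : ℝ → ℂ) : Set (ℝ → ℂ) :=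
  {F | LP p F ∧ Anl F ∧ ∀ n : ℤ, 0 ≤ n → cf (fun θ => F θ * conj (Θ θ)) n = 0}

lemma mulT {p : ℝ} (hp : 0 ≤ p) {F Θ : ℝ → ℂ} (hΘ : AEStronglyMeasurable Θ arcM) (h1 : ∀ᵐ θ ∂arcM, ‖Θ θ‖ = 1) (hF : LP p F) :
    LP p (fun θ => F θ * conj (Θ θ)) := by
  have := hF.bdd_mul hp (h := fun θ => conj (Θ θ)) (continuous_conj.comp_aestronglyMeasurable hΘ) (C := 1) 
    (by filter_upwards [h1] with θ h; rw [RCLike.norm_conj, h])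
  simpa [mul_comm] using this

lemma KT_binv {p : ℝ} (hp : 1 ≤ p) {Θ : ℝ → ℂ} (hΘ : AEStronglyMeasurable Θ arcM) (hA : Anl Θ) (h1 : ∀ᵐ θ ∂arcM, ‖Θ θ‖ = 1) :
    BInv p (KT p Θ) := by
  have hp0 : 0 ≤ p := by linarith
  have hf := full_binv hp
  have hm : ∀ {F}, LP p F → Integrable (fun θ => F θ * conj (Θ θ)) arcM := fun h => (mulT hp0 hΘ h1 h).int hp
  have hΘi : Integrable Θ arcM := (LP.bdd hp0 hΘ (h1.mono fun θ h => h.le)).int hp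
  refine ⟨fun F h => h.1, fun F h => h.2.1, ⟨hf.zero.1, hf.zero.2, fun n _ => by simp [cf]⟩, ?_, ?_, ?_, ?_, ?_⟩
  · rintro F ⟨a, b, c⟩ G ⟨a', b', c'⟩
    have := hf.add F ⟨a, b⟩ G ⟨a', b'⟩
    refine ⟨this.1, this.2, fun n hn => ?_⟩
    simp_rw [add_mul]
    rw [cf_add (hm a) (hm a'), c n hn, c' n hn, add_zero]
  · rintro z F ⟨a, b, c⟩
    have := hf.smul z F ⟨a, b⟩
    refine ⟨this.1, this.2, fun n hn => ?_⟩
    simp_rw [mul_assoc]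
    rw [cf_smul, c n hn, mul_zero]
  · rintro F ⟨a, b, c⟩ G h
    have := hf.ae F ⟨a, b⟩ G h
    refine ⟨this.1, this.2, fun n hn => ?_⟩
    rw [← c n hn]
    refine cf_congr ?_ n
    filter_upwards [h] with θ h
    rw [h]
  · intro F a b h
    refine ⟨a, b, fun n hn => ?_⟩
    by_contra hne
    have hpos : 0 < ‖cf (fun θ => F θ * conj (Θ θ)) n‖ := norm_pos_iff.2 hne
    obtain ⟨G, ⟨a', b', c'⟩, hG⟩ := h _ (Real.rpow_pos_of_pos hpos p)
    have e1 : cf (fun θ => F θ * conj (Θ θ)) n = cf (fun θ => (F θ - G θ) * conj (Θ θ)) n := by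
      simp_rw [sub_mul]
      rw [cf_sub (hm a) (hm a'), c' n hn, sub_zero]
    have e2 : ‖cf (fun θ => F θ * conj (Θ θ)) n‖ ≤ ∫ θ, ‖F θ - G θ‖ ∂arcM := by
      rw [e1]
      refine (norm_cf_le _ n).trans (le_of_eq (integral_congr_ae ?_))
      filter_upwards [h1] with θ h
      rw [norm_mul, RCLike.norm_conj, h, mul_one]
    have e3 := l1_le_lp hp (a.sub hp0 a')
    have e4 := Real.rpow_le_rpow hpos.le e2 hp0
    linarith
  · rintro F ⟨a, b, c⟩
    have := hf.shift F ⟨a, b⟩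
    refine ⟨this.1, this.2, fun n hn => ?_⟩
    have e : (fun θ => bs F θ * conj (Θ θ)) = fun θ => bpt θ ^ (-1:ℤ) * (F θ * conj (Θ θ) - cf F 0 * conj (Θ θ)) := by
      ext θ; simp only [bs]; ring
    rw [e, cf_shift, cf_sub (hm a) (hΘi.conj'.const_mul _), cf_smul, cf_conj, c _ (by omega), hA _ (by omega)]
    simp

lemma core {p : ℝ} {M : Set (ℝ → ℂ)} (hp : 1 ≤ p) (hM : BInv p M) (hne : ∃ F, LP p F ∧ Anl F ∧ F ∉ M) :
    ∃ Θ : ℝ → ℂ, AEStronglyMeasurable Θ arcM ∧ Anl Θ ∧ (∀ᵐ θ ∂arcM, ‖Θ θ‖ = 1) ∧ M = KT p Θ := by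
  have hp0 : 0 ≤ p := by linarith
  have hb := beurling (S := {G | G ∈ M ∧ MemLp G 2 arcM}) ⟨hM.zero, memLp_const 0⟩
    (fun F hF G hG => ⟨hM.add F hF.1 G hG.1, hF.2.add hG.2⟩)
    (fun c F hF => ⟨hM.smul c F hF.1, hF.2.const_mul c⟩)
    (fun F hF G h => ⟨hM.ae F hF.1 G h, (memLp_congr_ae h).1 hF.2⟩)
    (fun F hF => hF.2) (fun F hF => hM.anl F hF.1)
    (fun F hF => ⟨hM.shift F hF.1, memLp2_iff.2 ((memLp2_iff.1 hF.2).bs (by norm_num))⟩)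
  rcases hb with h | ⟨Θ, hΘ, hΘA, hΘ1, hk, hd⟩
  · exfalso
    obtain ⟨F, hF, hFA, hFM⟩ := hne
    refine hFM (hM.closed F hF hFA fun ε hε => ?_)
    obtain ⟨G, hG, hG2, hGe⟩ := sdense hp (full_binv hp) (F := F) ⟨hF, hFA⟩ ε hε
    refine ⟨G, sclos hp hM hG.1 hG.2 hG2 fun δ hδ => ?_, hGe⟩
    obtain ⟨X, hX, hX2⟩ := h G hG2 hG.2 δ hδ
    exact ⟨X, hX.1, hX.2, hX2⟩
  · have hK := KT_binv hp hΘ.1 hΘA hΘ1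
    refine ⟨Θ, hΘ.1, hΘA, hΘ1, Set.Subset.antisymm (fun F hF => ?_) fun F hF => ?_⟩
    · refine hK.closed F (hM.lp F hF) (hM.anl F hF) fun ε hε => ?_
      obtain ⟨G, hG, hG2, hGe⟩ := sdense hp hM hF ε hε
      exact ⟨G, ⟨hM.lp G hG, hM.anl G hG, hk G ⟨hG, hG2⟩⟩, hGe⟩
    · refine hM.closed F hF.1 hF.2.1 fun ε hε => ?_
      obtain ⟨G, hG, hG2, hGe⟩ := sdense hp hK hF ε hε
      refine ⟨G, sclos hp hM hG.1 hG.2.1 hG2 fun δ hδ => ?_, hGe⟩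
      obtain ⟨X, hX, hX2⟩ := hd G hG2 hG.2.1 hG.2.2 δ hδ
      exact ⟨X, hX.1, hX.2, hX2⟩

/-- `F` is a boundary representative of `f`. -/
structure HRep (p : ℝ) (f : ℂ → ℂ) (F : ℝ → ℂ) : Prop where
  lp : LP p F
  anl : Anl F
  eq : ∀ z, ‖z‖ < 1 → cau F z = f z

lemma hMean_congr {p : ℝ} {f g : ℂ → ℂ} (h : ∀ z, ‖z‖ < 1 → f z = g z) {r : ℝ} (hr : r ∈ Ioo (0:ℝ) 1) :
    hMean p f r = hMean p g r := by
  unfold hMean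
  congr 1; ext θ
  rw [h]
  rw [norm_r_bpt hr.1.le]; exact hr.2

lemma memHp_congr {p : ℝ} {f g : ℂ → ℂ} (h : ∀ z, ‖z‖ < 1 → f z = g z) (hf : MemHp p f) : MemHp p g := by
  refine ⟨hf.1.congr fun z hz => (h z (mem_uDisc.1 hz)).symm, ?_⟩
  have : hMean p g '' Ioo 0 1 = hMean p f '' Ioo 0 1 := Set.image_congr fun r hr => (hMean_congr h hr).symm
  rw [this]; exact hf.2

lemma bdryFn_congr {f g : ℂ → ℂ} {F : ℝ → ℂ} (h : ∀ z, ‖z‖ < 1 → f z = g z) (hf : BoundaryFn f F) : BoundaryFn g F := by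
  filter_upwards [hf] with θ hθ
  refine hθ.congr' ?_
  filter_upwards [Ioo_mem_nhdsLT (show (0:ℝ) < 1 by norm_num)] with r hr
  exact h _ (by rw [norm_r_bpt hr.1.le]; exact hr.2)

lemma exists_rep {p : ℝ} (hp : 1 ≤ p) {f : ℂ → ℂ} (hf : MemHp p f) :
    ∃ F, HRep p f F ∧ ∫ θ, ‖F θ‖ ^ p ∂arcM ≤ sSup (hMean p f '' Set.Ioo 0 1) := by
  obtain ⟨F, h1, h2, h3, h4, h5, h6⟩ := T1 hp hf
  exact ⟨F, ⟨⟨h1.1, h2⟩, h3, h5⟩, h6⟩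

lemma HRep.bdry {p : ℝ} (hp : 1 ≤ p) {f : ℂ → ℂ} {F : ℝ → ℂ} (h : HRep p f F) : BoundaryFn f F :=
  bdryFn_congr h.eq (fatou_cau (h.lp.int hp) h.anl)

lemma HRep.mem {p : ℝ} (hp : 1 ≤ p) {f : ℂ → ℂ} {F : ℝ → ℂ} (h : HRep p f F) : MemHp p f :=
  memHp_congr h.eq (T2' hp (h.lp.int hp) h.lp.2 h.anl)

lemma HRep.norm {p : ℝ} (hp : 1 ≤ p) {f : ℂ → ℂ} {F : ℝ → ℂ} (h : HRep p f F) :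
    hardyNorm p f = (∫ θ, ‖F θ‖ ^ p ∂arcM) ^ (1 / p) := by
  have hp0 : 0 < p := by linarith
  have e1 : min 1 (1 / p) = 1 / p := min_eq_right (by rw [div_le_one hp0]; exact hp)
  rw [hardyNorm, e1]
  congr 1
  obtain ⟨G, hG, hGle⟩ := exists_rep hp (h.mem hp)
  have ae := bdry_unique (h.bdry hp) (hG.bdry hp)
  apply le_antisymm
  · refine csSup_le (Set.Nonempty.image _ ⟨1/2, by norm_num, by norm_num⟩) ?_
    rintro _ ⟨r, hr, rfl⟩
    rw [← hMean_congr h.eq hr]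
    exact T2 hp (h.lp.int hp) h.lp.2 h.anl hr.1.le hr.2
  · refine le_trans (le_of_eq (integral_congr_ae ?_)) hGle
    filter_upwards [ae] with θ hθ
    rw [hθ]

lemma HRep.lin {p : ℝ} (hp : 1 ≤ p) {f g : ℂ → ℂ} {F G : ℝ → ℂ} (hf : HRep p f F) (hg : HRep p g G) (a b : ℂ) :
    HRep p (fun z => a * f z + b * g z) (fun θ => a * F θ + b * G θ) := by
  have hp0 : 0 ≤ p := by linarith
  have hb := full_binv hp
  have h1 := hb.add _ (hb.smul a F ⟨hf.lp, hf.anl⟩) _ (hb.smul b G ⟨hg.lp, hg.anl⟩)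
  refine ⟨h1.1, h1.2, fun z hz => ?_⟩
  rw [cau_lin (hf.lp.int hp) (hg.lp.int hp) a b hz, hf.eq z hz, hg.eq z hz]

lemma HRep.sub {p : ℝ} (hp : 1 ≤ p) {f g : ℂ → ℂ} {F G : ℝ → ℂ} (hf : HRep p f F) (hg : HRep p g G) :
    HRep p (fun z => f z - g z) (fun θ => F θ - G θ) := by
  have := hf.lin hp hg 1 (-1)
  simpa [← sub_eq_add_neg] using this

lemma cau_bs {F : ℝ → ℂ} (hF : Integrable F arcM) {z : ℂ} (hz : ‖z‖ < 1) : cau F z = cf F 0 + z * cau (bs F) z := by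
  have h1 := cau_hasSum hF hz
  have h2 := (cau_hasSum (bs_int hF) hz).mul_left z
  have h3 := (hasSum_nat_add_iff' 1).2 h1
  have h4 : (fun n : ℕ => z * (cf (bs F) n * z ^ n)) = fun n : ℕ => cf F ((n + 1 : ℕ):ℤ) * z ^ (n + 1) := by
    ext n
    rw [bs_cf hF _ (by omega)]
    push_cast; ring
  rw [h4] at h2
  have := h2.unique h3
  rw [this]; simp

lemma HRep.shift {p : ℝ} (hp : 1 ≤ p) {f : ℂ → ℂ} {F : ℝ → ℂ} (h : HRep p f F) : HRep p (bShift f) (bs F) := by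
  have hFi := h.lp.int hp
  have hs := (full_binv hp).shift F ⟨h.lp, h.anl⟩
  have hf0 : f 0 = cf F 0 := by rw [← h.eq 0 (by simp), cau_zero]
  refine ⟨hs.1, hs.2, fun z hz => ?_⟩
  by_cases hz0 : z = 0
  · subst hz0
    simp only [bShift, if_true]
    have hd : DifferentiableAt ℂ (cau (bs F)) 0 :=
      (cau_analytic (bs_int hFi)).differentiableAt (Metric.ball_mem_nhds 0 one_pos)
    have h2 : HasDerivAt (fun z => cf F 0 + z * cau (bs F) z) (1 * cau (bs F) 0 + 0 * deriv (cau (bs F)) 0) 0 :=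
      ((hasDerivAt_id (0:ℂ)).mul hd.hasDerivAt).const_add _
    have h3 : f =ᶠ[𝓝 0] (fun z => cf F 0 + z * cau (bs F) z) := by
      filter_upwards [Metric.ball_mem_nhds (0:ℂ) one_pos] with w hw
      have hw' : ‖w‖ < 1 := by simpa using hw
      rw [← h.eq w hw', cau_bs hFi hw']
    rw [(h2.congr_of_eventuallyEq h3).deriv]; simp
  · simp only [bShift, if_neg hz0]
    rw [← h.eq z hz, hf0, cau_bs hFi hz]
    field_simp
    ring

lemma K_iff {p : ℝ} (hp : 1 ≤ p) {ϑ : ℂ → ℂ} {Θ : ℝ → ℂ} (hb : BoundaryFn ϑ Θ) (hΘ : AEStronglyMeasurable Θ arcM)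
    (h1 : ∀ᵐ θ ∂arcM, ‖Θ θ‖ = 1) {f : ℂ → ℂ} {F : ℝ → ℂ} (hF : HRep p f F) : PseudoCont p ϑ f ↔ F ∈ KT p Θ := by
  have hp0 : 0 ≤ p := by linarith
  have hsq : ∀ᵐ θ ∂arcM, Θ θ * conj (Θ θ) = 1 := by
    filter_upwards [h1] with θ h
    rw [Complex.mul_conj, Complex.normSq_eq_norm_sq, h]; simp
  constructor
  · rintro ⟨F1, Θ1, G1, g, b1, b2, hg, g0, b3, he⟩
    obtain ⟨G, hG, -⟩ := exists_rep hp hg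
    refine ⟨hF.lp, hF.anl, fun n hn => ?_⟩
    have ae : (fun θ => F θ * conj (Θ θ)) =ᵐ[arcM] fun θ => conj (G θ) := by
      filter_upwards [he, bdry_unique b1 (hF.bdry hp), bdry_unique b2 hb, bdry_unique b3 (hG.bdry hp), hsq] with θ x1 x2 x3 x4 x5
      rw [← x2, x1, x3, x4]
      linear_combination conj (G θ) * x5
    rw [cf_congr ae, cf_conj]
    have : cf G (-n) = 0 := by
      rcases hn.eq_or_lt with h | h
      · rw [← h, neg_zero, ← cau_zero, hG.eq 0 (by simp), g0]
      · exact hG.anl _ (by omega)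
    rw [this, map_zero]
  · rintro ⟨a, b, c⟩
    have hX := (mulT hp0 hΘ h1 a).conj
    have hc : ∀ n : ℤ, n ≤ 0 → cf (fun θ => conj (F θ * conj (Θ θ))) n = 0 := fun n hn => by
      rw [cf_conj, c _ (by omega), map_zero]
    have hR : HRep p (cau (fun θ => conj (F θ * conj (Θ θ)))) (fun θ => conj (F θ * conj (Θ θ))) :=
      ⟨hX, fun n hn => hc n hn.le, fun z _ => rfl⟩
    refine ⟨F, Θ, _, _, hF.bdry hp, hb, hR.mem hp, ?_, hR.bdry hp, ?_⟩
    · rw [cau_zero]; exact hc 0 le_rfl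
    · filter_upwards [hsq] with θ h
      rw [Complex.conj_conj]
      linear_combination -F θ * h

lemma bridge {p : ℝ} (hp : 1 ≤ p) {M : Set (ℂ → ℂ)}
    (hzero : (fun _ : ℂ => (0 : ℂ)) ∈ M)
    (hadd : ∀ f ∈ M, ∀ g ∈ M, (fun z => f z + g z) ∈ M)
    (hsmul : ∀ c : ℂ, ∀ f ∈ M, (fun z => c * f z) ∈ M)
    (hc : ∀ f ∈ M, ∀ g, (∀ z, ‖z‖ < 1 → f z = g z) → g ∈ M)
    (hclosed : ∀ f : ℂ → ℂ, MemHp p f →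
      (∀ ε > (0 : ℝ), ∃ g ∈ M, hardyNorm p (fun z => f z - g z) < ε) → f ∈ M)
    (hs : ∀ f ∈ M, bShift f ∈ M) : BInv p {F | LP p F ∧ Anl F ∧ cau F ∈ M} := by
  have hp0 : 0 < p := by linarith
  have hb := full_binv hp
  have rep : ∀ {F}, LP p F → Anl F → HRep p (cau F) F := fun h1 h2 => ⟨h1, h2, fun _ _ => rfl⟩
  refine ⟨fun F h => h.1, fun F h => h.2.1, ?_, ?_, ?_, ?_, ?_, ?_⟩
  · refine ⟨hb.zero.1, hb.zero.2, hc _ hzero _ fun z hz => ?_⟩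
    simp [cau]
  · rintro F ⟨a, b, c⟩ G ⟨a', b', c'⟩
    have h := hb.add F ⟨a, b⟩ G ⟨a', b'⟩
    refine ⟨h.1, h.2, hc _ (hadd _ c _ c') _ fun z hz => ?_⟩
    have := ((rep a b).lin hp (rep a' b') 1 1).eq z hz
    simp only [one_mul] at this
    exact this.symm
  · rintro k F ⟨a, b, c⟩
    have h := hb.smul k F ⟨a, b⟩
    refine ⟨h.1, h.2, hc _ (hsmul k _ c) _ fun z hz => ?_⟩
    have := ((rep a b).lin hp (rep a b) k 0).eq z hz
    simp only [zero_mul, add_zero] at this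
    exact this.symm
  · rintro F ⟨a, b, c⟩ G h
    have h' := hb.ae F ⟨a, b⟩ G h
    refine ⟨h'.1, h'.2, hc _ c _ fun z hz => ?_⟩
    refine integral_congr_ae ?_
    filter_upwards [h] with θ h
    rw [h]
  · intro F a b h
    refine ⟨a, b, hclosed _ ((rep a b).mem hp) fun ε hε => ?_⟩
    obtain ⟨G, ⟨a', b', c'⟩, hG⟩ := h (ε ^ p) (Real.rpow_pos_of_pos hε p)
    refine ⟨_, c', ?_⟩
    rw [((rep a b).sub hp (rep a' b')).norm hp]
    have h0 : 0 ≤ ∫ θ, ‖F θ - G θ‖ ^ p ∂arcM := integral_nonneg fun θ => by positivity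
    have := Real.rpow_lt_rpow h0 hG (show 0 < 1 / p by positivity)
    rwa [← Real.rpow_mul hε.le, mul_one_div_cancel hp0.ne', Real.rpow_one] at this
  · rintro F ⟨a, b, c⟩
    have h := hb.shift F ⟨a, b⟩
    exact ⟨h.1, h.2, hc _ (hs _ c) _ fun z hz => (((rep a b).shift hp).eq z hz).symm⟩

lemma final {p : ℝ} (hp : 1 ≤ p) (M : Set (ℂ → ℂ))
    (hsub : ∀ f ∈ M, MemHp p f)
    (hzero : (fun _ : ℂ => (0 : ℂ)) ∈ M)
    (hadd : ∀ f ∈ M, ∀ g ∈ M, (fun z => f z + g z) ∈ M)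
    (hsmul : ∀ c : ℂ, ∀ f ∈ M, (fun z => c * f z) ∈ M)
    (hclosed : ∀ f : ℂ → ℂ, MemHp p f →
      (∀ ε > (0 : ℝ), ∃ g ∈ M, hardyNorm p (fun z => f z - g z) < ε) → f ∈ M)
    (hproper : ∃ f : ℂ → ℂ, MemHp p f ∧ f ∉ M) :
    (∀ f ∈ M, bShift f ∈ M) ↔
      ∃ ϑ : ℂ → ℂ, IsInner ϑ ∧ M = {f | MemHp p f ∧ PseudoCont p ϑ f} := by
  have hp0 : 0 < p := by linarith
  constructor
  · intro hs
    have hc : ∀ f ∈ M, ∀ g, (∀ z, ‖z‖ < 1 → f z = g z) → g ∈ M := by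
      intro f hf g h
      obtain ⟨F, hF, -⟩ := exists_rep hp (hsub f hf)
      have hG : HRep p g F := ⟨hF.lp, hF.anl, fun z hz => (hF.eq z hz).trans (h z hz)⟩
      refine hclosed g (hG.mem hp) fun ε hε => ⟨f, hf, ?_⟩
      rw [(hG.sub hp hF).norm hp]
      simpa [Real.zero_rpow hp0.ne', Real.zero_rpow (inv_ne_zero hp0.ne')] using hε
    have hB := bridge hp hzero hadd hsmul hc hclosed hs
    have hiff : ∀ {f F}, HRep p f F → (f ∈ M ↔ F ∈ {F | LP p F ∧ Anl F ∧ cau F ∈ M}) := fun {f F} h =>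
      ⟨fun hf => ⟨h.lp, h.anl, hc f hf _ fun z hz => (h.eq z hz).symm⟩, fun hF => hc _ hF.2.2 _ h.eq⟩
    obtain ⟨f, hf, hfM⟩ := hproper
    obtain ⟨F, hF, -⟩ := exists_rep hp hf
    obtain ⟨Θ, hΘ, hΘA, hΘ1, hK⟩ := core hp hB ⟨F, hF.lp, hF.anl, fun h => hfM ((hiff hF).2 h)⟩
    have hΘi : Integrable Θ arcM := (LP.bdd hp0.le hΘ (hΘ1.mono fun θ h => h.le)).int hp
    have hbd := fatou_cau hΘi hΘA
    refine ⟨cau Θ, ⟨⟨cau_analytic hΘi, 1, fun z hz => ?_⟩, Θ, hbd, hΘ1⟩, ?_⟩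
    · rw [← pois_anl hΘi hΘA (mem_uDisc.1 hz)]
      exact norm_pois_le_bdd hΘi (hΘ1.mono fun θ h => h.le) (mem_uDisc.1 hz)
    · ext g
      constructor
      · intro hg
        obtain ⟨G, hG, -⟩ := exists_rep hp (hsub g hg)
        exact ⟨hsub g hg, (K_iff hp hbd hΘ hΘ1 hG).2 (hK ▸ (hiff hG).1 hg)⟩
      · rintro ⟨h1, h2⟩
        obtain ⟨G, hG, -⟩ := exists_rep hp h1
        refine (hiff hG).2 ?_
        rw [hK]
        exact (K_iff hp hbd hΘ hΘ1 hG).1 h2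
  · rintro ⟨ϑ, ⟨⟨ha, C, hC⟩, Θ, hb, h1⟩, rfl⟩ f ⟨hf, hP⟩
    obtain ⟨hΘ, -, hΘA, -⟩ := bddAnalytic ha (fun z hz => hC z (mem_uDisc.2 hz)) hb
    obtain ⟨F, hF, -⟩ := exists_rep hp hf
    have hFK := (K_iff hp hb hΘ h1 hF).1 hP
    exact ⟨(hF.shift hp).mem hp, (K_iff hp hb hΘ h1 (hF.shift hp)).2 ((KT_binv hp hΘ hΘA h1).shift F hFK)⟩

/-- Douglas–Shapiro–Shields / Proposition 2.1: for `1 ≤ p < ∞`, a proper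
closed subspace `M` of `H^p` is invariant under the backward shift if and only if
`M = K^p_ϑ = H^p ∩ ϑ ⋅ conj(H^p_0)` for some inner function `ϑ`. -/
theorem backward_shift_invariant_subspaces_Hp
    (p : ℝ) (hp : 1 ≤ p) (M : Set (ℂ → ℂ))
    (hsub : ∀ f ∈ M, MemHp p f)
    (hzero : (fun _ : ℂ => (0 : ℂ)) ∈ M)
    (hadd : ∀ f ∈ M, ∀ g ∈ M, (fun z => f z + g z) ∈ M)
    (hsmul : ∀ c : ℂ, ∀ f ∈ M, (fun z => c * f z) ∈ M)
    (hclosed : ∀ f : ℂ → ℂ, MemHp p f →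
      (∀ ε > (0 : ℝ), ∃ g ∈ M, hardyNorm p (fun z => f z - g z) < ε) → f ∈ M)
    (hproper : ∃ f : ℂ → ℂ, MemHp p f ∧ f ∉ M) :
    (∀ f ∈ M, bShift f ∈ M) ↔
      ∃ ϑ : ℂ → ℂ, IsInner ϑ ∧ M = {f | MemHp p f ∧ PseudoCont p ϑ f} := by
  exact final hp M hsub hzero hadd hsmul hclosed hproper
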